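/- Let d ≥ 3, k ≥ 0, R = ℤ[x_1,…,x_k], and let U be an ideal of finite index in R. Then the quotient group G(U)/EL(d;U) is finite, and it is central in SL_d(R)/EL(d;U); equivalently, for every g ∈ SL_d(R) and every h ∈ G(U), the commutator g·h·g^{−1}·h^{−1} lies in EL(d;U). -/

import Mathlib

/-- The elementary matrix `E_{ij}(r)`: the identity matrix with the entry `r`
added in position `(i,j)`, as an element of `SL_d(A)`. -/
def elem {A : Type*} [CommRing A] {d : ℕ} (i j : Fin d) (h : i ≠ j) (r : A) :
    Matrix.SpecialLinearGroup (Fin d) A :=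
  ⟨Matrix.transvection i j r, Matrix.det_transvection_of_ne i j h r⟩

/-- `EL(d;U)`: the normal subgroup of `SL_d(R)` generated by the elementary matrices
`E_{ij}(u)` with `u ∈ U`. -/
def EL {R : Type*} [CommRing R] (d : ℕ) (U : Ideal R) :
    Subgroup (Matrix.SpecialLinearGroup (Fin d) R) :=
  Subgroup.normalClosure
    {g | ∃ (i j : Fin d) (h : i ≠ j) (u : R), u ∈ U ∧ g = elem i j h u}

/-- The principal congruence subgroup `G(U)`: the kernel of the reduction map
`SL_d(R) → SL_d(R/U)`, i.e. the matrices congruent to the identity modulo `U`. -/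
def congSubgroup {R : Type*} [CommRing R] (d : ℕ) (U : Ideal R) :
    Subgroup (Matrix.SpecialLinearGroup (Fin d) R) :=
  (Matrix.SpecialLinearGroup.map (Ideal.Quotient.mk U)).ker

section Part1
set_option linter.unusedSimpArgs false
open Matrix

/-- The elementary subgroup. -/
def El (n : ℕ) (R : Type*) [CommRing R] : Subgroup (SpecialLinearGroup (Fin n) R) :=
  Subgroup.closure {g | ∃ (i j : Fin n) (h : i ≠ j) (r : R), g = elem i j h r}

section basics
variable {n : ℕ} {R : Type*} [CommRing R] {S : Type*} [CommRing S]

theorem SLext {g h : SpecialLinearGroup (Fin n) R}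
    (H : (g : Matrix (Fin n) (Fin n) R) = h) : g = h := Subtype.ext H

theorem elem_mem_El (i j : Fin n) (h : i ≠ j) (r : R) : elem i j h r ∈ El n R :=
  Subgroup.subset_closure ⟨i, j, h, r, rfl⟩

theorem coe_elem (i j : Fin n) (h : i ≠ j) (r : R) :
    (elem i j h r : Matrix (Fin n) (Fin n) R) = 1 + Matrix.single i j r := rfl

theorem elem_add (i j : Fin n) (h : i ≠ j) (r s : R) :
    elem i j h (r + s) = elem i j h r * elem i j h s := by
  apply SLext
  exact (Matrix.transvection_mul_transvection_same i j h r s).symm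

theorem elem_zero (i j : Fin n) (h : i ≠ j) : elem i j h (0 : R) = 1 := by
  apply SLext
  exact Matrix.transvection_zero i j

theorem elem_neg (i j : Fin n) (h : i ≠ j) (r : R) :
    elem i j h (-r) = (elem i j h r)⁻¹ := by
  rw [eq_inv_iff_mul_eq_one, ← elem_add, neg_add_cancel, elem_zero]

theorem map_elem (f : R →+* S) (i j : Fin n) (h : i ≠ j) (r : R) :
    Matrix.SpecialLinearGroup.map f (elem i j h r) = elem i j h (f r) := by
  apply SLext
  ext a b
  change f ((1 + Matrix.single i j r : Matrix (Fin n) (Fin n) R) a b) =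
    (1 + Matrix.single i j (f r) : Matrix (Fin n) (Fin n) S) a b
  simp only [Matrix.add_apply, Matrix.single_apply, Matrix.one_apply]
  split_ifs <;> simp

theorem map_mem_El (f : R →+* S) {g : SpecialLinearGroup (Fin n) R} (hg : g ∈ El n R) :
    Matrix.SpecialLinearGroup.map f g ∈ El n S := by
  have : El n R ≤ (El n S).comap (Matrix.SpecialLinearGroup.map f) := by
    rw [El, Subgroup.closure_le]
    rintro _ ⟨i, j, h, r, rfl⟩
    simp only [Subgroup.coe_comap, Set.mem_preimage, SetLike.mem_coe]
    rw [map_elem]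
    exact elem_mem_El _ _ _ _
  exact this hg

theorem elem_comm_of_ne (i j k l : Fin n) (h : i ≠ j) (h' : k ≠ l) (hjk : j ≠ k) (hil : i ≠ l)
    (r s : R) : elem i j h r * elem k l h' s = elem k l h' s * elem i j h r := by
  apply SLext
  simp only [Matrix.SpecialLinearGroup.coe_mul, coe_elem]
  simp [add_mul, mul_add, Matrix.single_mul_single_of_ne, hjk, hil.symm]
  abel

theorem elem_commutator (i j k : Fin n) (hij : i ≠ j) (hjk : j ≠ k) (hik : i ≠ k) (r s : R) :
    elem i j hij r * elem j k hjk s =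
      elem i k hik (r * s) * elem j k hjk s * elem i j hij r := by
  apply SLext
  simp only [Matrix.SpecialLinearGroup.coe_mul, coe_elem]
  simp [add_mul, mul_add, Matrix.single_mul_single_of_ne, Matrix.single_mul_single_same,
    hij, hjk, hik, hij.symm, hjk.symm, hik.symm]
  abel

/-- A matrix which is (the underlying matrix of) an elementary one. -/
def IsEl (M : Matrix (Fin n) (Fin n) R) : Prop := ∃ g ∈ El n R, (g : Matrix (Fin n) (Fin n) R) = M

theorem IsEl.one : IsEl (1 : Matrix (Fin n) (Fin n) R) := ⟨1, one_mem _, rfl⟩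

theorem IsEl.mul {M N : Matrix (Fin n) (Fin n) R} (hM : IsEl M) (hN : IsEl N) : IsEl (M * N) := by
  obtain ⟨g, hg, rfl⟩ := hM
  obtain ⟨g', hg', rfl⟩ := hN
  exact ⟨g * g', mul_mem hg hg', rfl⟩

theorem IsEl.mem {g : SpecialLinearGroup (Fin n) R} (h : IsEl (g : Matrix (Fin n) (Fin n) R)) : g ∈ El n R := by
  obtain ⟨g', hg', h⟩ := h
  rwa [← SLext h]

theorem isEl_single (i j : Fin n) (h : i ≠ j) (r : R) : IsEl (1 + Matrix.single i j r) :=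
  ⟨elem i j h r, elem_mem_El _ _ _ _, rfl⟩

theorem vmv_mul (v w v' w' : Fin n → R) :
    vecMulVec v w * vecMulVec v' w' = (w ⬝ᵥ v') • vecMulVec v w' := by
  rw [vecMulVec_mul_vecMulVec]
  ext i j
  simp [vecMulVec_apply]
  ring

theorem isEl_sum_right {κ : Type*} (s : Finset κ) (v : Fin n → R) (w : κ → Fin n → R)
    (h0 : ∀ a ∈ s, w a ⬝ᵥ v = 0) (h : ∀ a ∈ s, IsEl (1 + vecMulVec v (w a))) :
    IsEl (1 + vecMulVec v (∑ a ∈ s, w a)) := by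
  classical
  induction s using Finset.induction_on with
  | empty => simpa using IsEl.one
  | insert a s ha ih =>
    rw [Finset.sum_insert ha]
    have e : 1 + vecMulVec v (w a + ∑ b ∈ s, w b) =
        (1 + vecMulVec v (w a)) * (1 + vecMulVec v (∑ b ∈ s, w b)) := by
      rw [vecMulVec_add, add_mul, one_mul, mul_add, mul_one, vmv_mul, h0 a (by simp)]
      simp; abel
    rw [e]
    exact (h a (by simp)).mul (ih (fun b hb => h0 b (by simp [hb])) (fun b hb => h b (by simp [hb])))

theorem isEl_sum_left {κ : Type*} (s : Finset κ) (v : κ → Fin n → R) (w : Fin n → R)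
    (h0 : ∀ a ∈ s, w ⬝ᵥ v a = 0) (h : ∀ a ∈ s, IsEl (1 + vecMulVec (v a) w)) :
    IsEl (1 + vecMulVec (∑ a ∈ s, v a) w) := by
  classical
  induction s using Finset.induction_on with
  | empty => simpa using IsEl.one
  | insert a s ha ih =>
    rw [Finset.sum_insert ha]
    have e : 1 + vecMulVec (v a + ∑ b ∈ s, v b) w =
        (1 + vecMulVec (∑ b ∈ s, v b) w) * (1 + vecMulVec (v a) w) := by
      rw [add_vecMulVec, add_mul, one_mul, mul_add, mul_one, vmv_mul, h0 a (by simp)]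
      simp; abel
    rw [e]
    exact (ih (fun b hb => h0 b (by simp [hb])) (fun b hb => h b (by simp [hb]))).mul (h a (by simp))

theorem vmv_single (i j : Fin n) (a b : R) :
    vecMulVec (Pi.single i a) (Pi.single j b) = Matrix.single i j (a * b) := by
  ext p q
  simp only [vecMulVec_apply, Matrix.single_apply, Pi.single_apply]
  split_ifs <;> simp_all

theorem isEl_row (p : Fin n) (c : R) (w : Fin n → R) (hw : w p = 0) :
    IsEl (1 + vecMulVec (Pi.single p c) w) := by
  have e : w = ∑ q, Pi.single q (w q) := by
    ext x; simp [Finset.sum_apply, Pi.single_apply]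
  rw [e]
  apply isEl_sum_right
  · intro q _
    by_cases hq : q = p
    · subst hq; simp [hw]
    · simp [Pi.single_apply, hq]
  · intro q _
    by_cases hq : q = p
    · subst hq; simpa [hw] using IsEl.one
    · rw [vmv_single]; exact isEl_single _ _ (Ne.symm hq) _

theorem isEl_col (p : Fin n) (c : R) (v : Fin n → R) (hv : v p = 0) :
    IsEl (1 + vecMulVec v (Pi.single p c)) := by
  have e : v = ∑ q, Pi.single q (v q) := by
    ext x; simp [Finset.sum_apply, Pi.single_apply]
  rw [e]
  apply isEl_sum_left
  · intro q _
    by_cases hq : q = p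
    · subst hq; simp [hv]
    · simp [Pi.single_apply, Ne.symm hq]
  · intro q _
    by_cases hq : q = p
    · subst hq; simpa [hv] using IsEl.one
    · rw [vmv_single]; exact isEl_single _ _ hq _

theorem isEl_third (l : Fin n) (v w : Fin n → R) (hv : v l = 0) (hw : w l = 0)
    (hwv : w ⬝ᵥ v = 0) : IsEl (1 + vecMulVec v w) := by
  have e : 1 + vecMulVec v w =
      (1 + vecMulVec v (Pi.single l 1)) * (1 + vecMulVec (Pi.single l 1) w) *
      (1 + vecMulVec v (Pi.single l (-1))) * (1 + vecMulVec (Pi.single l (-1)) w) := by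
    have e1 : vecMulVec v (Pi.single l (-1 : R)) = - vecMulVec v (Pi.single l (1 : R)) := by
      ext i j; simp [vecMulVec_apply, Pi.single_apply]; split_ifs <;> simp
    have e2 : vecMulVec (Pi.single l (-1 : R)) w = - vecMulVec (Pi.single l (1 : R)) w := by
      ext i j; simp [vecMulVec_apply, Pi.single_apply]; split_ifs <;> simp
    rw [e1, e2]
    simp only [mul_add, add_mul, mul_one, one_mul, mul_neg, neg_mul, vmv_mul]
    simp [hv, hw, hwv, vmv_mul, smul_mul_assoc]
    abel
  rw [e]
  exact (((isEl_col l _ v hv).mul (isEl_row l _ w hw)).mul (isEl_col l _ v hv)).mul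
    (isEl_row l _ w hw)

theorem isEl_pair (hn : 3 ≤ n) (k l : Fin n) (hkl : k ≠ l) (c : R) (v : Fin n → R) :
    IsEl (1 + vecMulVec v (Pi.single k (c * v l) - Pi.single l (c * v k))) := by
  set w : Fin n → R := Pi.single k (c * v l) - Pi.single l (c * v k) with hw
  have hwp : ∀ p, p ≠ k → p ≠ l → w p = 0 := by
    intro p h1 h2; simp [hw, Pi.single_apply, h1, h2]
  obtain ⟨m, hmk, hml⟩ : ∃ m : Fin n, m ≠ k ∧ m ≠ l := by
    obtain ⟨m, hm⟩ := Finset.exists_mem_notMem_of_card_lt_card (s := {k, l}) (t := Finset.univ)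
      (lt_of_le_of_lt Finset.card_le_two (by simp; omega))
    exact ⟨m, by simpa [not_or] using hm.2⟩
  set v' : Fin n → R := Pi.single k (v k) + Pi.single l (v l) with hv'
  have hwv' : w ⬝ᵥ v' = 0 := by
    simp [hw, hv', Pi.single_apply, hkl, hkl.symm]; ring
  set v'' : Fin n → R := ∑ p ∈ Finset.univ.filter (fun p => p ≠ k ∧ p ≠ l), Pi.single p (v p)
    with hv''
  have hv : v = ∑ b : Bool, (if b then v' else v'') := by
    ext x
    simp only [Fintype.sum_bool, if_true, Bool.false_eq_true, if_false, Pi.add_apply, hv', hv'',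
      Finset.sum_apply, Pi.single_apply]
    rw [Finset.sum_ite_eq]
    by_cases h1 : x = k
    · subst h1; simp [hkl]
    · by_cases h2 : x = l
      · subst h2; simp [h1]
      · simp [h1, h2]
  have h0'' : ∀ p ∈ Finset.univ.filter (fun p => p ≠ k ∧ p ≠ l), w ⬝ᵥ Pi.single p (v p) = 0 := by
    intro p hp
    simp at hp
    simp [hwp p hp.1 hp.2]
  rw [hv]
  apply isEl_sum_left
  · intro b _
    cases b
    · simp only [Bool.false_eq_true, if_false, hv'']
      rw [dotProduct_sum]
      exact Finset.sum_eq_zero h0''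
    · simpa using hwv'
  · intro b _
    cases b
    · simp only [Bool.false_eq_true, if_false, hv'']
      apply isEl_sum_left _ _ _ h0''
      intro p hp
      simp at hp
      exact isEl_row _ _ _ (hwp p hp.1 hp.2)
    · simp only [if_true]
      exact isEl_third m v' w (by simp [hv', Pi.single_apply, hmk, hml])
        (hwp m hmk hml) hwv'

/-- The basic lemma of Suslin. -/
theorem isEl_suslin (hn : 3 ≤ n) (v w y : Fin n → R) (h : w ⬝ᵥ v = 0) :
    IsEl (1 + vecMulVec v ((y ⬝ᵥ v) • w)) := by
  have e : (y ⬝ᵥ v) • w = ∑ p : Fin n × Fin n,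
      (Pi.single p.1 ((w p.1 * y p.2) * v p.2) - Pi.single p.2 ((w p.1 * y p.2) * v p.1)) := by
    ext x
    rw [Finset.sum_apply, Fintype.sum_prod_type]
    simp only [Pi.sub_apply, Finset.sum_sub_distrib, Pi.smul_apply, smul_eq_mul]
    have h1 : ∑ a, ∑ b, (Pi.single a (w a * y b * v b) : Fin n → R) x = (y ⬝ᵥ v) * w x := by
      rw [Finset.sum_comm]
      simp only [Pi.single_apply, Finset.sum_ite_eq, Finset.mem_univ, if_true, dotProduct,
        Finset.sum_mul]
      exact Finset.sum_congr rfl fun _ _ => by ring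
    have h2 : ∑ a, ∑ b, (Pi.single b (w a * y b * v a) : Fin n → R) x = (w ⬝ᵥ v) * y x := by
      simp only [Pi.single_apply, Finset.sum_ite_eq, Finset.mem_univ, if_true, dotProduct,
        Finset.sum_mul]
      exact Finset.sum_congr rfl fun _ _ => by ring
    rw [h1, h2, h]; ring
  rw [e]
  apply isEl_sum_right
  · rintro ⟨k, l⟩ _
    simp [sub_dotProduct]; ring
  · rintro ⟨k, l⟩ _
    by_cases hkl : k = l
    · subst hkl; simpa using IsEl.one
    · exact isEl_pair hn k l hkl _ v

theorem coe_conj_elem (g : SpecialLinearGroup (Fin n) R) (i j : Fin n) (h : i ≠ j) (r : R) :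
    ((g * elem i j h r * g⁻¹ : SpecialLinearGroup (Fin n) R) : Matrix (Fin n) (Fin n) R) =
      1 + vecMulVec (fun a => g a i) (fun b => r * (g⁻¹ : SpecialLinearGroup (Fin n) R) j b) := by
  have h1 : (g : Matrix (Fin n) (Fin n) R) * (g⁻¹ : SpecialLinearGroup (Fin n) R) = 1 := by
    rw [← Matrix.SpecialLinearGroup.coe_mul, mul_inv_cancel, Matrix.SpecialLinearGroup.coe_one]
  rw [Matrix.SpecialLinearGroup.coe_mul, Matrix.SpecialLinearGroup.coe_mul, coe_elem, mul_add, add_mul, mul_one, h1]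
  congr 1
  ext a b
  rw [Matrix.mul_apply]
  simp only [vecMulVec_apply]
  rw [Finset.sum_eq_single j]
  · simp [mul_assoc]
  · intro c _ hc
    rw [Matrix.mul_single_apply_of_ne _ _ _ _ _ hc, zero_mul]
  · simp

theorem conj_dot (g : SpecialLinearGroup (Fin n) R) (i j : Fin n) :
    (fun b => (g⁻¹ : SpecialLinearGroup (Fin n) R) j b) ⬝ᵥ (fun a => g a i) =
      (1 : Matrix (Fin n) (Fin n) R) j i := by
  have h1 : ((g⁻¹ : SpecialLinearGroup (Fin n) R) : Matrix (Fin n) (Fin n) R) * g = 1 := by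
    rw [← Matrix.SpecialLinearGroup.coe_mul, inv_mul_cancel, Matrix.SpecialLinearGroup.coe_one]
  rw [← h1, Matrix.mul_apply]; rfl

theorem conj_elem_mem (hn : 3 ≤ n) (g : SpecialLinearGroup (Fin n) R) (i j : Fin n) (h : i ≠ j)
    (r : R) : g * elem i j h r * g⁻¹ ∈ El n R := by
  apply IsEl.mem
  rw [coe_conj_elem]
  have := isEl_suslin hn (fun a => g a i) (fun b => r * (g⁻¹ : SpecialLinearGroup (Fin n) R) j b)
    (fun b => (g⁻¹ : SpecialLinearGroup (Fin n) R) i b) (by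
      have := conj_dot g i j
      rw [Matrix.one_apply_ne h.symm] at this
      change (r • fun b => (g⁻¹ : SpecialLinearGroup (Fin n) R) j b) ⬝ᵥ _ = 0
      rw [smul_dotProduct, this, smul_zero])
  rwa [conj_dot g i i, Matrix.one_apply_eq, one_smul] at this

theorem El_normal (hn : 3 ≤ n) : (El n R).Normal := by
  constructor
  intro e he g
  have : El n R ≤ (El n R).comap (MulAut.conj g).toMonoidHom := by
    conv_lhs => rw [El]
    rw [Subgroup.closure_le]
    rintro _ ⟨i, j, h, r, rfl⟩
    exact conj_elem_mem hn g i j h r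
  exact this he

end basics

section relative
variable {n : ℕ} {R : Type*} [CommRing R]

instance EL_normal' (U : Ideal R) : (EL n U).Normal := by unfold EL; infer_instance

theorem elem_mem_EL (U : Ideal R) (i j : Fin n) (h : i ≠ j) (u : R) (hu : u ∈ U) :
    elem i j h u ∈ EL n U := Subgroup.subset_normalClosure ⟨i, j, h, u, hu, rfl⟩

/-- The double of a ring along an ideal. -/
def dbl (U : Ideal R) : Subring (R × R) :=
  RingHom.eqLocus ((Ideal.Quotient.mk U).comp (RingHom.fst R R))
    ((Ideal.Quotient.mk U).comp (RingHom.snd R R))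

theorem relative_comm (hn : 3 ≤ n) (U : Ideal R) (e h : SpecialLinearGroup (Fin n) R)
    (he : e ∈ El n R) (hh : h ∈ congSubgroup n U) : e * h * e⁻¹ * h⁻¹ ∈ EL n U := by
  let p1 : dbl U →+* R := (RingHom.fst R R).comp (dbl U).subtype
  let p2 : dbl U →+* R := (RingHom.snd R R).comp (dbl U).subtype
  let dg : R →+* dbl U := ((RingHom.id R).prod (RingHom.id R)).codRestrict (dbl U) (by
    intro x; simp [dbl])
  let q : SpecialLinearGroup (Fin n) R →* SpecialLinearGroup (Fin n) R ⧸ EL n U :=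
    QuotientGroup.mk' _
  have key : El n (dbl U) ≤ MonoidHom.eqLocus (q.comp (Matrix.SpecialLinearGroup.map p1))
      (q.comp (Matrix.SpecialLinearGroup.map p2)) := by
    rw [El, Subgroup.closure_le]
    rintro _ ⟨i, j, hij, r, rfl⟩
    change q (Matrix.SpecialLinearGroup.map p1 _) = q (Matrix.SpecialLinearGroup.map p2 _)
    rw [map_elem, map_elem]
    symm
    change ((elem i j hij (p2 r) : SpecialLinearGroup (Fin n) R) : _ ⧸ EL n U) = (elem i j hij (p1 r) : SpecialLinearGroup (Fin n) R)
    rw [QuotientGroup.eq, ← elem_neg, ← elem_add]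
    apply elem_mem_EL
    have := r.2
    simp only [dbl, RingHom.mem_eqLocus, RingHom.comp_apply] at this
    have := Ideal.Quotient.eq.mp this
    convert this using 1
    simp [p1, p2]; ring
  have hh' : ∀ i j, h i j - (1 : Matrix (Fin n) (Fin n) R) i j ∈ U := by
    intro i j
    rw [← Ideal.Quotient.eq]
    have := congrArg (fun g : SpecialLinearGroup (Fin n) (R ⧸ U) => g i j) (MonoidHom.mem_ker.mp hh)
    simp at this
    rw [this, Matrix.one_apply, Matrix.one_apply]
    split_ifs <;> simp
  let HM : Matrix (Fin n) (Fin n) (dbl U) := fun i j =>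
    ⟨(h i j, (1 : Matrix (Fin n) (Fin n) R) i j), by
      simp only [dbl, RingHom.mem_eqLocus, RingHom.comp_apply]
      exact Ideal.Quotient.eq.mpr (hh' i j)⟩
  have hH1 : p1.mapMatrix HM = (h : Matrix (Fin n) (Fin n) R) := by ext i j; rfl
  have hH2 : p2.mapMatrix HM = 1 := by ext i j; rfl
  have hdet : HM.det = 1 := by
    apply Subtype.ext
    apply Prod.ext
    · change p1 HM.det = 1
      rw [RingHom.map_det, hH1]; exact h.2
    · change p2 HM.det = 1
      rw [RingHom.map_det, hH2, det_one]
  let H : SpecialLinearGroup (Fin n) (dbl U) := ⟨HM, hdet⟩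
  have h1 : Matrix.SpecialLinearGroup.map p1 H = h := SLext hH1
  have h2 : Matrix.SpecialLinearGroup.map p2 H = 1 := SLext hH2
  let e' := Matrix.SpecialLinearGroup.map dg e
  have he' : e' ∈ El n (dbl U) := map_mem_El dg he
  have e1 : Matrix.SpecialLinearGroup.map p1 e' = e := by ext i j; rfl
  have e2 : Matrix.SpecialLinearGroup.map p2 e' = e := by ext i j; rfl
  have hz : e' * (H * e'⁻¹ * H⁻¹) ∈ El n (dbl U) :=
    mul_mem he' ((El_normal hn).conj_mem _ (inv_mem he') H)
  have := key hz
  change q (Matrix.SpecialLinearGroup.map p1 _) = q (Matrix.SpecialLinearGroup.map p2 _) at this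
  simp only [map_mul (Matrix.SpecialLinearGroup.map _), map_inv (Matrix.SpecialLinearGroup.map _), h1, h2, e1, e2] at this
  rw [one_mul, inv_one, mul_one, mul_inv_cancel, map_one] at this
  have := (QuotientGroup.eq_one_iff _).mp this
  simpa [mul_assoc] using this

end relative

end Part1

section Part2
set_option linter.unusedSimpArgs false
open Matrix

section rowred
variable {n : ℕ} {R : Type*} [CommRing R]

/-- Standard outside `T`. -/
def Std (T : Finset (Fin n)) (M : Matrix (Fin n) (Fin n) R) : Prop :=
  ∀ c, c ∉ T → ∀ p, M p c = (1 : Matrix (Fin n) (Fin n) R) p c ∧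
    M c p = (1 : Matrix (Fin n) (Fin n) R) c p

theorem Std.mul {T : Finset (Fin n)} {M N : Matrix (Fin n) (Fin n) R} (hM : Std T M)
    (hN : Std T N) : Std T (M * N) := by
  intro c hc p
  constructor
  · rw [Matrix.mul_apply]
    simp only [(hN c hc _).1, Matrix.one_apply, mul_ite, mul_one, mul_zero, Finset.sum_ite_eq',
      Finset.mem_univ, if_true]
    exact (hM c hc p).1
  · rw [Matrix.mul_apply]
    simp only [(hM c hc _).2, Matrix.one_apply, ite_mul, one_mul, zero_mul, Finset.sum_ite_eq,
      Finset.mem_univ, if_true]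
    exact (hN c hc p).2

theorem Std.one (T : Finset (Fin n)) : Std T (1 : Matrix (Fin n) (Fin n) R) :=
  fun _ _ _ => ⟨rfl, rfl⟩

theorem Std.vmv {T : Finset (Fin n)} {v w : Fin n → R} (hv : ∀ c, c ∉ T → v c = 0)
    (hw : ∀ c, c ∉ T → w c = 0) : Std T (1 + vecMulVec v w) := by
  intro c hc p
  simp [vecMulVec_apply, hv c hc, hw c hc]

/-- Reduction of column vectors. -/
def Red (T : Finset (Fin n)) (v v' : Fin n → R) : Prop :=
  ∃ M : Matrix (Fin n) (Fin n) R, IsEl M ∧ Std T M ∧ M *ᵥ v = v'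

theorem Red.refl (T : Finset (Fin n)) (v : Fin n → R) : Red T v v :=
  ⟨1, IsEl.one, Std.one T, by simp⟩

theorem Red.trans {T : Finset (Fin n)} {u v w : Fin n → R} (h : Red T u v) (h' : Red T v w) :
    Red T u w := by
  obtain ⟨M, h1, h2, rfl⟩ := h
  obtain ⟨N, h3, h4, rfl⟩ := h'
  exact ⟨N * M, h3.mul h1, h4.mul h2, by simp⟩

theorem Red.step {T : Finset (Fin n)} (v : Fin n → R) (p q : Fin n) (hp : p ∈ T) (hq : q ∈ T)
    (hpq : p ≠ q) (c : R) : Red T v (v + Pi.single p (c * v q)) := by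
  refine ⟨1 + vecMulVec (Pi.single p c) (Pi.single q 1), isEl_row _ _ _ (by simp [hpq]),
    Std.vmv ?_ ?_, ?_⟩
  · intro a ha
    have : a ≠ p := by rintro rfl; exact ha hp
    simp [this]
  · intro a ha
    have : a ≠ q := by rintro rfl; exact ha hq
    simp [this]
  · ext a
    simp [Matrix.add_mulVec, vecMulVec_mulVec, Pi.single_apply, mul_comm]

theorem Red.clear {T : Finset (Fin n)} (v : Fin n → R) (i : Fin n) (hi : i ∈ T)
    (hv : ∀ c, c ∉ T → v c = 0) (h : v i = 1) : Red T v (Pi.single i 1) := by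
  refine ⟨1 + vecMulVec (Pi.single i 1 - v) (Pi.single i 1), isEl_col _ _ _ (by simp [h]),
    Std.vmv ?_ ?_, ?_⟩
  · intro a ha
    have : a ≠ i := by rintro rfl; exact ha hi
    simp [this, hv a ha]
  · intro a ha
    have : a ≠ i := by rintro rfl; exact ha hi
    simp [this]
  · ext a
    simp [Matrix.add_mulVec, vecMulVec_mulVec, h]

theorem Red.supp {T : Finset (Fin n)} {v v' : Fin n → R} (h : Red T v v')
    (hv : ∀ c, c ∉ T → v c = 0) : ∀ c, c ∉ T → v' c = 0 := by
  obtain ⟨M, h1, h2, rfl⟩ := h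
  intro c hc
  simp only [Matrix.mulVec, dotProduct, (h2 c hc _).2, Matrix.one_apply]
  simp [hv c hc]

theorem Red.unimod {T : Finset (Fin n)} {v v' : Fin n → R} (h : Red T v v')
    (hv : ∃ w, w ⬝ᵥ v = 1) : ∃ w, w ⬝ᵥ v' = 1 := by
  obtain ⟨M, ⟨g, hg, rfl⟩, h2, rfl⟩ := h
  obtain ⟨w, hw⟩ := hv
  refine ⟨w ᵥ* (g⁻¹ : Matrix.SpecialLinearGroup (Fin n) R).1, ?_⟩
  have h1 : (g⁻¹ : Matrix.SpecialLinearGroup (Fin n) R).1 * g.1 = 1 := by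
    have : (g⁻¹ * g).1 = (1 : Matrix (Fin n) (Fin n) R) := by rw [inv_mul_cancel]; rfl
    exact this
  rw [← Matrix.dotProduct_mulVec, Matrix.mulVec_mulVec, h1, Matrix.one_mulVec, hw]

theorem Red.to_single {T : Finset (Fin n)} (hT : 2 ≤ T.card) (v : Fin n → R) (i : Fin n)
    (hi : i ∈ T) (hv : ∀ c, c ∉ T → v c = 0) (h : ∃ p ∈ T, IsUnit (v p)) :
    Red T v (Pi.single i 1) := by
  -- it suffices to have a unit somewhere other than i
  have key : ∀ v : Fin n → R, (∀ c, c ∉ T → v c = 0) → (∃ p ∈ T, p ≠ i ∧ IsUnit (v p)) →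
      Red T v (Pi.single i 1) := by
    rintro v hv ⟨p, hp, hpi, u, hu⟩
    have h1 := Red.step v i p hi hp hpi.symm ((1 - v i) * (↑u⁻¹ : R))
    refine h1.trans (Red.clear _ i hi (h1.supp hv) ?_)
    simp [← hu]
  obtain ⟨p, hp, hu⟩ := h
  by_cases hpi : p = i
  · subst hpi
    obtain ⟨q, hq, hqp⟩ := Finset.exists_mem_ne (by omega : 1 < T.card) p
    obtain ⟨u, hu⟩ := hu
    have h1 := Red.step v q p hq hp hqp ((1 - v q) * (↑u⁻¹ : R))
    refine h1.trans (key _ (h1.supp hv) ⟨q, hq, hqp, ?_⟩)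
    simp [← hu]
  · exact key v hv ⟨p, hp, hpi, hu⟩

end rowred

/-- every unimodular vector can be reduced to one with a unit entry. -/
def UnitRed (n : ℕ) (R : Type*) [CommRing R] : Prop :=
  ∀ (T : Finset (Fin n)) (v : Fin n → R), 2 ≤ T.card → (∀ c, c ∉ T → v c = 0) →
    (∃ w, w ⬝ᵥ v = 1) → ∃ v', Red T v v' ∧ ∃ p ∈ T, IsUnit (v' p)

theorem El_eq_top_of_unitRed {n : ℕ} {R : Type*} [CommRing R] (H : UnitRed n R) :
    El n R = ⊤ := by
  have key : ∀ (m : ℕ) (T : Finset (Fin n)), T.card = m → ∀ g : Matrix.SpecialLinearGroup (Fin n) R,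
      Std T g.1 → g ∈ El n R := by
    intro m
    induction m with
    | zero =>
      intro T hT g hg
      rw [Finset.card_eq_zero] at hT
      subst hT
      have : g = 1 := SLext (by ext p c; exact (hg c (by simp) p).1)
      rw [this]; exact one_mem _
    | succ m ih =>
      intro T hT g hg
      by_cases hm : m = 0
      · subst hm
        obtain ⟨t, rfl⟩ := Finset.card_eq_one.mp hT
        have hd : g.1 = Matrix.diagonal (fun p => if p = t then g.1 t t else 1) := by
          ext p c
          by_cases hc : c = t
          · by_cases hp : p = t
            · subst hp; subst hc; simp
            · rw [(hg p (by simpa using hp) c).2, Matrix.diagonal_apply, Matrix.one_apply]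
              simp [hp]
          · rw [(hg c (by simpa using hc) p).1, Matrix.diagonal_apply, Matrix.one_apply]
            split_ifs <;> simp_all
        have h1 : g.1.det = 1 := g.2
        rw [hd, Matrix.det_diagonal, Finset.prod_ite_eq' Finset.univ t] at h1
        simp at h1
        have : g = 1 := SLext (by
          rw [hd, h1]; simp)
        rw [this]; exact one_mem _
      · obtain ⟨i, hi⟩ : T.Nonempty := Finset.card_pos.mp (by omega)
        have hT2 : 2 ≤ T.card := by omega
        have hs : ∀ c, c ∉ T → (fun a => g.1 a i) c = 0 := by
          intro c hc
          have : c ≠ i := by rintro rfl; exact hc hi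
          simp only [(hg c hc i).2, Matrix.one_apply_ne this]
        obtain ⟨v', h1, hu⟩ := H T (fun a => g.1 a i) hT2 hs
          ⟨_, (conj_dot g i i).trans (Matrix.one_apply_eq i)⟩
        obtain ⟨M, ⟨e, he, rfl⟩, hstd, hM⟩ := h1.trans (Red.to_single hT2 v' i hi (h1.supp hs) hu)
        have hcol : ∀ p, (e * g).1 p i = (1 : Matrix (Fin n) (Fin n) R) p i := by
          intro p
          have := congrFun hM p
          change (e.1 * g.1) p i = _
          rw [Matrix.mul_apply]
          simp only [Matrix.mulVec, dotProduct] at this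
          rw [this, Matrix.one_apply, Pi.single_apply]
        have hstd2 : Std T (e * g).1 := hstd.mul hg
        set r : Fin n → R := Pi.single i 1 - (fun q => (e * g).1 i q) with hr
        have hri : r i = 0 := by simp only [hr, Pi.sub_apply, hcol i]; simp
        obtain ⟨f, hf, hfM⟩ := isEl_row i 1 r hri
        have hgoal : Std (T.erase i) (e * g * f).1 := by
          have e1 : (e * g * f).1 = (e * g).1 + vecMulVec (Pi.single i 1) r := by
            change (e * g).1 * f.1 = _
            have hfM' : f.1 = 1 + vecMulVec (Pi.single i 1) r := hfM
            rw [hfM', mul_add, mul_one, Matrix.mul_vecMulVec]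
            congr 2
            ext p
            simp only [Matrix.mulVec_single_one, Matrix.col_apply, hcol]
            rw [Matrix.one_apply, Pi.single_apply]
          intro c hc p
          rw [e1]
          simp only [Matrix.add_apply, vecMulVec_apply]
          by_cases hci : c = i
          · subst hci
            refine ⟨by rw [hcol, hri]; simp, ?_⟩
            simp only [hr, Pi.sub_apply, Pi.single_eq_same]
            rw [Matrix.one_apply, Pi.single_apply]
            simp only [eq_comm]; ring
          · have hcT : c ∉ T := fun h => hc (Finset.mem_erase.mpr ⟨hci, h⟩)
            have hrc : r c = 0 := by
              simp only [hr, Pi.sub_apply, (hstd2 c hcT i).1]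
              simp [Matrix.one_apply, hci, Ne.symm hci]
            rw [(hstd2 c hcT p).1, (hstd2 c hcT p).2, hrc]
            simp [hci]
        have := ih (T.erase i) (by rw [Finset.card_erase_of_mem hi]; omega) _ hgoal
        have h2 : e⁻¹ * (e * g * f) * f⁻¹ ∈ El n R :=
          mul_mem (mul_mem (inv_mem he) this) (inv_mem hf)
        simpa [mul_assoc] using h2
  rw [eq_top_iff]
  intro g _
  exact key _ Finset.univ rfl g (fun c hc => absurd (Finset.mem_univ c) hc)

theorem El_eq_top_of_isLocalRing {n : ℕ} {R : Type*} [CommRing R] [IsLocalRing R] :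
    El n R = ⊤ := by
  apply El_eq_top_of_unitRed
  intro T v _ hv hw
  refine ⟨v, Red.refl _ _, ?_⟩
  by_contra hcon
  push Not at hcon
  obtain ⟨w, hw⟩ := hw
  have : w ⬝ᵥ v ∈ IsLocalRing.maximalIdeal R := by
    apply Ideal.sum_mem
    intro p _
    apply Ideal.mul_mem_left
    by_cases hp : p ∈ T
    · exact hcon p hp
    · rw [hv p hp]; exact zero_mem _
  rw [hw] at this
  exact this isUnit_one

/-- Euclidean-type property. -/
def EuclProp (R : Type*) [CommRing R] : Prop :=
  ∃ N : R → ℕ, ∀ a b : R, b ≠ 0 → ∃ q, a - q * b = 0 ∨ N (a - q * b) < N b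

theorem El_eq_top_of_eucl {n : ℕ} {R : Type*} [CommRing R] (H : EuclProp R) :
    El n R = ⊤ := by
  apply El_eq_top_of_unitRed
  intro T v hT hv hw
  obtain ⟨N, hN⟩ := H
  rcases subsingleton_or_nontrivial R with hR | hR
  · obtain ⟨p, hp⟩ : T.Nonempty := Finset.card_pos.mp (by omega)
    exact ⟨v, Red.refl _ _, p, hp, isUnit_of_subsingleton _⟩
  have hex : ∃ m, ∃ v', Red T v v' ∧ ∃ p ∈ T, v' p ≠ 0 ∧ N (v' p) = m := by
    by_contra hcon
    push Not at hcon
    obtain ⟨w, hw⟩ := hw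
    have hv0 : v = 0 := by
      ext p
      by_contra hp
      have hpT : p ∈ T := by
        by_contra h; exact hp (hv p h)
      exact hcon _ v (Red.refl _ _) p hpT hp rfl
    rw [hv0] at hw; simp at hw
  classical
  obtain ⟨v', hred, p, hp, hp0, hpN⟩ := Nat.find_spec hex
  have hmin := fun m => Nat.find_min (m := m) hex
  refine ⟨v', hred, p, hp, ?_⟩
  have hdvd : ∀ q, v' p ∣ v' q := by
    intro q
    by_cases hqT : q ∈ T
    · by_cases hqp : q = p
      · rw [hqp]
      · obtain ⟨c, hc⟩ := hN (v' q) (v' p) hp0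
        by_cases h0 : v' q - c * v' p = 0
        · exact ⟨c, by linear_combination h0⟩
        · exfalso
          have hlt := hc.resolve_left h0
          rw [hpN] at hlt
          apply hmin _ hlt
          refine ⟨_, hred.trans (Red.step v' q p hqT hp hqp (-c)), q, hqT, ?_, ?_⟩
          · simpa [sub_eq_add_neg] using h0
          · simp [sub_eq_add_neg]
    · rw [hred.supp hv q hqT]; exact dvd_zero _
  obtain ⟨w, hw⟩ := hred.unimod hw
  apply isUnit_of_dvd_one
  rw [← hw]
  exact Finset.dvd_sum fun q _ => Dvd.dvd.mul_left (hdvd q) _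

end Part2

section Part3
set_option linter.unusedSimpArgs false
open Matrix

section maps
variable {n : ℕ} {R S T : Type*} [CommRing R] [CommRing S] [CommRing T]

/-- entrywise map of `SL_n`. -/
abbrev sm (f : R →+* S) :
    Matrix.SpecialLinearGroup (Fin n) R →* Matrix.SpecialLinearGroup (Fin n) S :=
  Matrix.SpecialLinearGroup.map f

theorem sm_sm (g : S →+* T) (f : R →+* S) (x : Matrix.SpecialLinearGroup (Fin n) R) :
    sm g (sm f x) = sm (g.comp f) x := rfl

theorem sm_apply (f : R →+* S) (x : Matrix.SpecialLinearGroup (Fin n) R) (i j : Fin n) :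
    (sm f x).1 i j = f (x.1 i j) := rfl

theorem sm_id (x : Matrix.SpecialLinearGroup (Fin n) R) : sm (RingHom.id R) x = x := rfl

theorem sm_injective (f : R →+* S) (hf : Function.Injective f) :
    Function.Injective (sm f : Matrix.SpecialLinearGroup (Fin n) R →* _) := by
  intro x y h
  apply SLext
  ext i j
  apply hf
  have := congrArg (fun z => z.1 i j) h
  exact this

theorem sm_elem (f : R →+* S) (i j : Fin n) (h : i ≠ j) (r : R) :
    sm f (elem i j h r) = elem i j h (f r) := map_elem f i j h r

theorem sm_mem_El (f : R →+* S) {g : Matrix.SpecialLinearGroup (Fin n) R} (hg : g ∈ El n R) :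
    sm f g ∈ El n S := map_mem_El f hg

end maps

section dilation
open Polynomial

variable {n : ℕ} {R Q : Type*} [CommRing R] [CommRing Q]

theorem mapRingHom_inj (f : R →+* Q) (hf : Function.Injective f) :
    Function.Injective (mapRingHom f) := Polynomial.map_injective f hf

/-- Denominators in `S`. -/
def Denom (φ : R →+* Q) (S : Submonoid R) : Prop := ∀ q : Q, ∃ s ∈ S, ∃ r, φ s * q = φ r

theorem Denom.fin {φ : R →+* Q} {S : Submonoid R} (h : Denom φ S) {κ : Type*} (F : Finset κ)
    (v : κ → Q) : ∃ s ∈ S, ∀ k ∈ F, ∃ r, φ s * v k = φ r := by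
  classical
  induction F using Finset.induction_on with
  | empty => exact ⟨1, one_mem _, by simp⟩
  | insert a F ha ih =>
    obtain ⟨s, hs, hF⟩ := ih
    obtain ⟨t, ht, r, hr⟩ := h (v a)
    refine ⟨s * t, mul_mem hs ht, fun k hk => ?_⟩
    rcases Finset.mem_insert.mp hk with rfl | hk
    · exact ⟨s * r, by rw [map_mul, map_mul, mul_assoc, hr]⟩
    · obtain ⟨r', hr'⟩ := hF k hk
      exact ⟨t * r', by rw [map_mul, map_mul, ← hr']; ring⟩

theorem Denom.vec {φ : R →+* Q} {S : Submonoid R} (h : Denom φ S) {κ : Type*} [Fintype κ]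
    (v : κ → Q) : ∃ s ∈ S, ∃ r : κ → R, ∀ k, φ s * v k = φ (r k) := by
  obtain ⟨s, hs, hF⟩ := h.fin Finset.univ v
  choose r hr using fun k => hF k (Finset.mem_univ k)
  exact ⟨s, hs, r, hr⟩

theorem Denom.poly {φ : R →+* Q} {S : Submonoid R} (h : Denom φ S) (g : Q[X]) :
    ∃ s ∈ S, ∃ g' : R[X], C (φ s) * g = g'.map φ := by
  induction g using Polynomial.induction_on' with
  | add p q hp hq =>
    obtain ⟨s, hs, p', hp⟩ := hp
    obtain ⟨t, ht, q', hq⟩ := hq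
    refine ⟨s * t, mul_mem hs ht, C t * p' + C s * q', ?_⟩
    rw [Polynomial.map_add, Polynomial.map_mul, Polynomial.map_mul, ← hp, ← hq]
    simp only [map_C, map_mul]
    ring
  | monomial k a =>
    obtain ⟨s, hs, r, hr⟩ := h a
    exact ⟨s, hs, monomial k r, by simp [C_mul_monomial, hr]⟩

/-- `f(Z) ↦ f(sZ)`. -/
noncomputable abbrev scl (s : R) : R[X] →+* R[X] := compRingHom (C s * X)

theorem scl_scl (s t : R) : (scl s).comp (scl t) = scl (s * t) := by
  apply Polynomial.ringHom_ext
  · simp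
  · simp [mul_assoc, mul_left_comm]

theorem scl_map (φ : R →+* Q) (s : R) :
    (mapRingHom φ).comp (scl s) = (scl (φ s)).comp (mapRingHom φ) := by
  apply Polynomial.ringHom_ext <;> simp

/-- liftability after dilation -/
def Dil (φ : R →+* Q) (S : Submonoid R) (ε : Matrix.SpecialLinearGroup (Fin n) Q[X]) : Prop :=
  ∃ s ∈ S, ∃ e ∈ El n R[X], sm (mapRingHom φ) e = sm (scl (φ s)) ε

theorem Dil.mul {φ : R →+* Q} {S : Submonoid R} {ε ε' : Matrix.SpecialLinearGroup (Fin n) Q[X]}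
    (h : Dil φ S ε) (h' : Dil φ S ε') : Dil φ S (ε * ε') := by
  obtain ⟨s, hs, e, he, hh⟩ := h
  obtain ⟨t, ht, f, hf, hh'⟩ := h'
  refine ⟨s * t, mul_mem hs ht, sm (scl t) e * sm (scl s) f,
    mul_mem (sm_mem_El _ he) (sm_mem_El _ hf), ?_⟩
  rw [map_mul, map_mul, sm_sm, sm_sm, scl_map, scl_map, ← sm_sm, ← sm_sm, hh, hh', sm_sm, sm_sm,
    scl_scl, scl_scl, ← map_mul φ, ← map_mul φ, mul_comm t s]

theorem Dil.inv {φ : R →+* Q} {S : Submonoid R} {ε : Matrix.SpecialLinearGroup (Fin n) Q[X]}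
    (h : Dil φ S ε) : Dil φ S ε⁻¹ := by
  obtain ⟨s, hs, e, he, hh⟩ := h
  exact ⟨s, hs, e⁻¹, inv_mem he, by rw [map_inv, map_inv, hh]⟩

theorem Dil.conj_elem (hn : 3 ≤ n) {φ : R →+* Q} (hφ : Function.Injective φ) {S : Submonoid R}
    (hS : Denom φ S) (γ : Matrix.SpecialLinearGroup (Fin n) Q) (i j : Fin n) (hij : i ≠ j)
    (g : Q[X]) : Dil φ S (sm C γ * elem i j hij (X * g) * (sm C γ)⁻¹) := by
  obtain ⟨s1, hs1, v', hv'⟩ := hS.vec (fun a => γ.1 a i)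
  obtain ⟨s2, hs2, w', hw'⟩ := hS.vec (fun a => (γ⁻¹).1 j a)
  obtain ⟨s3, hs3, y', hy'⟩ := hS.vec (fun a => (γ⁻¹).1 i a)
  obtain ⟨s4, hs4, g', hg'⟩ := hS.poly g
  set s := s1 * s3 * s1 * s2 * s4 with hs
  have hw0 : w' ⬝ᵥ v' = 0 := by
    apply hφ
    rw [map_zero, dotProduct, map_sum]
    have h0 := conj_dot γ i j
    rw [Matrix.one_apply_ne hij.symm] at h0
    simp only [map_mul, ← hv', ← hw']
    calc _ = φ s2 * φ s1 * ((fun b => (γ⁻¹).1 j b) ⬝ᵥ (fun a => γ.1 a i)) := by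
          rw [dotProduct, Finset.mul_sum]
          exact Finset.sum_congr rfl fun _ _ => by ring
      _ = 0 := by rw [h0, mul_zero]
  have hy1 : y' ⬝ᵥ v' = s1 * s3 := by
    apply hφ
    rw [dotProduct, map_sum]
    have h0 := conj_dot γ i i
    rw [Matrix.one_apply_eq] at h0
    simp only [map_mul, ← hv', ← hy']
    calc _ = φ s1 * φ s3 * ((fun b => (γ⁻¹).1 i b) ⬝ᵥ (fun a => γ.1 a i)) := by
          rw [dotProduct, Finset.mul_sum]
          exact Finset.sum_congr rfl fun _ _ => by ring
      _ = _ := by rw [h0, mul_one]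
  have hsus := isEl_suslin hn (fun a => C (v' a)) (fun a => (X * scl s g') * C (w' a))
    (fun a => C (y' a)) (by
      have : (fun a => (X * scl s g') * C (w' a)) ⬝ᵥ (fun a => C (v' a)) =
          (X * scl s g') * C (w' ⬝ᵥ v') := by
        simp only [dotProduct, map_sum, Finset.mul_sum, map_mul]
        exact Finset.sum_congr rfl fun _ _ => by ring
      rw [this, hw0]; simp)
  have hy2 : (fun a => C (y' a)) ⬝ᵥ (fun a => C (v' a)) = C (s1 * s3) := by
    rw [← hy1]; simp only [dotProduct, map_sum, map_mul]
  rw [hy2] at hsus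
  obtain ⟨e, he, heM⟩ := hsus
  refine ⟨s, by simp only [hs]; exact mul_mem (mul_mem (mul_mem (mul_mem hs1 hs3) hs1) hs2) hs4,
    e, he, ?_⟩
  apply SLext
  ext a b
  have h1 : e.1 a b = (1 : Matrix (Fin n) (Fin n) R[X]) a b +
      C (v' a) * (C (s1 * s3) * ((X * scl s g') * C (w' b))) := by
    have h2 : e.1 = _ := heM
    rw [h2]; rfl
  have h3 : (sm C γ * elem i j hij (X * g) * (sm C γ)⁻¹).1 a b =
      (1 : Matrix (Fin n) (Fin n) Q[X]) a b + C (γ.1 a i) * ((X * g) * C ((γ⁻¹).1 j b)) := by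
    have h2 := coe_conj_elem (sm C γ) i j hij (X * g)
    have h2' : (sm C γ * elem i j hij (X * g) * (sm C γ)⁻¹).1 = _ := h2
    rw [h2', ← map_inv]; rfl
  rw [sm_apply, sm_apply, h1, h3]
  have h4 : mapRingHom φ (scl s g') = scl (φ s) (C (φ s4) * g) := by
    have := RingHom.congr_fun (scl_map φ s) g'
    simp only [RingHom.comp_apply] at this
    rw [this, hg']; rfl
  have h5 : ∀ (F : R[X] →+* Q[X]), F ((1 : Matrix (Fin n) (Fin n) R[X]) a b) =
      (1 : Matrix (Fin n) (Fin n) Q[X]) a b := by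
    intro F; simp only [Matrix.one_apply]; split_ifs <;> simp
  have h6 : ∀ (F : Q[X] →+* Q[X]), F ((1 : Matrix (Fin n) (Fin n) Q[X]) a b) =
      (1 : Matrix (Fin n) (Fin n) Q[X]) a b := by
    intro F; simp only [Matrix.one_apply]; split_ifs <;> simp
  have hC : ∀ r, mapRingHom φ (C r) = C (φ r) := by intro r; simp
  have hX : mapRingHom φ X = X := by simp
  have hC' : ∀ r, scl (φ s) (C r) = C r := by intro r; simp
  have hX' : scl (φ s) X = C (φ s) * X := by simp
  simp only [map_add, map_mul, h5, h6, hC, hX, h4, ← hv', ← hw', hC', hX']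
  simp only [hs, map_mul]
  ring

/-- `ε(0)` as constant. -/
noncomputable abbrev cst : Q[X] →+* Q[X] := C.comp (evalRingHom 0)

theorem dil_of_mem (hn : 3 ≤ n) {φ : R →+* Q} (hφ : Function.Injective φ) {S : Submonoid R}
    (hS : Denom φ S) (ε : Matrix.SpecialLinearGroup (Fin n) Q[X]) (hε : ε ∈ El n Q[X]) :
    ∀ γ : Matrix.SpecialLinearGroup (Fin n) Q,
      Dil φ S (sm C γ * (ε * (sm cst ε)⁻¹) * (sm C γ)⁻¹) := by
  refine Subgroup.closure_induction
    (p := fun ε _ => ∀ γ : Matrix.SpecialLinearGroup (Fin n) Q,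
      Dil φ S (sm C γ * (ε * (sm cst ε)⁻¹) * (sm C γ)⁻¹)) ?_ ?_ ?_ ?_ hε
  · rintro _ ⟨i, j, h, r, rfl⟩ γ
    rw [sm_elem, ← elem_neg, ← elem_add]
    have : r + -cst r = X * divX r := by
      have := X_mul_divX_add r
      rw [← sub_eq_add_neg, sub_eq_iff_eq_add]
      simpa [coeff_zero_eq_eval_zero] using this.symm
    rw [this]
    exact Dil.conj_elem hn hφ hS γ i j h _
  · intro γ
    refine ⟨1, one_mem _, 1, one_mem _, by simp⟩
  · intro x y _ _ hx hy γ
    have h1 := (hx γ).mul (hy (γ * sm (evalRingHom 0) x))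
    convert h1 using 1
    have : sm cst x = sm C (sm (evalRingHom 0) x) := rfl
    rw [map_mul (sm cst), map_mul (sm C), ← this]
    group
  · intro x _ hx γ
    have h1 := (hx (γ * (sm (evalRingHom 0) x)⁻¹)).inv
    convert h1 using 1
    have : sm cst x = sm C (sm (evalRingHom 0) x) := rfl
    rw [map_mul (sm C), map_inv (sm C), ← this, map_inv]
    group

theorem dilation (hn : 3 ≤ n) {φ : R →+* Q} (hφ : Function.Injective φ) {S : Submonoid R}
    (hS : Denom φ S) (ε : Matrix.SpecialLinearGroup (Fin n) Q[X]) (hε : ε ∈ El n Q[X])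
    (h0 : sm (evalRingHom 0) ε = 1) : Dil φ S ε := by
  have h := dil_of_mem hn hφ hS ε hε 1
  have : sm cst ε = sm C (sm (evalRingHom 0) ε) := rfl
  rw [this, h0] at h
  simpa using h

theorem exists_path (ε : Matrix.SpecialLinearGroup (Fin n) Q) (hε : ε ∈ El n Q) :
    ∃ e ∈ El n Q[X], sm (evalRingHom 0) e = 1 ∧ sm (evalRingHom 1) e = ε := by
  refine Subgroup.closure_induction
    (p := fun ε _ => ∃ e ∈ El n Q[X], sm (evalRingHom 0) e = 1 ∧ sm (evalRingHom 1) e = ε)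
    ?_ ?_ ?_ ?_ hε
  · rintro _ ⟨i, j, h, r, rfl⟩
    refine ⟨elem i j h (C r * X), elem_mem_El _ _ _ _, ?_, ?_⟩
    · rw [sm_elem]; simp [elem_zero]
    · rw [sm_elem]; simp
  · exact ⟨1, one_mem _, by simp, by simp⟩
  · rintro x y _ _ ⟨e, he, h1, h2⟩ ⟨e', he', h1', h2'⟩
    exact ⟨e * e', mul_mem he he', by rw [map_mul, h1, h1', one_mul], by rw [map_mul, h2, h2']⟩
  · rintro x _ ⟨e, he, h1, h2⟩
    exact ⟨e⁻¹, inv_mem he, by rw [map_inv, h1, inv_one], by rw [map_inv, h2]⟩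

theorem splitting {R L M Q : Type*} [CommRing R] [CommRing L] [CommRing M] [CommRing Q]
    (hn : 3 ≤ n) (a : R →+* L) (b : R →+* M) (φ : L →+* Q) (ψ : M →+* Q)
    (hcomm : φ.comp a = ψ.comp b) (hφ : Function.Injective φ) (hψ : Function.Injective ψ)
    (S T : Submonoid R) (hS : Denom φ (S.map a)) (hT : Denom ψ (T.map b))
    (hST : ∀ s ∈ S, ∀ t ∈ T, IsCoprime s t)
    (ε : Matrix.SpecialLinearGroup (Fin n) Q) (hε : ε ∈ El n Q) :
    ∃ ε₁ ∈ El n L, ∃ ε₂ ∈ El n M, ε = sm φ ε₁ * sm ψ ε₂ := by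
  obtain ⟨e, he, he0, he1⟩ := exists_path ε hε
  obtain ⟨_, ⟨s, hs, rfl⟩, e1, he1', h1⟩ := dilation hn hφ hS e he he0
  set θ := sm (compRingHom (1 - X)) e⁻¹ * sm C ε with hθ
  have hθm : θ ∈ El n Q[X] := mul_mem (sm_mem_El _ (inv_mem he)) (sm_mem_El _ hε)
  have hθ0 : sm (evalRingHom 0) θ = 1 := by
    rw [hθ, map_mul, sm_sm, sm_sm]
    have q1 : (evalRingHom (0 : Q)).comp (compRingHom (1 - X)) = evalRingHom 1 := by
      apply Polynomial.ringHom_ext <;> simp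
    have q2 : (evalRingHom (0 : Q)).comp C = RingHom.id Q := by ext; simp
    rw [q1, q2, sm_id, map_inv, he1, inv_mul_cancel]
  obtain ⟨_, ⟨t, ht, rfl⟩, e2, he2, h2⟩ := dilation hn hψ hT θ hθm hθ0
  obtain ⟨r, q, hrq⟩ := hST s hs t ht
  refine ⟨sm (evalRingHom (a r)) e1, sm_mem_El _ he1', sm (evalRingHom (b q)) e2,
    sm_mem_El _ he2, ?_⟩
  have c1 : φ.comp (evalRingHom (a r)) = (evalRingHom (φ (a r))).comp (mapRingHom φ) := by
    apply Polynomial.ringHom_ext <;> simp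
  have c2 : ψ.comp (evalRingHom (b q)) = (evalRingHom (ψ (b q))).comp (mapRingHom ψ) := by
    apply Polynomial.ringHom_ext <;> simp
  rw [sm_sm, sm_sm, c1, c2, ← sm_sm, ← sm_sm, h1, h2, hθ, map_mul, map_mul, sm_sm, sm_sm, sm_sm,
    sm_sm, sm_sm]
  have hba : ∀ x, ψ (b x) = φ (a x) := fun x => (RingHom.congr_fun hcomm x).symm
  have hrq' : φ (a r) * φ (a s) + φ (a q) * φ (a t) = 1 := by
    rw [← map_mul, ← map_mul, ← map_mul, ← map_mul, ← map_add, ← map_add, hrq, map_one, map_one]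
  have d1 : (evalRingHom (φ (a r))).comp (scl (φ (a s))) =
      ((evalRingHom (ψ (b q))).comp (scl (ψ (b t)))).comp (compRingHom (1 - X)) := by
    apply Polynomial.ringHom_ext
    · simp
    · simp [hba]
      linear_combination hrq'
  have d2 : ((evalRingHom (ψ (b q))).comp (scl (ψ (b t)))).comp C = RingHom.id Q := by
    ext; simp
  rw [← d1, d2, sm_id, map_inv, mul_inv_cancel_left]

/-- `α(X) ↦ α(X+sY)` -/
noncomputable abbrev shf (s : R) : R[X] →+* R[X][X] :=
  eval₂RingHom (C.comp C) (C X + C (C s) * X)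

theorem map_shf {B B' : Type*} [CommRing B] [CommRing B'] (f : B →+* B') (s : B) :
    (mapRingHom (mapRingHom f)).comp (shf s) = (shf (f s)).comp (mapRingHom f) := by
  apply Polynomial.ringHom_ext <;> simp

theorem local_global {B : Type*} [CommRing B] [IsDomain B] (hn : 3 ≤ n)
    (α : Matrix.SpecialLinearGroup (Fin n) B[X])
    (h : ∀ (m : Ideal B) [hm : m.IsMaximal],
      sm (mapRingHom (algebraMap B (Localization.AtPrime m))) α ∈
        El n (Localization.AtPrime m)[X]) :
    α * (sm cst α)⁻¹ ∈ El n B[X] := by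
  let 𝔮 : Ideal B :=
    { carrier := {s | sm (shf s) α * (sm C α)⁻¹ ∈ El n B[X][X]}
      zero_mem' := by
        have : shf (0 : B) = C := by
          apply Polynomial.ringHom_ext <;> simp
        simp only [Set.mem_ofPred_eq, this, mul_inv_cancel]
        exact one_mem _
      add_mem' := by
        intro s t hs ht
        simp only [Set.mem_ofPred_eq] at hs ht ⊢
        have h1 := sm_mem_El (eval₂RingHom (shf s) X) ht
        rw [map_mul, map_inv, sm_sm, sm_sm] at h1
        have q1 : (eval₂RingHom (shf s) X).comp (shf t) = shf (s + t) := by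
          apply Polynomial.ringHom_ext
          · simp
          · simp; ring
        have q2 : (eval₂RingHom (shf s) X).comp C = shf s := by
          apply Polynomial.ringHom_ext <;> simp
        rw [q1, q2] at h1
        have := mul_mem h1 hs
        simpa [mul_assoc] using this
      smul_mem' := by
        intro c s hs
        simp only [Set.mem_ofPred_eq] at hs ⊢
        have h1 := sm_mem_El (scl (C c)) hs
        rw [map_mul, map_inv, sm_sm, sm_sm] at h1
        have q1 : (scl (C c)).comp (shf s) = shf (c • s) := by
          apply Polynomial.ringHom_ext
          · simp
          · simp [mul_assoc, mul_left_comm]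
        have q2 : (scl (C c)).comp C = (C : B[X] →+* B[X][X]) := by
          apply Polynomial.ringHom_ext <;> simp
        rw [q1, q2] at h1
        exact h1 }
  have htop : 𝔮 = ⊤ := by
    by_contra hne
    obtain ⟨m, hm, hle⟩ := Ideal.exists_le_maximal 𝔮 hne
    set f := algebraMap B (Localization.AtPrime m) with hf
    have hfinj : Function.Injective f :=
      IsLocalization.injective _ m.primeCompl_le_nonZeroDivisors
    have hD0 : Denom f m.primeCompl := by
      intro q
      obtain ⟨⟨r, s⟩, hrs⟩ := IsLocalization.surj m.primeCompl q
      exact ⟨s, s.2, r, by rw [mul_comm]; exact hrs⟩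
    have hD : Denom (mapRingHom f) (m.primeCompl.map (C : B →+* B[X])) := by
      intro q
      obtain ⟨s, hs, g, hg⟩ := hD0.poly q
      exact ⟨C s, ⟨s, hs, rfl⟩, g, by simpa using hg⟩
    have hα := h m
    rw [← hf] at hα
    set α' := sm (mapRingHom f) α with hα'
    have hε : sm (shf 1) α' * (sm C α')⁻¹ ∈ El n (Localization.AtPrime m)[X][X] :=
      mul_mem (sm_mem_El _ hα) (inv_mem (sm_mem_El _ hα))
    obtain ⟨_, ⟨s, hs, rfl⟩, e, he, hee⟩ := dilation hn (φ := mapRingHom f)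
      (mapRingHom_inj f hfinj) hD _ hε (by
        rw [map_mul, map_inv]
        have : (evalRingHom 0).comp (shf (1 : Localization.AtPrime m)) = (evalRingHom 0).comp C := by
          apply Polynomial.ringHom_ext <;> simp
        have h3 : sm ((evalRingHom 0).comp (shf 1)) α' = sm ((evalRingHom 0).comp C) α' := by
          rw [this]
        rw [← sm_sm, ← sm_sm] at h3
        rw [h3, mul_inv_cancel])
    apply hs
    apply hle
    change sm (shf s) α * (sm C α)⁻¹ ∈ El n B[X][X]
    have : e = sm (shf s) α * (sm C α)⁻¹ := by
      have hinj := mapRingHom_inj (mapRingHom f) (mapRingHom_inj f hfinj)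
      apply sm_injective _ hinj
      rw [hee, map_mul, map_mul, map_inv, map_inv]
      have q1 : ((scl (mapRingHom f (C s))).comp (shf 1)) = shf (f s) := by
        apply Polynomial.ringHom_ext <;> simp
      have q2 : ((scl (mapRingHom f (C s))).comp C).comp (mapRingHom f) =
          (mapRingHom (mapRingHom f)).comp C := by
        apply Polynomial.ringHom_ext <;> simp
      change sm (((scl (mapRingHom f (C s))).comp (shf 1)).comp (mapRingHom f)) α *
        (sm (((scl (mapRingHom f (C s))).comp C).comp (mapRingHom f)) α)⁻¹ =
        sm ((mapRingHom (mapRingHom f)).comp (shf s)) α *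
          (sm ((mapRingHom (mapRingHom f)).comp C) α)⁻¹
      rw [q1, q2, map_shf]
    rwa [← this]
  have h1 : (1 : B) ∈ 𝔮 := by rw [htop]; trivial
  change sm (shf 1) α * (sm C α)⁻¹ ∈ El n B[X][X] at h1
  have h2 := sm_mem_El (eval₂RingHom cst X) h1
  rw [map_mul, map_inv, sm_sm, sm_sm] at h2
  have q1 : (eval₂RingHom cst X).comp (shf 1) = RingHom.id B[X] := by
    apply Polynomial.ringHom_ext <;> simp
  have q2 : (eval₂RingHom cst X).comp C = (cst : B[X] →+* B[X]) := by
    apply Polynomial.ringHom_ext <;> simp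
  rw [q1, q2, sm_id] at h2
  exact h2

end dilation

end Part3

section Part4
set_option linter.unusedSimpArgs false

/-- An abstract system of affine root subgroups of type `A_{n-1}`. -/
structure Aff (n : ℕ) (B : Type*) [CommRing B] [IsLocalRing B] (G : Type*) [Group G] where
  x : ℤ → ℤ → B → G
  C : Subgroup G
  Tm : Subgroup G
  hC : C.Normal
  hTC : Tm ≤ C
  x_add : ∀ p q c d, x p q (c + d) = x p q c * x p q d
  x_deg : ∀ p q : ℤ, (p : ZMod n) = q → ∀ c, x p q c = 1
  x_shift : ∀ p q k c, x (p + n * k) (q + n * k) c = x p q c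
  x_comm : ∀ p q r s : ℤ, (q : ZMod n) ≠ r → (p : ZMod n) ≠ s → ∀ c d,
    x p q c * x r s d = x r s d * x p q c
  x_mul : ∀ p q r : ℤ, (p : ZMod n) ≠ q → (q : ZMod n) ≠ r → (p : ZMod n) ≠ r → ∀ c d,
    x p q c * x q r d = x p r (c * d) * x q r d * x p q c
  x_mem_C : ∀ p q, ∀ c ∈ IsLocalRing.maximalIdeal B, x p q c ∈ C
  C_pos : ∀ u ∈ Subgroup.closure {g | ∃ p q c, p < q ∧ g = x p q c}, ∀ p v,
    x (p + 1) p v * u ∈ C → v ∈ IsLocalRing.maximalIdeal B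
  C_neg : ∀ u ∈ Subgroup.closure {g | ∃ p q c, q < p ∧ g = x p q c}, ∀ p v,
    x p (p + 1) v * u ∈ C → v ∈ IsLocalRing.maximalIdeal B
  T_conj : ∀ t ∈ Tm, ∀ p q, ∃ χ : B, χ - 1 ∈ IsLocalRing.maximalIdeal B ∧
    ∀ c, t * x p q c * t⁻¹ = x p q (χ * c)
  S1 : ∀ p q : ℤ, (p : ZMod n) ≠ q → ∀ c u, u ∈ IsLocalRing.maximalIdeal B →
    ∃ t ∈ Tm, ∃ u' c', (1 + c * u) * u' = u ∧ (1 + c * u) * c' = c ∧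
      x q p c * x p q u = x p q u' * t * x q p c'
  S3 : ∀ p q : ℤ, (p : ZMod n) ≠ q → ∀ v,
    (x p q (-1) * x q p 1 * x p q (-1)) * x p q v * (x p q (-1) * x q p 1 * x p q (-1))⁻¹
      = x q p (-v)

namespace Aff

variable {n : ℕ} {B : Type*} [CommRing B] [IsLocalRing B] {G : Type*} [Group G] (A : Aff n B G)

/-- Positive part. -/
def Up : Subgroup G := Subgroup.closure {g | ∃ p q c, p < q ∧ g = A.x p q c}
/-- Negative part. -/
def Um : Subgroup G := Subgroup.closure {g | ∃ p q c, q < p ∧ g = A.x p q c}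
/-- All. -/
def E : Subgroup G := Subgroup.closure {g | ∃ p q c, g = A.x p q c}
/-- The small cell. -/
def H : Set G := {h | ∃ u ∈ A.Up ⊓ A.C, ∃ t ∈ A.Tm, ∃ z ∈ A.Um ⊓ A.C, h = u * t * z}

theorem x_zero (p q : ℤ) : A.x p q 0 = 1 := by
  have := A.x_add p q 0 0
  rw [add_zero] at this
  exact left_eq_mul.mp this

theorem x_neg (p q : ℤ) (c : B) : A.x p q (-c) = (A.x p q c)⁻¹ := by
  rw [eq_inv_iff_mul_eq_one, ← A.x_add, neg_add_cancel, A.x_zero]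

theorem mem_Up {p q : ℤ} (h : p < q) (c : B) : A.x p q c ∈ A.Up :=
  Subgroup.subset_closure ⟨p, q, c, h, rfl⟩
theorem mem_Um {p q : ℤ} (h : q < p) (c : B) : A.x p q c ∈ A.Um :=
  Subgroup.subset_closure ⟨p, q, c, h, rfl⟩
theorem mem_E (p q : ℤ) (c : B) : A.x p q c ∈ A.E :=
  Subgroup.subset_closure ⟨p, q, c, rfl⟩

theorem Up_le_E : A.Up ≤ A.E := by
  rw [Up, Subgroup.closure_le]
  rintro _ ⟨p, q, c, _, rfl⟩
  exact A.mem_E p q c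
theorem Um_le_E : A.Um ≤ A.E := by
  rw [Um, Subgroup.closure_le]
  rintro _ ⟨p, q, c, _, rfl⟩
  exact A.mem_E p q c

/-- Opposite system. -/
def neg : Aff n B G where
  x p q c := A.x (-p) (-q) c
  C := A.C
  Tm := A.Tm
  hC := A.hC
  hTC := A.hTC
  x_add p q c d := A.x_add _ _ _ _
  x_deg p q h c := A.x_deg _ _ (by push_cast; rw [h]) c
  x_shift p q k c := by
    rw [← A.x_shift (-p) (-q) (-k)]; congr 1 <;> ring
  x_comm p q r s h h' c d := A.x_comm _ _ _ _ (by push_cast; simpa using h) (by simpa using h') c d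
  x_mul p q r h h' h'' c d := A.x_mul _ _ _ (by simpa using h) (by simpa using h')
    (by simpa using h'') c d
  x_mem_C p q c hc := A.x_mem_C _ _ c hc
  C_pos u hu p v h := by
    refine A.C_neg u ?_ (-(p + 1)) v (by convert h using 3; ring)
    refine Subgroup.closure_mono ?_ hu
    rintro _ ⟨p, q, c, hpq, rfl⟩
    exact ⟨-p, -q, c, by omega, rfl⟩
  C_neg u hu p v h := by
    refine A.C_pos u ?_ (-(p + 1)) v (by convert h using 3; ring)
    refine Subgroup.closure_mono ?_ hu
    rintro _ ⟨p, q, c, hpq, rfl⟩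
    exact ⟨-p, -q, c, by omega, rfl⟩
  T_conj t ht p q := A.T_conj t ht _ _
  S1 p q h c u hu := A.S1 _ _ (by simpa using h) c u hu
  S3 p q h v := A.S3 _ _ (by simpa using h) v

theorem neg_x (p q : ℤ) (c : B) : A.neg.x p q c = A.x (-p) (-q) c := rfl

theorem neg_Up : A.neg.Up = A.Um := by
  apply le_antisymm
  · rw [Up, Subgroup.closure_le]
    rintro _ ⟨p, q, c, h, rfl⟩
    exact A.mem_Um (by omega) c
  · rw [Um, Subgroup.closure_le]
    rintro _ ⟨p, q, c, h, rfl⟩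
    have := A.neg.mem_Up (p := -p) (q := -q) (by omega) c
    simpa [neg_x] using this

theorem neg_Um : A.neg.Um = A.Up := by
  apply le_antisymm
  · rw [Um, Subgroup.closure_le]
    rintro _ ⟨p, q, c, h, rfl⟩
    exact A.mem_Up (by omega) c
  · rw [Up, Subgroup.closure_le]
    rintro _ ⟨p, q, c, h, rfl⟩
    have := A.neg.mem_Um (p := -p) (q := -q) (by omega) c
    simpa [neg_x] using this

theorem mem_neg_H {h : G} : h ∈ A.neg.H ↔ h⁻¹ ∈ A.H := by
  simp only [H, neg_Up, neg_Um, Set.mem_ofPred_eq]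
  change (∃ u ∈ A.Um ⊓ A.C, ∃ t ∈ A.Tm, ∃ z ∈ A.Up ⊓ A.C, h = u * t * z) ↔ _
  constructor
  · rintro ⟨u, hu, t, ht, z, hz, rfl⟩
    exact ⟨z⁻¹, inv_mem hz, t⁻¹, inv_mem ht, u⁻¹, inv_mem hu, by group⟩
  · rintro ⟨u, hu, t, ht, z, hz, hh⟩
    exact ⟨z⁻¹, inv_mem hz, t⁻¹, inv_mem ht, u⁻¹, inv_mem hu, by
      rw [← inv_inv h, hh]; group⟩

/-- Admissible pairs. -/
def ok (n : ℕ) (p r s : ℤ) : Prop :=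
  ¬ ((r : ZMod n) = p ∧ (s : ZMod n) = p + 1) ∧ ¬ ((r : ZMod n) = p + 1 ∧ (s : ZMod n) = p)

/-- The kernel `K_a`, `a = (p, p+1)`. -/
def K (p : ℤ) : Subgroup G :=
  Subgroup.closure {g | ∃ r s c, r < s ∧ ok n p r s ∧ g = A.x r s c}

theorem mem_K {p r s : ℤ} (h : r < s) (h' : ok n p r s) (c : B) : A.x r s c ∈ A.K p :=
  Subgroup.subset_closure ⟨r, s, c, h, h', rfl⟩

theorem K_le_Up (p : ℤ) : A.K p ≤ A.Up := by
  rw [K, Subgroup.closure_le]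
  rintro _ ⟨r, s, c, h, _, rfl⟩
  exact A.mem_Up h c

theorem x_eq_of_left {p q r : ℤ} (h : (p : ZMod n) = r) (c : B) :
    A.x p q c = A.x r (q + (r - p)) c := by
  obtain ⟨k, hk⟩ := (ZMod.intCast_eq_intCast_iff_dvd_sub p r n).mp h
  rw [← A.x_shift p q k]
  congr 1
  · linarith
  · linarith

theorem x_eq_of_right {p q r : ℤ} (h : (q : ZMod n) = r) (c : B) :
    A.x p q c = A.x (p + (r - q)) r c := by
  obtain ⟨k, hk⟩ := (ZMod.intCast_eq_intCast_iff_dvd_sub q r n).mp h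
  rw [← A.x_shift p q k]
  congr 1
  · linarith
  · linarith

theorem one_ne (hn : 3 ≤ n) : (1 : ZMod n) ≠ 0 := by
  have : ((1 : ℕ) : ZMod n) ≠ 0 := by
    rw [Ne, ZMod.natCast_eq_zero_iff]
    intro h; have := Nat.le_of_dvd (by norm_num) h; omega
  simpa using this

theorem two_ne (hn : 3 ≤ n) : (2 : ZMod n) ≠ 0 := by
  have : ((2 : ℕ) : ZMod n) ≠ 0 := by
    rw [Ne, ZMod.natCast_eq_zero_iff]
    intro h; have := Nat.le_of_dvd (by norm_num) h; omega
  simpa using this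

theorem conj_K_gen (hn : 3 ≤ n) (p r s : ℤ) (h : r < s) (hok : ok n p r s) (c d : B) :
    A.x p (p + 1) d * A.x r s c * (A.x p (p + 1) d)⁻¹ ∈ A.K p ∧
    A.x (p + 1) p d * A.x r s c * (A.x (p + 1) p d)⁻¹ ∈ A.K p := by
  have h1 := one_ne hn
  have hg := A.mem_K h hok c
  by_cases hd : (r : ZMod n) = s
  · rw [A.x_deg r s hd]; simp [one_mem]
  constructor
  · by_cases hs : (p : ZMod n) = s
    · rw [A.x_eq_of_left hs, show p + 1 + (s - p) = s + 1 by ring]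
      have hrs : (r : ZMod n) ≠ ((s + 1 : ℤ) : ZMod n) := by
        intro h2; push_cast at h2; exact hok.2 ⟨by rw [h2, hs], hs.symm⟩
      have e := A.x_mul r s (s + 1) hd (by push_cast; simpa using h1) hrs c d
      have e' : A.x s (s + 1) d * A.x r s c * (A.x s (s + 1) d)⁻¹ =
          (A.x r (s + 1) (c * d))⁻¹ * A.x r s c := by
        rw [mul_inv_eq_iff_eq_mul, mul_assoc _ (A.x r s c), e]; group
      rw [e']
      refine mul_mem (inv_mem (A.mem_K (by omega) ⟨?_, ?_⟩ _)) hg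
      · rintro ⟨h2, h3⟩; exact hd (by rw [h2, hs])
      · rintro ⟨h2, h3⟩; push_cast at h3; apply h1; linear_combination h3 + hs
    · by_cases hr : ((p + 1 : ℤ) : ZMod n) = r
      · rw [A.x_eq_of_right hr, show p + (r - (p + 1)) = r - 1 by ring]
        push_cast at hr
        have hrs : ((r - 1 : ℤ) : ZMod n) ≠ s := by
          intro h2; push_cast at h2; exact hs (by linear_combination h2 + hr)
        have e := A.x_mul (r - 1) r s (by push_cast; simpa using h1) hd hrs d c
        have e' : A.x (r - 1) r d * A.x r s c * (A.x (r - 1) r d)⁻¹ =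
            (A.x (r - 1) s (d * c)) * A.x r s c := by
          rw [mul_inv_eq_iff_eq_mul, e]
        rw [e']
        refine mul_mem (A.mem_K (by omega) ⟨?_, ?_⟩ _) hg
        · rintro ⟨h2, h3⟩; exact hd (by rw [h3, hr])
        · rintro ⟨h2, h3⟩; exact hs h3.symm
      · rw [A.x_comm p (p + 1) r s hr hs, mul_inv_cancel_right]; exact hg
  · by_cases hs : ((p + 1 : ℤ) : ZMod n) = s
    · rw [A.x_eq_of_left hs, show p + (s - (p + 1)) = s - 1 by ring]
      push_cast at hs
      have hrs : (r : ZMod n) ≠ ((s - 1 : ℤ) : ZMod n) := by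
        intro h2; push_cast at h2
        exact hok.1 ⟨by linear_combination h2 - hs, hs.symm⟩
      have e := A.x_mul r s (s - 1) hd
        (by push_cast; intro a; apply h1; linear_combination a) hrs c d
      have e' : A.x s (s - 1) d * A.x r s c * (A.x s (s - 1) d)⁻¹ =
          (A.x r (s - 1) (c * d))⁻¹ * A.x r s c := by
        rw [mul_inv_eq_iff_eq_mul, mul_assoc _ (A.x r s c), e]; group
      rw [e']
      have hlt : r < s - 1 := by
        have : r ≠ s - 1 := by rintro rfl; exact hrs rfl
        omega
      refine mul_mem (inv_mem (A.mem_K hlt ⟨?_, ?_⟩ _)) hg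
      · rintro ⟨h2, h3⟩; push_cast at h3; apply h1; linear_combination - h3 - hs
      · rintro ⟨h2, h3⟩; exact hd (by rw [h2, hs])
    · by_cases hr : (p : ZMod n) = r
      · rw [A.x_eq_of_right hr, show p + 1 + (r - p) = r + 1 by ring]
        push_cast at hs
        have hrs : ((r + 1 : ℤ) : ZMod n) ≠ s := by
          intro h2; push_cast at h2; exact hs (by linear_combination h2 + hr)
        have e := A.x_mul (r + 1) r s (by push_cast; simpa using h1) hd hrs d c
        have e' : A.x (r + 1) r d * A.x r s c * (A.x (r + 1) r d)⁻¹ =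
            (A.x (r + 1) s (d * c)) * A.x r s c := by
          rw [mul_inv_eq_iff_eq_mul, e]
        rw [e']
        have hlt : r + 1 < s := by
          have : r + 1 ≠ s := by rintro rfl; exact hrs rfl
          omega
        refine mul_mem (A.mem_K hlt ⟨?_, ?_⟩ _) hg
        · rintro ⟨h2, h3⟩; exact hs h3.symm
        · rintro ⟨h2, h3⟩; exact hd (by rw [h3, hr])
      · rw [A.x_comm (p + 1) p r s hr hs, mul_inv_cancel_right]; exact hg

theorem conj_K (hn : 3 ≤ n) (p : ℤ) (d : B) (κ : G) (hκ : κ ∈ A.K p) :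
    A.x p (p + 1) d * κ * (A.x p (p + 1) d)⁻¹ ∈ A.K p ∧
    A.x (p + 1) p d * κ * (A.x (p + 1) p d)⁻¹ ∈ A.K p := by
  have h1 : A.K p ≤ (A.K p).comap (MulAut.conj (A.x p (p + 1) d)).toMonoidHom := by
    conv_lhs => rw [K]
    rw [Subgroup.closure_le]
    rintro _ ⟨r, s, c, h, hok, rfl⟩
    exact (A.conj_K_gen hn p r s h hok c d).1
  have h2 : A.K p ≤ (A.K p).comap (MulAut.conj (A.x (p + 1) p d)).toMonoidHom := by
    conv_lhs => rw [K]
    rw [Subgroup.closure_le]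
    rintro _ ⟨r, s, c, h, hok, rfl⟩
    exact (A.conj_K_gen hn p r s h hok c d).2
  exact ⟨h1 hκ, h2 hκ⟩

/-- every positive root element lies in `K` or is simple. -/
theorem gen_decomp (hn : 3 ≤ n) (p r s : ℤ) (h : r < s) (c : B) :
    A.x r s c ∈ A.K p ∨ A.x r s c = A.x p (p + 1) c := by
  have h1 := one_ne hn
  have h2 := two_ne hn
  have comm : ∀ t, r < t → t < s → ok n p r t → ok n p t s → (r : ZMod n) ≠ t →
      (t : ZMod n) ≠ s → (r : ZMod n) ≠ s → A.x r s c ∈ A.K p := by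
    intro t a1 a2 a3 a4 a5 a6 a7
    have e := A.x_mul r t s a5 a6 a7 c 1
    have e' : A.x r s c = A.x r t c * A.x t s 1 * (A.x r t c)⁻¹ * (A.x t s 1)⁻¹ := by
      rw [e, mul_one]; group
    rw [e']
    have b1 := A.mem_K a1 a3 c
    have b2 := A.mem_K a2 a4 1
    exact mul_mem (mul_mem (mul_mem b1 b2) (inv_mem b1)) (inv_mem b2)
  by_cases hok : ok n p r s
  · exact Or.inl (A.mem_K h hok c)
  · rw [ok, not_and_or, not_not, not_not] at hok
    rcases hok with ⟨hr, hs⟩ | ⟨hr, hs⟩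
    · by_cases hs1 : s = r + 1
      · right
        rw [A.x_eq_of_left hr, hs1]; congr 1; ring
      · left
        have hne : s ≠ r + 2 := by
          rintro rfl
          push_cast at hs
          apply h1; linear_combination hs - hr
        have h2' : s ≠ r + 1 := hs1
        refine comm (r + 2) (by omega) (by omega) ⟨?_, ?_⟩ ⟨?_, ?_⟩ ?_ ?_ ?_ <;> push_cast
        · rintro ⟨a, b⟩; apply h1; linear_combination b - hr
        · rintro ⟨a, b⟩; apply h1; linear_combination hr - a
        · rintro ⟨a, b⟩; apply h2; linear_combination a - hr
        · rintro ⟨a, b⟩; apply h1; linear_combination a - hr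
        · intro a; apply h2; linear_combination -a
        · intro a; apply h1; linear_combination a + hs - hr
        · intro a; apply h1; linear_combination hr - hs - a
          
    · left
      have hne : s ≠ r + 1 := by
        rintro rfl
        push_cast at hs
        apply h2; linear_combination hs - hr
      refine comm (r + 1) (by omega) (by omega) ⟨?_, ?_⟩ ⟨?_, ?_⟩ ?_ ?_ ?_ <;> push_cast
      · rintro ⟨a, b⟩; apply h1; linear_combination a - hr
      · rintro ⟨a, b⟩; apply h2; linear_combination b - hr
      · rintro ⟨a, b⟩; apply h1; linear_combination hs - b
      · rintro ⟨a, b⟩; apply h1; linear_combination a - hr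
      · intro a; apply h1; linear_combination -a
      · intro a; apply h2; linear_combination a - hr + hs
      · intro a; apply h1; linear_combination -hr + hs + a

theorem Up_decomp (hn : 3 ≤ n) (p : ℤ) (u : G) (hu : u ∈ A.Up) :
    ∃ κ ∈ A.K p, ∃ v, u = κ * A.x p (p + 1) v := by
  refine Subgroup.closure_induction
    (p := fun u _ => ∃ κ ∈ A.K p, ∃ v, u = κ * A.x p (p + 1) v) ?_ ?_ ?_ ?_ hu
  · rintro _ ⟨r, s, c, h, rfl⟩
    rcases A.gen_decomp hn p r s h c with h | h
    · exact ⟨_, h, 0, by rw [A.x_zero, mul_one]⟩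
    · exact ⟨1, one_mem _, c, by rw [h, one_mul]⟩
  · exact ⟨1, one_mem _, 0, by rw [A.x_zero, mul_one]⟩
  · rintro _ _ _ _ ⟨κ, hκ, v, rfl⟩ ⟨κ', hκ', v', rfl⟩
    refine ⟨κ * (A.x p (p + 1) v * κ' * (A.x p (p + 1) v)⁻¹),
      mul_mem hκ (A.conj_K hn p v κ' hκ').1, v + v', ?_⟩
    rw [A.x_add]; group
  · rintro _ _ ⟨κ, hκ, v, rfl⟩
    refine ⟨A.x p (p + 1) (-v) * κ⁻¹ * (A.x p (p + 1) (-v))⁻¹,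
      (A.conj_K hn p _ _ (inv_mem hκ)).1, -v, ?_⟩
    rw [A.x_neg]; group

theorem conj_C {g h : G} (hh : h ∈ A.C) : g * h * g⁻¹ ∈ A.C := A.hC.conj_mem h hh g

theorem x_ne (hn : 3 ≤ n) (p : ℤ) : (p : ZMod n) ≠ ((p + 1 : ℤ) : ZMod n) := by
  push_cast; simpa using one_ne hn

theorem UpC_decomp (hn : 3 ≤ n) (p : ℤ) (u : G) (hu : u ∈ A.Up) (huC : u ∈ A.C) :
    ∃ κ ∈ A.K p, κ ∈ A.C ∧ ∃ v ∈ IsLocalRing.maximalIdeal B, u = κ * A.x p (p + 1) v := by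
  obtain ⟨κ, hκ, v, rfl⟩ := A.Up_decomp hn p u hu
  have hv : v ∈ IsLocalRing.maximalIdeal B := by
    set w := A.x p (p + 1) (-1) * A.x (p + 1) p 1 * A.x p (p + 1) (-1) with hw
    have h1 : w * (κ * A.x p (p + 1) v) * w⁻¹ ∈ A.C := A.conj_C huC
    have h2 := A.S3 p (p + 1) (x_ne hn p) v
    rw [← hw] at h2
    have h3 : w * κ * w⁻¹ ∈ A.K p := by
      have a1 := (A.conj_K hn p (-1) _ hκ).1
      have a2 := (A.conj_K hn p 1 _ a1).2
      have a3 := (A.conj_K hn p (-1) _ a2).1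
      convert a3 using 1
      rw [hw]; group
    have h4 : w * (κ * A.x p (p + 1) v) * w⁻¹ = (w * κ * w⁻¹) * A.x (p + 1) p (-v) := by
      rw [← h2]; group
    rw [h4] at h1
    have h5 : A.x (p + 1) p (-v) * (w * κ * w⁻¹) ∈ A.C := by
      have := A.conj_C (g := (w * κ * w⁻¹)⁻¹) h1
      convert this using 1; group
    have := A.C_pos _ (A.K_le_Up p h3) p (-v) h5
    simpa using this
  refine ⟨κ, hκ, ?_, v, hv, rfl⟩
  have := mul_mem huC (inv_mem (A.x_mem_C p (p + 1) v hv))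
  simpa using this

theorem conj_H_neg (hn : 3 ≤ n) (p : ℤ) (c : B) (h : G) (hh : h ∈ A.H) :
    A.x (p + 1) p c * h * (A.x (p + 1) p c)⁻¹ ∈ A.H := by
  obtain ⟨u, hu0, t, ht, z, hz0, rfl⟩ := hh
  obtain ⟨hu, huC⟩ := Subgroup.mem_inf.mp hu0
  obtain ⟨hz, hzC⟩ := Subgroup.mem_inf.mp hz0
  obtain ⟨κ, hκ, hκC, v, hv, rfl⟩ := A.UpC_decomp hn p u hu huC
  obtain ⟨t', ht', v', c', hv', hc', e⟩ := A.S1 p (p + 1) (x_ne hn p) c v hv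
  obtain ⟨χ, hχ, eχ⟩ := A.T_conj t⁻¹ (inv_mem ht) (p + 1) p
  have e2 := eχ c'
  have hunit : IsUnit (1 + c * v) := by
    by_contra hcon
    have h3 : (1 + c * v) ∈ IsLocalRing.maximalIdeal B := hcon
    have := Ideal.sub_mem _ h3 (Ideal.mul_mem_left _ c hv)
    simp at this
  have hv'm : v' ∈ IsLocalRing.maximalIdeal B := by
    rw [← hv'] at hv
    exact (Ideal.unit_mul_mem_iff_mem _ hunit).mp hv
  have hcm : χ * c' - c ∈ IsLocalRing.maximalIdeal B := by
    have : χ * c' - c = (χ - 1) * c' - c * c' * v := by linear_combination hc'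
    rw [this]
    exact Ideal.sub_mem _ (Ideal.mul_mem_right _ _ hχ) (Ideal.mul_mem_left _ _ hv)
  have hyU : A.x (p + 1) p c ∈ A.Um := A.mem_Um (by omega) c
  refine ⟨(A.x (p + 1) p c * κ * (A.x (p + 1) p c)⁻¹) * A.x p (p + 1) v', ?_, t' * t,
    mul_mem ht' ht, A.x (p + 1) p (χ * c' - c) * (A.x (p + 1) p c * z * (A.x (p + 1) p c)⁻¹),
    ?_, ?_⟩
  · exact Subgroup.mem_inf.mpr ⟨mul_mem (A.K_le_Up p (A.conj_K hn p c κ hκ).2) (A.mem_Up (by omega) _),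
      mul_mem (A.conj_C hκC) (A.x_mem_C _ _ _ hv'm)⟩
  · exact Subgroup.mem_inf.mpr ⟨mul_mem (A.mem_Um (by omega) _) (mul_mem (mul_mem hyU hz) (inv_mem hyU)),
      mul_mem (A.x_mem_C _ _ _ hcm) (A.conj_C hzC)⟩
  · have e3 : A.x (p + 1) p (χ * c' - c) = t⁻¹ * A.x (p + 1) p c' * t * (A.x (p + 1) p c)⁻¹ := by
      rw [sub_eq_add_neg, A.x_add, A.x_neg, ← e2]; group
    rw [e3]
    calc A.x (p + 1) p c * (κ * A.x p (p + 1) v * t * z) * (A.x (p + 1) p c)⁻¹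
        = (A.x (p + 1) p c * κ * (A.x (p + 1) p c)⁻¹) * (A.x (p + 1) p c * A.x p (p + 1) v) * t * z
          * (A.x (p + 1) p c)⁻¹ := by group
      _ = _ := by rw [e]; group

theorem conj_H_pos (hn : 3 ≤ n) (p : ℤ) (c : B) (h : G) (hh : h ∈ A.H) :
    A.x p (p + 1) c * h * (A.x p (p + 1) c)⁻¹ ∈ A.H := by
  have h1 : h⁻¹ ∈ A.neg.H := by rw [mem_neg_H, inv_inv]; exact hh
  have h2 := A.neg.conj_H_neg hn (-(p + 1)) c _ h1
  rw [mem_neg_H] at h2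
  simp only [neg_x] at h2
  convert h2 using 1
  have e1 : -(-(p + 1) + 1) = p := by ring
  have e2 : -(-(p + 1)) = p + 1 := by ring
  rw [e1, e2]; group

/-- generation by simple roots -/
theorem E_le (hn : 3 ≤ n) (W : Subgroup G)
    (h : ∀ p c, A.x p (p + 1) c ∈ W) : ∀ (k : ℕ) (p q : ℤ), q - p = k → ∀ c, A.x p q c ∈ W := by
  have h1 := one_ne hn
  have h2 := two_ne hn
  intro k
  induction k using Nat.strong_induction_on with
  | _ k ih =>
    intro p q hk c
    by_cases hd : (p : ZMod n) = q
    · rw [A.x_deg p q hd]; exact one_mem _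
    by_cases hk0 : k = 0
    · subst hk0
      exact absurd (by rw [show p = q by simp at hk; omega]) hd
    by_cases hk1 : k = 1
    · subst hk1
      rw [show q = p + 1 by push_cast at hk; omega]; exact h p c
    have comm : ∀ t, p < t → t < q → (p : ZMod n) ≠ t → (t : ZMod n) ≠ q → A.x p q c ∈ W := by
      intro t a1 a2 a5 a6
      have e := A.x_mul p t q a5 a6 hd c 1
      have e' : A.x p q c = A.x p t c * A.x t q 1 * (A.x p t c)⁻¹ * (A.x t q 1)⁻¹ := by
        rw [e, mul_one]; group
      rw [e']
      have b1 := ih (t - p).toNat (by omega) p t (by omega) c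
      have b2 := ih (q - t).toNat (by omega) t q (by omega) 1
      exact mul_mem (mul_mem (mul_mem b1 b2) (inv_mem b1)) (inv_mem b2)
    by_cases hb : (p : ZMod n) = ((q - 1 : ℤ) : ZMod n)
    · by_cases hk2 : k = 2
      · exfalso
        rw [show q = p + 2 by omega] at hb
        push_cast at hb
        apply h1; linear_combination -hb
      refine comm (p + 2) (by omega) (by omega) ?_ ?_
      · push_cast; intro a; apply h2; linear_combination -a
      · push_cast at hb ⊢; intro a; apply h1; linear_combination a - hb
    · refine comm (q - 1) (by omega) (by omega) hb ?_
      push_cast; intro a; apply h1; linear_combination -a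

theorem E_le' (hn : 3 ≤ n) (W : Subgroup G)
    (h : ∀ p c, A.x p (p + 1) c ∈ W) (h' : ∀ p c, A.x (p + 1) p c ∈ W) : A.E ≤ W := by
  rw [E, Subgroup.closure_le]
  rintro _ ⟨p, q, c, rfl⟩
  rcases le_total p q with hpq | hpq
  · exact A.E_le hn W h (q - p).toNat p q (by omega) c
  · have := A.neg.E_le hn W (fun p c => by
      rw [neg_x]; convert h' (-(p + 1)) c using 2; ring) (p - q).toNat (-p) (-q) (by omega) c
    simpa [neg_x] using this

theorem conj_H (hn : 3 ≤ n) (g : G) (hg : g ∈ A.E) (h : G) (hh : h ∈ A.H) :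
    g * h * g⁻¹ ∈ A.H := by
  let W : Subgroup G :=
    { carrier := {g | (∀ h ∈ A.H, g * h * g⁻¹ ∈ A.H) ∧ (∀ h ∈ A.H, g⁻¹ * h * g ∈ A.H)}
      mul_mem' := by
        rintro a b ⟨ha, ha'⟩ ⟨hb, hb'⟩
        refine ⟨fun h hh => ?_, fun h hh => ?_⟩
        · have := ha _ (hb h hh); convert this using 1; group
        · have := hb' _ (ha' h hh); convert this using 1; group
      one_mem' := by
        refine ⟨fun h hh => ?_, fun h hh => ?_⟩ <;> simpa using hh
      inv_mem' := by
        rintro a ⟨ha, ha'⟩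
        exact ⟨by simpa using ha', by simpa using ha⟩ }
  have : A.E ≤ W := by
    apply A.E_le' hn
    · intro p c
      refine ⟨fun h hh => A.conj_H_pos hn p c h hh, fun h hh => ?_⟩
      have := A.conj_H_pos hn p (-c) h hh
      rwa [A.x_neg, inv_inv] at this
    · intro p c
      refine ⟨fun h hh => A.conj_H_neg hn p c h hh, fun h hh => ?_⟩
      have := A.conj_H_neg hn p (-c) h hh
      rwa [A.x_neg, inv_inv] at this
  exact (this hg).1 h hh

theorem one_mem_H : (1 : G) ∈ A.H := ⟨1, one_mem _, 1, one_mem _, 1, one_mem _, by simp⟩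

theorem mul_H_pos (p q : ℤ) (hpq : p < q) (c : B) (hc : c ∈ IsLocalRing.maximalIdeal B)
    (h : G) (hh : h ∈ A.H) : A.x p q c * h ∈ A.H := by
  obtain ⟨u, hu, t, ht, z, hz, rfl⟩ := hh
  exact ⟨A.x p q c * u, mul_mem ⟨A.mem_Up hpq c, A.x_mem_C _ _ _ hc⟩ hu, t, ht, z, hz, by group⟩

theorem mul_H_x (hn : 3 ≤ n) (p q : ℤ) (c : B) (hc : c ∈ IsLocalRing.maximalIdeal B)
    (h : G) (hh : h ∈ A.H) : A.x p q c * h ∈ A.H := by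
  by_cases hd : (p : ZMod n) = q
  · rw [A.x_deg p q hd, one_mul]; exact hh
  rcases lt_or_ge p q with hpq | hpq
  · exact A.mul_H_pos p q hpq c hc h hh
  · have hlt : q < p := lt_of_le_of_ne hpq (by rintro rfl; exact hd rfl)
    have e := A.S3 q p (Ne.symm hd) (-c)
    set w := A.x q p (-1) * A.x p q 1 * A.x q p (-1) with hw
    have hwE : w ∈ A.E := mul_mem (mul_mem (A.mem_E _ _ _) (A.mem_E _ _ _)) (A.mem_E _ _ _)
    rw [neg_neg] at e
    have h1 := A.conj_H hn w⁻¹ (inv_mem hwE) h hh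
    have h2 := A.mul_H_pos q p hlt (-c) (by simpa using hc) _ h1
    have h3 := A.conj_H hn w hwE _ h2
    convert h3 using 1
    rw [← e]; group

theorem mul_H (hn : 3 ≤ n) (g : G) (hg : g ∈ A.E) (p q : ℤ) (c : B)
    (hc : c ∈ IsLocalRing.maximalIdeal B)
    (h : G) (hh : h ∈ A.H) : (g * A.x p q c * g⁻¹) * h ∈ A.H := by
  have h1 := A.conj_H hn g⁻¹ (inv_mem hg) h hh
  have h2 := A.conj_H hn g hg _ (A.mul_H_x hn p q c hc _ h1)
  convert h2 using 1
  group

/-- The Birkhoff decomposition. -/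
theorem birkhoff (hn : 3 ≤ n) (M : Subgroup G) (hME : M ≤ A.E)
    (S1' : ∀ p q : ℤ, (p : ZMod n) ≠ q → ∀ c v : B, IsUnit (1 + c * v) →
      ∃ t ∈ M, ∃ v' c', A.x q p c * A.x p q v = A.x p q v' * t * A.x q p c')
    (S2 : ∀ p q : ℤ, (p : ZMod n) ≠ q → ∀ c : Bˣ,
      ∃ w ∈ M, A.x q p c = A.x p q (↑c⁻¹ : B) * w * A.x p q (↑c⁻¹ : B))
    (hM : ∀ w ∈ M, ∃ π : ℤ → ℤ, ∀ p q : ℤ, (p : ZMod n) ≠ q →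
      ((π p : ℤ) : ZMod n) ≠ ((π q : ℤ) : ZMod n) ∧ ∃ χ : B,
        ∀ c, w⁻¹ * A.x p q c * w = A.x (π p) (π q) (χ * c)) :
    ∀ g ∈ A.E, ∃ u ∈ A.Up, ∃ w ∈ M, ∃ z ∈ A.Um, ∃ h ∈ A.H, g = u * w * z * h := by
  let Z : Set G := {g | ∃ u ∈ A.Up, ∃ w ∈ M, ∃ z ∈ A.Um, ∃ h ∈ A.H, g = u * w * z * h}
  have hZU : ∀ u ∈ A.Up, ∀ g ∈ Z, u * g ∈ Z := by
    rintro u' hu' _ ⟨u, hu, w, hw, z, hz, h, hh, rfl⟩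
    exact ⟨u' * u, mul_mem hu' hu, w, hw, z, hz, h, hh, by group⟩
  have hneg : ∀ p c, ∀ g ∈ Z, A.x (p + 1) p c * g ∈ Z := by
    rintro p c _ ⟨u, hu, w, hw, z, hz, h, hh, rfl⟩
    obtain ⟨κ, hκ, v, rfl⟩ := A.Up_decomp hn p u hu
    suffices hy : (A.x (p + 1) p c * A.x p (p + 1) v) * (w * z * h) ∈ Z by
      have := hZU _ (A.K_le_Up p (A.conj_K hn p c κ hκ).2) _ hy
      convert this using 1; group
    have hne := x_ne hn p
    obtain ⟨π, hπ⟩ := hM w hw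
    obtain ⟨hπne, χ, hχ⟩ := hπ p (p + 1) hne
    obtain ⟨hπne', χ', hχ'⟩ := hπ (p + 1) p hne.symm
    have hwzE : (w * z)⁻¹ ∈ A.E := inv_mem (mul_mem (hME hw) (A.Um_le_E hz))
    have hsimp : ∀ d, A.x p (p + 1) d ∈ A.Up := fun d => A.mem_Up (by omega) d
    -- absorption of small elements
    have absorb : ∀ (r s : ℤ) (d : B), d ∈ IsLocalRing.maximalIdeal B → ∀ w' ∈ M, 
        w' * A.x r s d * (w * z * h) ∈ Z := by
      intro r s d hd w' hw'
      refine ⟨1, one_mem _, w' * w, mul_mem hw' hw, z, hz, _,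
        A.mul_H hn _ hwzE r s d hd h hh, ?_⟩
      group
    by_cases hc : IsUnit c
    · obtain ⟨c, rfl⟩ := hc
      obtain ⟨w', hw', e⟩ := S2 p (p + 1) hne c
      have e2 : A.x (p + 1) p c * A.x p (p + 1) v =
          A.x p (p + 1) (↑c⁻¹ : B) * (w' * A.x p (p + 1) ((↑c⁻¹ : B) + v)) := by
        rw [e, A.x_add]; group
      rcases lt_or_gt_of_ne (show π p ≠ π (p + 1) by
        intro h; exact hπne (by rw [h])) with hlt | hgt
      · -- b > 0
        by_cases hu1 : IsUnit (1 + c * v)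
        · obtain ⟨t, ht, v', c', e3⟩ := S1' p (p + 1) hne c v hu1
          rw [e3]
          have := hZU _ (hsimp v') (t * w * (w⁻¹ * A.x (p + 1) p c' * w) * z * h) (by
            refine ⟨1, one_mem _, t * w, mul_mem ht hw, (w⁻¹ * A.x (p + 1) p c' * w) * z,
              mul_mem ?_ hz, h, hh, by group⟩
            rw [hχ']; exact A.mem_Um hlt _)
          convert this using 1; group
        · rw [e2, mul_assoc]
          apply hZU _ (hsimp _)
          apply absorb _ _ _ _ _ hw'
          have : (↑c⁻¹ : B) + v = (↑c⁻¹ : B) * (1 + c * v) := by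
            rw [mul_add, mul_one, Units.inv_mul_cancel_left]
          rw [this]
          exact Ideal.mul_mem_left _ _ hu1
      · rw [e2, mul_assoc]
        apply hZU _ (hsimp _)
        refine ⟨1, one_mem _, w' * w, mul_mem hw' hw,
          (w⁻¹ * A.x p (p + 1) ((↑c⁻¹ : B) + v) * w) * z, mul_mem ?_ hz, h, hh, by group⟩
        rw [hχ]; exact A.mem_Um hgt _
    · -- c in the maximal ideal
      rcases lt_or_gt_of_ne (show π p ≠ π (p + 1) by
        intro h; exact hπne (by rw [h])) with hlt | hgt
      · have hu1 : IsUnit (1 + c * v) := by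
          by_contra hcon
          have h3 : (1 + c * v) ∈ IsLocalRing.maximalIdeal B := hcon
          have := Ideal.sub_mem _ h3 (Ideal.mul_mem_right v _ (show c ∈ _ from hc))
          simp at this
        obtain ⟨t, ht, v', c', e3⟩ := S1' p (p + 1) hne c v hu1
        rw [e3]
        have := hZU _ (hsimp v') (t * w * (w⁻¹ * A.x (p + 1) p c' * w) * z * h) (by
          refine ⟨1, one_mem _, t * w, mul_mem ht hw, (w⁻¹ * A.x (p + 1) p c' * w) * z,
            mul_mem ?_ hz, h, hh, by group⟩
          rw [hχ']; exact A.mem_Um hlt _)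
        convert this using 1; group
      · refine ⟨A.x p (p + 1) v, hsimp v, w, hw, z, hz,
          (((w * z)⁻¹ * (A.x p (p + 1) v)⁻¹) * A.x (p + 1) p c *
            ((w * z)⁻¹ * (A.x p (p + 1) v)⁻¹)⁻¹) * h, A.mul_H hn _ ?_ _ _ c hc h hh, by group⟩
        exact mul_mem hwzE (inv_mem (A.mem_E _ _ _))
  let W : Subgroup G :=
    { carrier := {g | (∀ z ∈ Z, g * z ∈ Z) ∧ (∀ z ∈ Z, g⁻¹ * z ∈ Z)}
      mul_mem' := by
        rintro a b ⟨ha, ha'⟩ ⟨hb, hb'⟩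
        refine ⟨fun h hh => ?_, fun h hh => ?_⟩
        · have := ha _ (hb h hh); convert this using 1; group
        · have := hb' _ (ha' h hh); convert this using 1; group
      one_mem' := by
        refine ⟨fun h hh => ?_, fun h hh => ?_⟩ <;> simpa using hh
      inv_mem' := by
        rintro a ⟨ha, ha'⟩
        exact ⟨by simpa using ha', by simpa using ha⟩ }
  have hEW : A.E ≤ W := by
    apply A.E_le' hn
    · intro p c
      exact ⟨hZU _ (A.mem_Up (by omega) c), hZU _ (inv_mem (A.mem_Up (by omega) c))⟩
    · intro p c
      refine ⟨hneg p c, ?_⟩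
      rw [← A.x_neg]; exact hneg p (-c)
  intro g hg
  have h1 := (hEW hg).1 1 ⟨1, one_mem _, 1, one_mem _, 1, one_mem _, 1, A.one_mem_H, by simp⟩
  rw [mul_one] at h1
  exact h1

end Aff

end Part4

section Part5
set_option linter.unusedSimpArgs false

section emb
variable {n : ℕ} {R : Type*} [CommRing R]

/-- Two by two block. -/
def emb (i j : Fin n) (a b c d : R) : Matrix (Fin n) (Fin n) R :=
  1 + (a - 1) • Matrix.single i i 1 + b • Matrix.single i j 1 + c • Matrix.single j i 1
    + (d - 1) • Matrix.single j j 1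

theorem emb_mul (i j : Fin n) (h : i ≠ j) (a b c d a' b' c' d' : R) :
    emb i j a b c d * emb i j a' b' c' d' =
      emb i j (a * a' + b * c') (a * b' + b * d') (c * a' + d * c') (c * b' + d * d') := by
  have h' := h.symm
  simp only [emb, add_mul, mul_add, one_mul, mul_one, Matrix.smul_mul, Matrix.mul_smul,
    Matrix.single_mul_single_same, Matrix.single_mul_single_of_ne _ _ _ _ h,
    Matrix.single_mul_single_of_ne _ _ _ _ h', smul_zero]
  module

theorem emb_elem (i j : Fin n) (h : i ≠ j) (r : R) : (elem i j h r).1 = emb i j 1 r 0 1 := by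
  change 1 + Matrix.single i j r = _
  simp [emb, Matrix.smul_single]

theorem emb_elem' (i j : Fin n) (h : j ≠ i) (r : R) : (elem j i h r).1 = emb i j 1 0 r 1 := by
  change 1 + Matrix.single j i r = _
  simp [emb, Matrix.smul_single]

theorem emb_diag (i j : Fin n) (h : i ≠ j) (a d : R) :
    emb i j a 0 0 d = Matrix.diagonal (fun k => if k = i then a else if k = j then d else 1) := by
  have h' := h.symm
  ext p q
  simp only [emb, Matrix.add_apply, Matrix.smul_apply, Matrix.single_apply, Matrix.one_apply,
    Matrix.diagonal_apply, smul_eq_mul, zero_mul, zero_smul, Matrix.zero_apply]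
  by_cases h1 : p = q
  · subst h1
    by_cases h2 : p = i
    · subst h2; simp [h, h']
    · by_cases h3 : p = j
      · subst h3; simp [h, h', Ne.symm h2]
      · simp [h2, h3, Ne.symm h2, Ne.symm h3]
  · have : ∀ k, ¬ (k = p ∧ k = q) := fun k hk => h1 (hk.1.symm.trans hk.2)
    simp [h1, this]

theorem emb_anti (i j : Fin n) (h : i ≠ j) (b c : R) (p q : Fin n) :
    emb i j 0 b c 0 p q = if Equiv.swap i j q = p then
      (if q = i then c else if q = j then b else 1) else 0 := by
  have h' := h.symm
  simp only [emb, Matrix.add_apply, Matrix.smul_apply, Matrix.single_apply, Matrix.one_apply,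
    smul_eq_mul]
  by_cases h1 : q = i
  · subst h1
    rw [Equiv.swap_apply_left]
    by_cases h2 : j = p
    · subst h2; simp [h, h']
    · by_cases h3 : p = q
      · subst h3; simp [h, h']
      · simp [h, h', h2, h3, Ne.symm h3]
  · by_cases h4 : q = j
    · subst h4
      rw [Equiv.swap_apply_right]
      by_cases h2 : i = p
      · subst h2; simp [h, h']
      · by_cases h3 : p = q
        · subst h3; simp [h, h']
        · simp [h, h', h2, h3, Ne.symm h3]
    · rw [Equiv.swap_apply_of_ne_of_ne h1 h4]
      by_cases h3 : p = q
      · subst h3; simp [h1, h4, Ne.symm h1, Ne.symm h4]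
      · simp [h1, h4, Ne.symm h1, Ne.symm h4, h3, Ne.symm h3]
end emb

section laurent
open LaurentPolynomial

variable {n : ℕ} [NeZero n] {R K : Type*} [CommRing R] [CommRing K]

/-- Laurent base change -/
noncomputable def lam (f : R →+* K) : R[T;T⁻¹] →+* K[T;T⁻¹] := AddMonoidAlgebra.mapRingHom ℤ f

theorem lam_coeff (f : R →+* K) (x : R[T;T⁻¹]) (m : ℤ) : (lam f x).coeff m = f (x.coeff m) :=
  AddMonoidAlgebra.coeff_mapRingHom f x m

theorem lam_CT (f : R →+* K) (c : R) (m : ℤ) : lam f (C c * T m) = C (f c) * T m := by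
  rw [← single_eq_C_mul_T, ← single_eq_C_mul_T]
  exact AddMonoidAlgebra.mapRingHom_single f m c

theorem lam_C (f : R →+* K) (c : R) : lam f (C c) = C (f c) := by
  have := lam_CT f c 0
  simpa using this

theorem lam_T (f : R →+* K) (m : ℤ) : lam f (T m) = T m := by
  have := lam_CT f 1 m
  simpa using this

theorem CT_mul (c d : R) (a b : ℤ) : (C c * T a) * (C d * T b) = C (c * d) * T (a + b) := by
  rw [T_add, C.map_mul]; ring

theorem CT_coeff (c : R) (a m : ℤ) : (C c * T a).coeff m = if a = m then c else 0 := by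
  rw [← single_eq_C_mul_T]
  exact Finsupp.single_apply

/-- residue -/
def fi (n : ℕ) [NeZero n] (p : ℤ) : Fin n :=
  ⟨(p % n).toNat, by
    have h0 : (0 : ℤ) < n := by exact_mod_cast Nat.pos_of_ne_zero (NeZero.ne n)
    have := Int.emod_lt_of_pos p h0
    have := Int.emod_nonneg p h0.ne'
    omega⟩

theorem npos (n : ℕ) [NeZero n] : (0 : ℤ) < n := by
  exact_mod_cast Nat.pos_of_ne_zero (NeZero.ne n)

theorem fi_val (p : ℤ) : ((fi n p).1 : ℤ) = p % n :=
  Int.toNat_of_nonneg (Int.emod_nonneg p (npos n).ne')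

theorem fi_eq {p q : ℤ} : fi n p = fi n q ↔ (p : ZMod n) = q := by
  rw [ZMod.intCast_eq_intCast_iff, Int.ModEq, ← fi_val, ← fi_val, Fin.ext_iff]
  norm_cast

theorem fi_ne {p q : ℤ} : fi n p ≠ fi n q ↔ (p : ZMod n) ≠ q := not_congr fi_eq

theorem fi_div (p : ℤ) : ((fi n p).1 : ℤ) + n * (p / n) = p := by
  rw [fi_val]; exact Int.emod_add_mul_ediv p n

theorem fi_mk (i : Fin n) (a : ℤ) : fi n (i.1 + n * a) = i ∧ ((i.1 : ℤ) + n * a) / n = a := by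
  have h := npos n
  have hi : ((i.1 : ℤ)) < n := by exact_mod_cast i.2
  constructor
  · apply Fin.ext
    have := fi_val (n := n) (i.1 + n * a)
    rw [Int.add_mul_emod_self_left, Int.emod_eq_of_lt (by omega) hi] at this
    exact_mod_cast this
  · rw [Int.add_mul_ediv_left _ _ h.ne', Int.ediv_eq_zero_of_lt (by omega) hi, zero_add]

/-- affine root elements -/
noncomputable def rx (n : ℕ) [NeZero n] (p q : ℤ) (c : R) :
    Matrix.SpecialLinearGroup (Fin n) R[T;T⁻¹] :=
  if h : fi n p ≠ fi n q then elem (fi n p) (fi n q) h (C c * T (q / n - p / n)) else 1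

theorem rx_of_ne {p q : ℤ} (h : fi n p ≠ fi n q) (c : R) :
    rx n p q c = elem (fi n p) (fi n q) h (C c * T (q / n - p / n)) := dif_pos h

theorem rx_of_eq {p q : ℤ} (h : fi n p = fi n q) (c : R) : rx n p q c = 1 :=
  dif_neg (not_not.mpr h)

theorem rx_mk (i j : Fin n) (h : i ≠ j) (a : ℤ) (c : R) :
    rx n (i.1) (j.1 + n * a) c = elem i j h (C c * T a) := by
  have h1 := fi_mk (n := n) i 0
  have h2 := fi_mk (n := n) j a
  simp only [mul_zero, add_zero] at h1
  have e : C c * T ((↑↑j + ↑n * a) / ↑n - ↑↑i / (n : ℤ)) = C c * T a := by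
    rw [h2.2, h1.2, sub_zero]
  rw [rx_of_ne (by rw [h1.1, h2.1]; exact h), e]
  congr 1
  · exact h1.1
  · exact h2.1

theorem rx_lam (f : R →+* K) (p q : ℤ) (c : R) : sm (lam f) (rx n p q c) = rx n p q (f c) := by
  by_cases h : fi n p = fi n q
  · rw [rx_of_eq h, rx_of_eq h, map_one]
  · rw [rx_of_ne h, rx_of_ne h, sm_elem, lam_CT]

theorem rx_add (p q : ℤ) (c d : R) : rx n p q (c + d) = rx n p q c * rx n p q d := by
  by_cases h : fi n p = fi n q
  · rw [rx_of_eq h, rx_of_eq h, rx_of_eq h, mul_one]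
  · rw [rx_of_ne h, rx_of_ne h, rx_of_ne h, ← elem_add, C.map_add, add_mul]

theorem rx_zero (p q : ℤ) : rx n p q (0 : R) = 1 := by
  have := rx_add (n := n) p q (0 : R) 0
  rw [add_zero] at this
  exact left_eq_mul.mp this

theorem rx_neg (p q : ℤ) (c : R) : rx n p q (-c) = (rx n p q c)⁻¹ := by
  rw [eq_inv_iff_mul_eq_one, ← rx_add, neg_add_cancel, rx_zero]

theorem rx_mem_El (p q : ℤ) (c : R) : rx n p q c ∈ El n R[T;T⁻¹] := by
  by_cases h : fi n p = fi n q
  · rw [rx_of_eq h]; exact one_mem _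
  · rw [rx_of_ne h]; exact elem_mem_El _ _ _ _

theorem rx_shift (p q k : ℤ) (c : R) : rx n (p + n * k) (q + n * k) c = rx n p q c := by
  have e : ∀ p : ℤ, fi n (p + n * k) = fi n p := by
    intro p; rw [fi_eq]; simp
  have e2 : ∀ p : ℤ, (p + n * k) / (n : ℤ) = p / n + k := by
    intro p; rw [Int.add_mul_ediv_left _ _ (npos n).ne']
  simp only [rx, e, e2, add_sub_add_right_eq_sub]

/-- the Iwahori type filtration -/
def iw (s : ℤ) (g : Matrix (Fin n) (Fin n) R[T;T⁻¹]) : Prop :=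
  ∀ i j l, s * (l * n + j.1 - i.1) < 0 → (g i j).coeff l = 0

theorem iw_one (s : ℤ) : iw s (1 : Matrix (Fin n) (Fin n) R[T;T⁻¹]) := by
  intro i j l h
  rw [Matrix.one_apply]
  split_ifs with hij
  · subst hij
    have := CT_coeff (1 : R) 0 l
    simp only [map_one, T_zero, mul_one] at this
    rw [this, if_neg]
    rintro rfl
    simp at h
  · rfl

theorem coeff_mul_zero {x y : R[T;T⁻¹]} {l : ℤ}
    (h : ∀ a b, a + b = l → x.coeff a = 0 ∨ y.coeff b = 0) : (x * y).coeff l = 0 := by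
  rw [AddMonoidAlgebra.coeff_mul]
  apply Finset.sum_eq_zero
  intro a _
  apply Finset.sum_eq_zero
  intro b _
  dsimp only
  split_ifs with hab
  · rcases h a b hab with h | h <;> rw [h] <;> simp
  · rfl

theorem iw_mul {s : ℤ} {g h : Matrix (Fin n) (Fin n) R[T;T⁻¹]} (hg : iw s g) (hh : iw s h) :
    iw s (g * h) := by
  intro i j l hl
  rw [Matrix.mul_apply]
  have : ∀ (F : Finset (Fin n)) (f : Fin n → R[T;T⁻¹]), (∀ k, (f k).coeff l = 0) →
      (∑ k ∈ F, f k).coeff l = 0 := by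
    intro F f hf
    induction F using Finset.induction_on with
    | empty => rfl
    | insert a F ha ih =>
      rw [Finset.sum_insert ha, AddMonoidAlgebra.coeff_add, Finsupp.add_apply, ih, hf, add_zero]
  apply this
  intro k
  apply coeff_mul_zero
  intro a b hab
  by_contra hcon
  rw [not_or] at hcon
  have h1 : ¬ s * (a * n + k.1 - i.1) < 0 := fun h => hcon.1 (hg i k a h)
  have h2 : ¬ s * (b * n + j.1 - k.1) < 0 := fun h => hcon.2 (hh k j b h)
  have : s * (l * n + j.1 - i.1) = s * (a * n + k.1 - i.1) + s * (b * n + j.1 - k.1) := by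
    rw [← hab]; ring
  omega

theorem iw_rx {s : ℤ} (p q : ℤ) (h : 0 < s * (q - p)) (c : R) : iw s (rx n p q c).1 := by
  by_cases hd : fi n p = fi n q
  · rw [rx_of_eq hd]; exact iw_one s
  · rw [rx_of_ne hd]
    change iw s (1 + Matrix.single _ _ _)
    intro i j l hl
    rw [Matrix.add_apply, AddMonoidAlgebra.coeff_add, Finsupp.add_apply, iw_one s i j l hl,
      zero_add, Matrix.single_apply]
    split_ifs with hij
    · obtain ⟨rfl, rfl⟩ := hij
      rw [CT_coeff, if_neg]
      rintro rfl
      have e1 := fi_div (n := n) p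
      have e2 := fi_div (n := n) q
      have : (q / (n : ℤ) - p / n) * n + (fi n q).1 - (fi n p).1 = q - p := by linarith
      rw [this] at hl
      omega
    · rfl

theorem iw_closure (s : ℤ) (P : ℤ → ℤ → Prop) (hP : ∀ p q, P p q → 0 < s * (q - p))
    (u : Matrix.SpecialLinearGroup (Fin n) R[T;T⁻¹])
    (hu : u ∈ Subgroup.closure {g | ∃ p q c, P p q ∧ g = rx n p q c}) : iw s u.1 := by
  refine (Subgroup.closure_induction (p := fun u _ => iw s u.1 ∧ iw s (u⁻¹).1) ?_ ?_ ?_ ?_ hu).1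
  · rintro _ ⟨p, q, c, h, rfl⟩
    rw [← rx_neg]
    exact ⟨iw_rx p q (hP p q h) c, iw_rx p q (hP p q h) (-c)⟩
  · rw [inv_one]; exact ⟨iw_one s, iw_one s⟩
  · rintro x y _ _ ⟨h1, h2⟩ ⟨h3, h4⟩
    rw [mul_inv_rev]
    exact ⟨iw_mul h1 h3, iw_mul h4 h2⟩
  · rintro x _ ⟨h1, h2⟩
    rw [inv_inv]; exact ⟨h2, h1⟩

theorem rx_iw_zero (s p q : ℤ) (h : s * (q - p) < 0) (hd : fi n p ≠ fi n q) (c : R)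
    (hi : iw s (rx n p q c).1) : c = 0 := by
  have e1 := fi_div (n := n) p
  have e2 := fi_div (n := n) q
  have := hi (fi n p) (fi n q) (q / (n : ℤ) - p / n) (by
    rw [show (q / (n : ℤ) - p / n) * n + (fi n q).1 - (fi n p).1 = q - p by linarith]
    exact h)
  rw [rx_of_ne hd] at this
  change ((1 + Matrix.single (fi n p) (fi n q) (C c * T (q / n - p / n)) :
    Matrix (Fin n) (Fin n) R[T;T⁻¹]) _ _).coeff _ = _ at this
  rw [Matrix.add_apply, Matrix.one_apply_ne hd, zero_add, Matrix.single_apply_same, CT_coeff,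
    if_pos rfl] at this
  exact this

theorem closure_lam (f : R →+* K) (P : ℤ → ℤ → Prop)
    (u : Matrix.SpecialLinearGroup (Fin n) R[T;T⁻¹])
    (hu : u ∈ Subgroup.closure {g | ∃ p q c, P p q ∧ g = rx n p q c}) :
    sm (lam f) u ∈ Subgroup.closure {g | ∃ p q c, P p q ∧ g = rx n p q c} := by
  have : Subgroup.closure {g | ∃ p q c, P p q ∧ g = rx n p q (c : R)} ≤
      (Subgroup.closure {g | ∃ p q c, P p q ∧ g = rx n p q (c : K)}).comap (sm (lam f)) := by
    rw [Subgroup.closure_le]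
    rintro _ ⟨p, q, c, h, rfl⟩
    rw [SetLike.mem_coe, Subgroup.mem_comap, rx_lam]
    exact Subgroup.subset_closure ⟨p, q, f c, h, rfl⟩
  exact this hu

theorem C_aux (f : R →+* K) (s : ℤ) (P : ℤ → ℤ → Prop) (hP : ∀ p q, P p q → 0 < s * (q - p))
    (u : Matrix.SpecialLinearGroup (Fin n) R[T;T⁻¹])
    (hu : u ∈ Subgroup.closure {g | ∃ p q c, P p q ∧ g = rx n p q c})
    (p q : ℤ) (h : s * (q - p) < 0) (hd : fi n p ≠ fi n q) (v : R)
    (hm : rx n p q v * u ∈ (sm (lam f)).ker) : f v = 0 := by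
  rw [MonoidHom.mem_ker, map_mul, rx_lam] at hm
  have h1 := iw_closure s P hP _ (closure_lam f P u hu)
  have h2 : sm (lam f) u = rx n p q (-f v) := by
    rw [rx_neg]; exact eq_inv_of_mul_eq_one_right hm
  rw [h2] at h1
  have := rx_iw_zero s p q h hd _ h1
  simpa using this

end laurent

end Part5

section Part6
set_option linter.unusedSimpArgs false
set_option linter.unusedSectionVars false

section mono
open LaurentPolynomial

variable {n : ℕ} [NeZero n] {R K : Type*} [CommRing R] [CommRing K]

/-- monomial matrices -/
noncomputable def monm (f : Equiv.Perm (Fin n)) (u : Fin n → Rˣ) (a : Fin n → ℤ) :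
    Matrix (Fin n) (Fin n) R[T;T⁻¹] :=
  Matrix.of fun i j => if f j = i then C (u j : R) * T (a j) else 0

theorem monm_apply (f : Equiv.Perm (Fin n)) (u : Fin n → Rˣ) (a : Fin n → ℤ) (i j : Fin n) :
    monm f u a i j = if f j = i then C (u j : R) * T (a j) else 0 := rfl

theorem monm_one : (monm 1 1 0 : Matrix (Fin n) (Fin n) R[T;T⁻¹]) = 1 := by
  ext1 i j
  rw [monm_apply, Matrix.one_apply]
  simp [eq_comm]

theorem monm_mul (f f' : Equiv.Perm (Fin n)) (u u' : Fin n → Rˣ) (a a' : Fin n → ℤ) :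
    monm f u a * monm f' u' a' =
      monm (f * f') (fun k => u (f' k) * u' k) (fun k => a (f' k) + a' k) := by
  ext1 i k
  rw [Matrix.mul_apply, Finset.sum_eq_single (f' k)]
  · rw [monm_apply, monm_apply, monm_apply, if_pos rfl]
    simp only [Equiv.Perm.mul_apply, ite_mul, zero_mul, CT_mul, Units.val_mul]
    rfl
  · intro b _ hb
    rw [monm_apply (i := b), if_neg (Ne.symm hb), mul_zero]
  · intro h; exact absurd (Finset.mem_univ _) h

theorem monm_inv (g : Matrix.SpecialLinearGroup (Fin n) R[T;T⁻¹]) (f : Equiv.Perm (Fin n))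
    (u : Fin n → Rˣ) (a : Fin n → ℤ) (hg : g.1 = monm f u a) :
    (g⁻¹).1 = monm f⁻¹ (fun k => (u (f⁻¹ k))⁻¹) (fun k => - a (f⁻¹ k)) := by
  have h1 : g.1 * monm f⁻¹ (fun k => (u (f⁻¹ k))⁻¹) (fun k => - a (f⁻¹ k)) = 1 := by
    rw [hg, monm_mul, ← monm_one]
    congr 1
    · simp
    · ext k; simp
    · ext k; simp
  have h2 : (g⁻¹).1 * g.1 = 1 := by
    have : (g⁻¹ * g).1 = 1 := by rw [inv_mul_cancel]; rfl
    exact this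
  calc (g⁻¹).1 = (g⁻¹).1 * (g.1 * monm f⁻¹ (fun k => (u (f⁻¹ k))⁻¹) (fun k => - a (f⁻¹ k))) := by
        rw [h1, mul_one]
    _ = _ := by rw [← mul_assoc, h2, one_mul]

/-- the monomial subgroup -/
def monSub (n : ℕ) [NeZero n] (R : Type*) [CommRing R] :
    Subgroup (Matrix.SpecialLinearGroup (Fin n) R[T;T⁻¹]) where
  carrier := {g | ∃ f u a, g.1 = monm f u a}
  mul_mem' := by
    rintro g h ⟨f, u, a, hg⟩ ⟨f', u', a', hh⟩
    refine ⟨f * f', fun k => u (f' k) * u' k, fun k => a (f' k) + a' k, ?_⟩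
    rw [← monm_mul, ← hg, ← hh]; rfl
  one_mem' := ⟨1, 1, 0, by rw [monm_one]; rfl⟩
  inv_mem' := by
    rintro g ⟨f, u, a, hg⟩
    exact ⟨_, _, _, monm_inv g f u a hg⟩

/-- the torus -/
def torSub (n : ℕ) [NeZero n] (R : Type*) [CommRing R] :
    Subgroup (Matrix.SpecialLinearGroup (Fin n) R[T;T⁻¹]) where
  carrier := {g | ∃ u, g.1 = monm 1 u 0}
  mul_mem' := by
    rintro g h ⟨u, hg⟩ ⟨u', hh⟩
    refine ⟨fun k => u k * u' k, ?_⟩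
    have := monm_mul 1 1 u u' 0 0
    rw [← hg, ← hh] at this
    refine this.trans ?_
    congr 1
  one_mem' := ⟨1, by rw [monm_one]; rfl⟩
  inv_mem' := by
    rintro g ⟨u, hg⟩
    refine ⟨fun k => (u k)⁻¹, (monm_inv g 1 u 0 hg).trans ?_⟩
    congr 1

theorem conj_mon_elem (g : Matrix.SpecialLinearGroup (Fin n) R[T;T⁻¹]) (f : Equiv.Perm (Fin n))
    (u : Fin n → Rˣ) (a : Fin n → ℤ) (hg : g.1 = monm f u a) (i j : Fin n) (h : i ≠ j)
    (r : R[T;T⁻¹]) : g * elem i j h r * g⁻¹ =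
      elem (f i) (f j) (f.injective.ne h)
        (C ((u i : R) * (↑(u j)⁻¹ : R)) * T (a i - a j) * r) := by
  rw [mul_inv_eq_iff_eq_mul]
  apply SLext
  change g.1 * (1 + Matrix.single i j r) = (1 + Matrix.single _ _ _) * g.1
  rw [mul_add, add_mul, mul_one, one_mul, hg]
  congr 1
  ext1 k l
  by_cases hl : l = j
  · subst hl
    rw [Matrix.mul_single_apply_same]
    by_cases hk : k = f i
    · subst hk
      rw [Matrix.single_mul_apply_same, monm_apply, monm_apply, if_pos rfl, if_pos rfl]
      have : (C ((u i : R) * (↑(u l)⁻¹ : R)) * T (a i - a l)) * (C (u l : R) * T (a l)) =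
          C (u i : R) * T (a i) := by
        rw [CT_mul]; simp [mul_assoc]
      rw [← this]; ring
    · rw [Matrix.single_mul_apply_of_ne (h := hk), monm_apply, if_neg (Ne.symm hk), zero_mul]
  · rw [Matrix.mul_single_apply_of_ne (hbj := hl)]
    by_cases hk : k = f i
    · subst hk
      rw [Matrix.single_mul_apply_same, monm_apply, if_neg, mul_zero]
      exact fun h => hl (f.injective h)
    · rw [Matrix.single_mul_apply_of_ne (h := hk)]

/-- action of monomial matrices on affine indices -/
def mact (f : Equiv.Perm (Fin n)) (a : Fin n → ℤ) (p : ℤ) : ℤ :=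
  (f (fi n p)).1 + n * (p / n - a (fi n p))

theorem conj_mon_rx (g : Matrix.SpecialLinearGroup (Fin n) R[T;T⁻¹]) (f : Equiv.Perm (Fin n))
    (u : Fin n → Rˣ) (a : Fin n → ℤ) (hg : g.1 = monm f u a) (p q : ℤ) (c : R) :
    g * rx n p q c * g⁻¹ = rx n (mact f a p) (mact f a q)
      (((u (fi n p) : R) * (↑(u (fi n q))⁻¹ : R)) * c) := by
  have hp := fi_mk (n := n) (f (fi n p)) (p / n - a (fi n p))
  have hq := fi_mk (n := n) (f (fi n q)) (q / n - a (fi n q))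
  by_cases hd : fi n p = fi n q
  · rw [rx_of_eq hd, rx_of_eq]
    · simp
    · rw [mact, mact, hp.1, hq.1, hd]
  · have hd' : fi n (mact f a p) ≠ fi n (mact f a q) := by
      rw [mact, mact, hp.1, hq.1]; exact f.injective.ne hd
    rw [rx_of_ne hd, rx_of_ne hd', conj_mon_elem g f u a hg]
    have e : C (((u (fi n p) : R) * (↑(u (fi n q))⁻¹ : R)) * c) *
        T (mact f a q / n - mact f a p / n) = C ((u (fi n p) : R) * (↑(u (fi n q))⁻¹ : R)) *
          T (a (fi n p) - a (fi n q)) * (C c * T (q / n - p / n)) := by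
      rw [CT_mul, mact, mact, hp.2, hq.2]
      congr 2; ring
    rw [e]
    congr 1
    · exact hp.1.symm
    · exact hq.1.symm

theorem sl2_S1 (i j : Fin n) (h : i ≠ j) (c v : R) (b : Rˣ) (hb : (b : R) = 1 + c * v) (τ : ℤ) :
    ((elem i j h (C ((↑b⁻¹ : R) * v) * T τ))⁻¹ * elem j i h.symm (C c * T (-τ)) *
      elem i j h (C v * T τ) * (elem j i h.symm (C ((↑b⁻¹ : R) * c) * T (-τ)))⁻¹).1 =
      monm 1 (fun k => if k = i then b⁻¹ else if k = j then b else 1) 0 := by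
  rw [← elem_neg, ← elem_neg]
  change (elem i j h _).1 * (elem j i h.symm _).1 * (elem i j h _).1 * (elem j i h.symm _).1 = _
  rw [emb_elem i j h, emb_elem i j h, emb_elem' i j h.symm, emb_elem' i j h.symm, emb_mul i j h, emb_mul i j h, emb_mul i j h]
  have hT : (T τ : R[T;T⁻¹]) * T (-τ) = 1 := by rw [← T_add]; simp
  have hbb : (C (b : R) : R[T;T⁻¹]) * C (↑b⁻¹ : R) = 1 := by rw [← map_mul]; simp
  have hbC : (C (b : R) : R[T;T⁻¹]) = 1 + C c * C v := by rw [hb]; simp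
  have e : (monm 1 (fun k => if k = i then b⁻¹ else if k = j then b else 1) 0 :
      Matrix (Fin n) (Fin n) R[T;T⁻¹]) = emb i j (C (↑b⁻¹ : R)) 0 0 (C (b : R)) := by
    rw [emb_diag i j h]
    ext1 p q
    rw [monm_apply, Matrix.diagonal_apply]
    by_cases hpq : p = q
    · subst hpq
      simp only [Equiv.Perm.one_apply, if_pos, Pi.zero_apply, T_zero, mul_one]
      split_ifs <;> simp
    · rw [if_neg hpq, if_neg]; exact fun h => hpq h.symm
  rw [e]
  simp only [map_mul]
  set x := (C c : R[T;T⁻¹])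
  set y := (C v : R[T;T⁻¹])
  set z := (C (↑b⁻¹ : R) : R[T;T⁻¹])
  set t := (T τ : R[T;T⁻¹])
  set s := (T (-τ) : R[T;T⁻¹])
  rw [hbC] at hbb ⊢
  congr 1
  · linear_combination (-2 * (z*x*y) + (z*x*y)^2 * (t * s + 1) + z * (z * x * y)) * hT
      + (z * x * y - 1) * hbb
  · linear_combination (- z * y * y * x * t) * hT - y * t * hbb
  · linear_combination (- x * s * z * x * y) * hT - x * s * hbb
  · linear_combination x * y * hT

theorem sl2_S2 (i j : Fin n) (h : i ≠ j) (c : Rˣ) (τ : ℤ) :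
    (elem i j h (C (-(↑c⁻¹ : R)) * T τ) * elem j i h.symm (C (c : R) * T (-τ)) *
      elem i j h (C (-(↑c⁻¹ : R)) * T τ)).1 =
      monm (Equiv.swap i j) (fun k => if k = i then c else if k = j then -c⁻¹ else 1)
        (fun k => if k = i then -τ else if k = j then τ else 0) := by
  change (elem i j h _).1 * (elem j i h.symm _).1 * (elem i j h _).1 = _
  rw [emb_elem i j h, emb_elem' i j h.symm, emb_mul i j h, emb_mul i j h]
  have hT : (T τ : R[T;T⁻¹]) * T (-τ) = 1 := by rw [← T_add]; simp
  have hbb : (C (c : R) : R[T;T⁻¹]) * C (↑c⁻¹ : R) = 1 := by rw [← map_mul]; simp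
  have e : (monm (Equiv.swap i j) (fun k => if k = i then c else if k = j then -c⁻¹ else 1)
        (fun k => if k = i then -τ else if k = j then τ else 0) :
      Matrix (Fin n) (Fin n) R[T;T⁻¹]) = emb i j 0 (C (-(↑c⁻¹ : R)) * T τ) (C (c : R) * T (-τ)) 0 := by
    ext1 p q
    rw [monm_apply, emb_anti i j h]
    by_cases h1 : Equiv.swap i j q = p
    · rw [if_pos h1, if_pos h1]
      split_ifs <;> simp
    · rw [if_neg h1, if_neg h1]
  rw [e]
  simp only [map_neg]
  set x := (C (c : R) : R[T;T⁻¹])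
  set z := (C (↑c⁻¹ : R) : R[T;T⁻¹])
  set t := (T τ : R[T;T⁻¹])
  set s := (T (-τ) : R[T;T⁻¹])
  have h2 : x * z * (t * s) = 1 := by rw [hbb, hT, mul_one]
  congr 1
  · linear_combination -h2
  · linear_combination z * t * h2
  · linear_combination 0 * h2
  · linear_combination -h2

end mono

end Part6

section Part7
set_option linter.unusedSimpArgs false
set_option linter.unusedSectionVars false

section affsl
open LaurentPolynomial

variable {n : ℕ} [NeZero n] {B : Type*} [CommRing B] [IsLocalRing B]

theorem rx_of_ne' {R : Type*} [CommRing R] {p q : ℤ} (h : fi n p ≠ fi n q) (c : R) :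
    rx n q p c = elem (fi n q) (fi n p) h.symm (C c * T (-(q / n - p / n))) := by
  rw [rx_of_ne h.symm, neg_sub]

theorem rx_S1 {p q : ℤ} (h : fi n p ≠ fi n q) (c v : B) (hu : IsUnit (1 + c * v)) :
    ∃ t ∈ torSub n B, ∃ v' c', (1 + c * v) * v' = v ∧ (1 + c * v) * c' = c ∧
      rx n q p c * rx n p q v = rx n p q v' * t * rx n q p c' := by
  obtain ⟨b, hb⟩ := hu
  have := sl2_S1 (fi n p) (fi n q) h c v b hb (q / n - p / n)
  rw [← rx_of_ne h, ← rx_of_ne h, ← rx_of_ne' h, ← rx_of_ne' h] at this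
  refine ⟨_, ⟨_, this⟩, (↑b⁻¹ : B) * v, (↑b⁻¹ : B) * c, ?_, ?_, ?_⟩
  · rw [← hb]; simp
  · rw [← hb]; simp
  · group

theorem rx_S2 {p q : ℤ} (h : fi n p ≠ fi n q) (c : Bˣ) :
    ∃ w ∈ monSub n B, rx n q p (c : B) = rx n p q (↑c⁻¹ : B) * w * rx n p q (↑c⁻¹ : B) := by
  have := sl2_S2 (fi n p) (fi n q) h c (q / n - p / n)
  rw [← rx_of_ne h, ← rx_of_ne' h] at this
  refine ⟨_, ⟨_, _, _, this⟩, ?_⟩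
  rw [rx_neg]; group

theorem rx_S3 {p q : ℤ} (h : fi n p ≠ fi n q) (v : B) :
    (rx n p q (-1 : B) * rx n q p (1 : B) * rx n p q (-1 : B)) * rx n p q v *
      (rx n p q (-1 : B) * rx n q p (1 : B) * rx n p q (-1 : B))⁻¹ = rx n q p (-v) := by
  have := sl2_S2 (fi n p) (fi n q) h (1 : Bˣ) (q / n - p / n)
  rw [← rx_of_ne h, ← rx_of_ne' h] at this
  simp only [inv_one, Units.val_one] at this
  rw [conj_mon_rx _ _ _ _ this]
  have hp := fi_div (n := n) p
  have hq := fi_div (n := n) q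
  congr 1
  · simp only [mact, Equiv.swap_apply_left, if_true]
    linear_combination hq
  · simp only [mact, Equiv.swap_apply_right, if_neg h.symm, if_true]
    linear_combination hp
  · simp [h, h.symm]

theorem tor_res (t : Matrix.SpecialLinearGroup (Fin n) B[T;T⁻¹]) (u : Fin n → Bˣ)
    (hu : t.1 = monm 1 u 0)
    (ht : t ∈ (sm (lam (IsLocalRing.residue B)) : Matrix.SpecialLinearGroup (Fin n) _ →* _).ker)
    (i : Fin n) : IsLocalRing.residue B (u i) = 1 := by
  rw [MonoidHom.mem_ker] at ht
  have h1 := sm_apply (lam (IsLocalRing.residue B)) t i i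
  rw [ht, hu, monm_apply] at h1
  simp only [Equiv.Perm.one_apply, if_true, Pi.zero_apply, T_zero, mul_one, lam_C] at h1
  have h2 : ((1 : Matrix.SpecialLinearGroup (Fin n) (IsLocalRing.ResidueField B)[T;T⁻¹]).1 i i) =
      1 := Matrix.one_apply_eq i
  rw [h2] at h1
  have h3 := congrArg (fun x => AddMonoidAlgebra.coeff x 0) h1
  have h4 := CT_coeff (1 : IsLocalRing.ResidueField B) 0 0
  simp only [map_one, T_zero, mul_one, if_true] at h4
  simp only [C_apply, if_true, h4] at h3
  exact h3.symm

/-- The concrete affine system. -/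
noncomputable def affSL (hn : 3 ≤ n) (B : Type*) [CommRing B] [IsLocalRing B] :
    Aff n B (Matrix.SpecialLinearGroup (Fin n) B[T;T⁻¹]) where
  x p q c := rx n p q c
  C := (sm (lam (IsLocalRing.residue B))).ker
  Tm := torSub n B ⊓ (sm (lam (IsLocalRing.residue B))).ker
  hC := inferInstance
  hTC := inf_le_right
  x_add := rx_add
  x_deg p q h c := rx_of_eq (fi_eq.mpr h) c
  x_shift := rx_shift
  x_comm p q r s h h' c d := by
    by_cases h1 : fi n p = fi n q
    · rw [rx_of_eq h1]; simp
    by_cases h2 : fi n r = fi n s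
    · rw [rx_of_eq h2]; simp
    rw [rx_of_ne h1, rx_of_ne h2]
    exact elem_comm_of_ne _ _ _ _ _ _ (fi_ne.mpr h) (fi_ne.mpr h') _ _
  x_mul p q r h h' h'' c d := by
    have h1 := fi_ne.mpr h
    have h2 := fi_ne.mpr h'
    have h3 := fi_ne.mpr h''
    rw [rx_of_ne h1, rx_of_ne h2, rx_of_ne h3]
    rw [elem_commutator _ _ _ h1 h2 h3, CT_mul]
    congr 5; ring
  x_mem_C p q c hc := by
    rw [MonoidHom.mem_ker, rx_lam, (IsLocalRing.residue_eq_zero_iff c).mpr hc, rx_zero]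
  C_pos u hu p v h := by
    rw [← IsLocalRing.residue_eq_zero_iff]
    exact C_aux (IsLocalRing.residue B) 1 (fun p q => p < q) (fun p q h => by omega) u hu (p + 1) p
      (by omega) (fi_ne.mpr (Aff.x_ne hn p).symm) v h
  C_neg u hu p v h := by
    rw [← IsLocalRing.residue_eq_zero_iff]
    exact C_aux (IsLocalRing.residue B) (-1) (fun p q => q < p) (fun p q h => by omega) u hu p
      (p + 1) (by omega) (fi_ne.mpr (Aff.x_ne hn p)) v h
  T_conj t ht p q := by
    obtain ⟨⟨u, hu⟩, ht⟩ := Subgroup.mem_inf.mp ht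
    refine ⟨(u (fi n p) : B) * (↑(u (fi n q))⁻¹ : B), ?_, ?_⟩
    · rw [← IsLocalRing.residue_eq_zero_iff, map_sub, map_mul, tor_res t u hu ht, map_one]
      have h1 := tor_res t u hu ht (fi n q)
      have h2 : IsLocalRing.residue B (u (fi n q)) * IsLocalRing.residue B (↑(u (fi n q))⁻¹ : B)
        = 1 := by rw [← map_mul]; simp
      rw [h1, one_mul] at h2
      rw [h2]; simp
    · intro c
      rw [conj_mon_rx t 1 u 0 hu]
      have hp := fi_div (n := n) p
      have hq := fi_div (n := n) q
      congr 1
      · simp only [mact, Equiv.Perm.one_apply, Pi.zero_apply]; linarith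
      · simp only [mact, Equiv.Perm.one_apply, Pi.zero_apply]; linarith
  S1 p q h c u hu := by
    have hunit : IsUnit (1 + c * u) := by
      by_contra hcon
      have h3 : (1 + c * u) ∈ IsLocalRing.maximalIdeal B := hcon
      have := Ideal.sub_mem _ h3 (Ideal.mul_mem_left _ c hu)
      simp at this
    obtain ⟨t, ht, v', c', e1, e2, e3⟩ := rx_S1 (fi_ne.mpr h) c u hunit
    refine ⟨t, Subgroup.mem_inf.mpr ⟨ht, ?_⟩, v', c', e1, e2, e3⟩
    have e4 := congrArg (sm (lam (IsLocalRing.residue B))) e3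
    have r1 := (IsLocalRing.residue_eq_zero_iff u).mpr hu
    have r2 := congrArg (IsLocalRing.residue B) e1
    have r3 := congrArg (IsLocalRing.residue B) e2
    simp only [map_mul, map_add, map_one, r1, mul_zero, add_zero, one_mul] at r2 r3
    rw [map_mul, map_mul, map_mul, rx_lam, rx_lam, rx_lam, rx_lam, r1, r2, r3, rx_zero,
      mul_one, one_mul] at e4
    rw [MonoidHom.mem_ker]
    exact right_eq_mul.mp e4
  S3 p q h v := rx_S3 (fi_ne.mpr h) v

theorem El_le_affE (hn : 3 ≤ n) : El n B[T;T⁻¹] ≤ (affSL hn B).E := by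
  rw [El, Subgroup.closure_le]
  rintro _ ⟨i, j, h, r, rfl⟩
  rw [SetLike.mem_coe]
  induction r using LaurentPolynomial.induction_on' with
  | add p q hp hq => rw [elem_add]; exact mul_mem hp hq
  | C_mul_T a m =>
    rw [← rx_mk]
    exact (affSL hn B).mem_E _ _ _

theorem affE_le_El (hn : 3 ≤ n) : (affSL hn B).E ≤ El n B[T;T⁻¹] := by
  rw [Aff.E, Subgroup.closure_le]
  rintro _ ⟨p, q, c, rfl⟩
  exact rx_mem_El p q c

theorem birkhoffSL (hn : 3 ≤ n) (g : Matrix.SpecialLinearGroup (Fin n) B[T;T⁻¹])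
    (hg : g ∈ El n B[T;T⁻¹]) : ∃ u ∈ (affSL hn B).Up, ∃ w ∈ monSub n B, w ∈ (affSL hn B).E ∧ 
      ∃ z ∈ (affSL hn B).Um, ∃ h ∈ (affSL hn B).H, g = u * w * z * h := by
  have key := (affSL hn B).birkhoff hn (monSub n B ⊓ (affSL hn B).E) inf_le_right
  suffices hs : ∃ u ∈ (affSL hn B).Up, ∃ w ∈ (monSub n B ⊓ (affSL hn B).E),
      ∃ z ∈ (affSL hn B).Um, ∃ h ∈ (affSL hn B).H, g = u * w * z * h by
    obtain ⟨u, hu, w, hw, z, hz, h, hh, e⟩ := hs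
    exact ⟨u, hu, w, (Subgroup.mem_inf.mp hw).1, (Subgroup.mem_inf.mp hw).2, z, hz, h, hh, e⟩
  refine key ?_ ?_ ?_ g (El_le_affE hn hg)
  · intro p q hpq c v hcv
    obtain ⟨t, ⟨u, ht⟩, v', c', e1, e2, e3⟩ := rx_S1 (fi_ne.mpr hpq) c v hcv
    refine ⟨t, Subgroup.mem_inf.mpr ⟨⟨1, u, 0, ht⟩, ?_⟩, v', c', e3⟩
    have : t = (rx n p q v')⁻¹ * (rx n q p c * rx n p q v) * (rx n q p c')⁻¹ := by
      rw [e3]; group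
    rw [this]
    have hE := (affSL hn B).mem_E
    exact mul_mem (mul_mem (inv_mem (hE p q v')) (mul_mem (hE q p c) (hE p q v)))
      (inv_mem (hE q p c'))
  · intro p q hpq c
    obtain ⟨w, hw, e⟩ := rx_S2 (fi_ne.mpr hpq) c
    refine ⟨w, Subgroup.mem_inf.mpr ⟨hw, ?_⟩, e⟩
    have : w = (rx n p q (↑c⁻¹ : B))⁻¹ * rx n q p (c : B) * (rx n p q (↑c⁻¹ : B))⁻¹ := by
      rw [e]; group
    rw [this]
    have hE := (affSL hn B).mem_E
    exact mul_mem (mul_mem (inv_mem (hE p q _)) (hE q p c)) (inv_mem (hE p q _))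
  · intro w hw
    obtain ⟨f, u, a, hf⟩ := inv_mem (Subgroup.mem_inf.mp hw).1
    refine ⟨mact f a, fun p q hpq => ⟨?_, (u (fi n p) : B) * (↑(u (fi n q))⁻¹ : B), fun c => ?_⟩⟩
    · rw [← fi_ne, mact, mact, (fi_mk _ _).1, (fi_mk _ _).1]
      exact f.injective.ne (fi_ne.mpr hpq)
    · have hc := conj_mon_rx w⁻¹ f u a hf p q c
      rw [inv_inv] at hc
      exact hc

end affsl

end Part7

section Part8
set_option linter.unusedSimpArgs false
set_option linter.unusedSectionVars false

theorem sm_lift {n : ℕ} {R S : Type*} [CommRing R] [CommRing S] (f : R →+* S)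
    (hf : Function.Injective f) (g : Matrix.SpecialLinearGroup (Fin n) S)
    (h : ∀ i j, ∃ r, f r = g.1 i j) : ∃ g0 : Matrix.SpecialLinearGroup (Fin n) R, sm f g0 = g := by
  choose r hr using h
  have h1 : (Matrix.of r).map f = g.1 := by ext i j; exact hr i j
  refine ⟨⟨Matrix.of r, ?_⟩, ?_⟩
  · apply hf
    rw [map_one, RingHom.map_det]
    change ((Matrix.of r).map f).det = 1
    rw [h1]; exact g.2
  · apply SLext; exact h1

section local_lemma
open LaurentPolynomial

variable {n : ℕ} [NeZero n] {R K B : Type*} [CommRing R] [CommRing K] [CommRing B] [IsLocalRing B]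

/-- polynomials in `T` -/
noncomputable def iX (R : Type*) [CommRing R] : Polynomial R →+* R[T;T⁻¹] := Polynomial.toLaurent

/-- polynomials in `T⁻¹` -/
noncomputable def iY (R : Type*) [CommRing R] : Polynomial R →+* R[T;T⁻¹] :=
  ((invert : R[T;T⁻¹] ≃ₐ[R] R[T;T⁻¹]) : R[T;T⁻¹] →+* R[T;T⁻¹]).comp Polynomial.toLaurent

theorem iX_inj : Function.Injective (iX R) := Polynomial.toLaurent_injective
theorem iY_inj : Function.Injective (iY R) := 
  (invert (R := R)).injective.comp Polynomial.toLaurent_injective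
theorem iX_C (c : R) : iX R (Polynomial.C c) = C c := Polynomial.toLaurent_C c
theorem iY_C (c : R) : iY R (Polynomial.C c) = C c := by
  change invert (Polynomial.toLaurent _) = _
  simp
theorem iX_X : iX R Polynomial.X = T 1 := Polynomial.toLaurent_X
theorem iY_X : iY R Polynomial.X = T (-1) := by
  change invert (Polynomial.toLaurent _) = _
  simp
theorem iX_comp_C : (iX R).comp Polynomial.C = C := RingHom.ext iX_C
theorem iY_comp_C : (iY R).comp Polynomial.C = C := RingHom.ext iY_C

theorem iX_CX (c : R) (m : ℤ) (hm : 0 ≤ m) :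
    iX R (Polynomial.C c * Polynomial.X ^ m.toNat) = C c * T m := by
  rw [map_mul, map_pow, iX_C, iX_X, T_pow]
  congr 2; omega
theorem iY_CX (c : R) (m : ℤ) (hm : m ≤ 0) :
    iY R (Polynomial.C c * Polynomial.X ^ (-m).toNat) = C c * T m := by
  rw [map_mul, map_pow, iY_C, iY_X, T_pow]
  congr 2; omega

theorem iX_coeff (f : Polynomial R) (l : ℤ) (hl : l < 0) : (iX R f).coeff l = 0 := by
  change (Polynomial.toLaurent f).coeff l = 0
  induction f using Polynomial.induction_on' with
  | add p q hp hq =>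
    rw [map_add, AddMonoidAlgebra.coeff_add, Finsupp.add_apply, hp, hq, add_zero]
  | monomial m a =>
    rw [← Polynomial.C_mul_X_pow_eq_monomial, Polynomial.toLaurent_C_mul_X_pow, CT_coeff, if_neg]
    omega

theorem iY_coeff (f : Polynomial R) (l : ℤ) (hl : 0 < l) : (iY R f).coeff l = 0 := by
  change (invert (Polynomial.toLaurent f)).coeff l = 0
  rw [invert_apply]; exact iX_coeff f _ (by omega)

theorem lam_iX (f : R →+* K) : (lam f).comp (iX R) = (iX K).comp (Polynomial.mapRingHom f) := by
  apply Polynomial.ringHom_ext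
  · intro a; simp [iX_C, lam_C]
  · simp [iX_X, lam_T]

theorem lam_iY (f : R →+* K) : (lam f).comp (iY R) = (iY K).comp (Polynomial.mapRingHom f) := by
  apply Polynomial.ringHom_ext
  · intro a; simp [iY_C, lam_C]
  · simp [iY_X, lam_T]

/-- Elements that are polynomial in both directions are constant. -/
theorem iX_iY (f g : Polynomial R) (h : iX R f = iY R g) : ∃ c, f = Polynomial.C c := by
  refine ⟨(iX R f).coeff 0, ?_⟩
  apply iX_inj
  rw [iX_C]
  ext l
  rw [C_apply]
  split_ifs with hl
  · rw [hl]
  · rcases lt_or_gt_of_ne hl with h1 | h1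
    · exact iX_coeff f l h1
    · rw [h]; exact iY_coeff g l h1

/-- The intersection of the two vector groups. -/
theorem const_of_eq (α β : Matrix.SpecialLinearGroup (Fin n) (Polynomial R))
    (h : sm (iX R) α = sm (iY R) β) :
    ∃ γ : Matrix.SpecialLinearGroup (Fin n) R, α = sm Polynomial.C γ ∧ β = sm Polynomial.C γ := by
  have h1 : ∀ i j, iX R (α.1 i j) = iY R (β.1 i j) := by
    intro i j; rw [← sm_apply, ← sm_apply, h]
  obtain ⟨γ, hγ⟩ := sm_lift (Polynomial.C) Polynomial.C_injective α (fun i j => by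
    obtain ⟨c, hc⟩ := iX_iY _ _ (h1 i j)
    exact ⟨c, hc.symm⟩)
  refine ⟨γ, hγ.symm, ?_⟩
  apply sm_injective (iY R) iY_inj
  rw [← h, ← hγ, sm_sm, sm_sm, iX_comp_C, iY_comp_C]

theorem mul_T_coeff (x : R[T;T⁻¹]) (a l : ℤ) : (x * T a).coeff l = x.coeff (l - a) := by
  induction x using LaurentPolynomial.induction_on' with
  | add p q hp hq =>
    rw [add_mul, AddMonoidAlgebra.coeff_add, AddMonoidAlgebra.coeff_add, Finsupp.add_apply,
      Finsupp.add_apply, hp, hq]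
  | C_mul_T c m =>
    rw [mul_assoc, ← T_add, CT_coeff, CT_coeff]
    congr 1
    apply propext
    constructor <;> intro h <;> omega

theorem CTmul_coeff (c : R) (x : R[T;T⁻¹]) (a l : ℤ) :
    (C c * T a * x).coeff l = c * x.coeff (l - a) := by
  rw [mul_assoc, T_mul, ← mul_T_coeff, ← smul_eq_C_mul]
  rfl

theorem exponents (P Q : Matrix.SpecialLinearGroup (Fin n) (Polynomial K)) [Nontrivial K]
    (w : Matrix (Fin n) (Fin n) K[T;T⁻¹]) (f : Equiv.Perm (Fin n)) (u : Fin n → K)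
    (a : Fin n → ℤ) (hw : ∀ i j, w i j = if f j = i then C (u j) * T (a j) else 0)
    (h : w = (sm (iX K) P).1 * (sm (iY K) Q).1) : ∀ j, a j = 0 := by
  intro j
  rcases lt_trichotomy (a j) 0 with h1 | h1 | h1
  · exfalso
    -- row `f j` of `P`
    have e : w * (sm (iY K) Q⁻¹).1 = (sm (iX K) P).1 := by
      rw [h, mul_assoc]
      have : (sm (iY K) Q).1 * (sm (iY K) Q⁻¹).1 = (sm (iY K) (Q * Q⁻¹)).1 := by
        rw [map_mul]; rfl
      rw [this, mul_inv_cancel, map_one]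
      exact mul_one _
    have hz : ∀ l, (sm (iX K) P).1 (f j) l = 0 := by
      intro l
      have e1 : (sm (iX K) P).1 (f j) l = C (u j) * T (a j) * (iY K ((Q⁻¹).1 j l)) := by
        rw [← e, Matrix.mul_apply, Finset.sum_eq_single j, hw, if_pos rfl, sm_apply]
        · intro b _ hb
          rw [hw, if_neg, zero_mul]
          exact fun h => hb (f.injective h)
        · intro h; exact absurd (Finset.mem_univ _) h
      ext m
      by_cases hm : m < 0
      · rw [sm_apply, iX_coeff _ _ hm]; rfl
      · rw [e1, CTmul_coeff, iY_coeff _ _ (by omega), mul_zero]; rfl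
    have := Matrix.det_eq_zero_of_row_eq_zero (f j) hz
    rw [(sm (iX K) P).2] at this
    exact one_ne_zero this
  · exact h1
  · exfalso
    have e : (sm (iX K) P⁻¹).1 * w = (sm (iY K) Q).1 := by
      rw [h, ← mul_assoc]
      have : (sm (iX K) P⁻¹).1 * (sm (iX K) P).1 = (sm (iX K) (P⁻¹ * P)).1 := by
        rw [map_mul]; rfl
      rw [this, inv_mul_cancel, map_one]
      exact one_mul _
    have hz : ∀ i, (sm (iY K) Q).1 i j = 0 := by
      intro i
      have e1 : (sm (iY K) Q).1 i j = C (u j) * T (a j) * (iX K ((P⁻¹).1 i (f j))) := by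
        rw [← e, Matrix.mul_apply, Finset.sum_eq_single (f j), hw, if_pos rfl, sm_apply, mul_comm]
        · intro b _ hb
          rw [hw, if_neg (Ne.symm hb), mul_zero]
        · intro h; exact absurd (Finset.mem_univ _) h
      ext m
      by_cases hm : 0 < m
      · rw [sm_apply, iY_coeff _ _ hm]; rfl
      · rw [e1, CTmul_coeff, iX_coeff _ _ (by omega), mul_zero]; rfl
    have := Matrix.det_eq_zero_of_column_eq_zero j hz
    rw [(sm (iY K) Q).2] at this
    exact one_ne_zero this

theorem Up_poly (hn : 3 ≤ n) (u : Matrix.SpecialLinearGroup (Fin n) B[T;T⁻¹])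
    (hu : u ∈ (affSL hn B).Up) : ∃ e ∈ El n (Polynomial B), sm (iX B) e = u := by
  have : (affSL hn B).Up ≤ (El n (Polynomial B)).map (sm (iX B)) := by
    rw [Aff.Up, Subgroup.closure_le]
    rintro _ ⟨p, q, c, h, rfl⟩
    rw [SetLike.mem_coe]
    change rx n p q c ∈ _
    by_cases hd : fi n p = fi n q
    · rw [rx_of_eq hd]; exact one_mem _
    · refine ⟨_, elem_mem_El (fi n p) (fi n q) hd
        (Polynomial.C c * Polynomial.X ^ (q / n - p / n : ℤ).toNat), ?_⟩
      rw [sm_elem, iX_CX, rx_of_ne hd]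
      have := Int.ediv_le_ediv (npos n) h.le
      omega
  exact this hu

theorem Um_poly (hn : 3 ≤ n) (u : Matrix.SpecialLinearGroup (Fin n) B[T;T⁻¹])
    (hu : u ∈ (affSL hn B).Um) : ∃ e ∈ El n (Polynomial B), sm (iY B) e = u := by
  have : (affSL hn B).Um ≤ (El n (Polynomial B)).map (sm (iY B)) := by
    rw [Aff.Um, Subgroup.closure_le]
    rintro _ ⟨p, q, c, h, rfl⟩
    rw [SetLike.mem_coe]
    change rx n p q c ∈ _
    by_cases hd : fi n p = fi n q
    · rw [rx_of_eq hd]; exact one_mem _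
    · refine ⟨_, elem_mem_El (fi n p) (fi n q) hd
        (Polynomial.C c * Polynomial.X ^ (-(q / n - p / n : ℤ)).toNat), ?_⟩
      rw [sm_elem, iY_CX, rx_of_ne hd]
      have := Int.ediv_le_ediv (npos n) h.le
      omega
  exact this hu

theorem C_inj : Function.Injective (C : R →+* R[T;T⁻¹]) := by
  rw [← iX_comp_C]
  exact iX_inj.comp Polynomial.C_injective

theorem mon_const (w : Matrix.SpecialLinearGroup (Fin n) B[T;T⁻¹]) (f : Equiv.Perm (Fin n))
    (u : Fin n → Bˣ) (hw : w.1 = monm f u 0) : ∃ w0 ∈ El n B, sm C w0 = w := by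
  obtain ⟨w0, h⟩ := sm_lift C C_inj w (fun i j => by
    rw [hw, monm_apply]
    split_ifs with h
    · exact ⟨u j, by simp⟩
    · exact ⟨0, by simp⟩)
  exact ⟨w0, by rw [El_eq_top_of_isLocalRing]; trivial, h⟩

theorem local_lemma (hn : 3 ≤ n) (α β : Matrix.SpecialLinearGroup (Fin n) (Polynomial B))
    (h : sm (iX B) α * (sm (iY B) β)⁻¹ ∈ El n B[T;T⁻¹]) :
    α ∈ El n (Polynomial B) ∧ β ∈ El n (Polynomial B) := by
  obtain ⟨u, hu, w, ⟨f, v, a, hw⟩, hwE, z, hz, h', hh, e⟩ := birkhoffSL hn _ h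
  obtain ⟨eu, heu, rfl⟩ := Up_poly hn u hu
  obtain ⟨ez, hez, hez'⟩ := Um_poly hn z hz
  -- reduction modulo the maximal ideal
  have hhC : sm (lam (IsLocalRing.residue B)) h' = 1 := by
    obtain ⟨u1, hu1, t1, ht1, z1, hz1, rfl⟩ := hh
    have a1 : u1 ∈ (affSL hn B).C := (Subgroup.mem_inf.mp hu1).2
    have a2 : t1 ∈ (affSL hn B).C := (affSL hn B).hTC ht1
    have a3 : z1 ∈ (affSL hn B).C := (Subgroup.mem_inf.mp hz1).2
    exact mul_mem (mul_mem a1 a2) a3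
  have ha : a = 0 := by
    set ρ := IsLocalRing.residue B
    have e1 := congrArg (sm (lam ρ)) e
    rw [map_mul, map_inv, map_mul, map_mul, map_mul, hhC, mul_one, ← hez'] at e1
    simp only [sm_sm, lam_iX, lam_iY] at e1
    simp only [← sm_sm] at e1
    have e2 : sm (lam ρ) w = sm (iX _) ((sm (Polynomial.mapRingHom ρ) eu)⁻¹ *
        sm (Polynomial.mapRingHom ρ) α) * sm (iY _) ((sm (Polynomial.mapRingHom ρ) β)⁻¹ *
        (sm (Polynomial.mapRingHom ρ) ez)⁻¹) := by
      rw [map_mul, map_mul, map_inv, map_inv, map_inv, mul_assoc, ← mul_assoc (sm (iX _) (sm _ α)),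
        e1]
      group
    funext j
    exact exponents _ _ (sm (lam ρ) w).1 f (fun j => ρ (v j)) a (fun i j => by
      rw [sm_apply, hw, monm_apply]
      split_ifs
      · exact lam_CT _ _ _
      · exact map_zero _) (congrArg Subtype.val e2) j
  subst ha
  obtain ⟨w0, hw0, hw0'⟩ := mon_const w f v hw
  -- move `h'` to the left
  have hH := (affSL hn B).conj_H hn (w * z) (mul_mem hwE ((affSL hn B).Um_le_E hz)) h' hh
  obtain ⟨u1, hu1, t1, ht1, z1, hz1, e3⟩ := hH
  obtain ⟨eu1, heu1, heu1'⟩ := Up_poly hn u1 (Subgroup.mem_inf.mp hu1).1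
  obtain ⟨ez1, hez1, hez1'⟩ := Um_poly hn z1 (Subgroup.mem_inf.mp hz1).1
  obtain ⟨ut, hut⟩ := (Subgroup.mem_inf.mp ht1).1
  obtain ⟨t0, ht0, ht0'⟩ := mon_const t1 1 ut hut
  have e4 : sm (iX B) α * (sm (iY B) β)⁻¹ = sm (iX B) (eu * eu1 * sm Polynomial.C t0) *
      sm (iY B) (ez1 * sm Polynomial.C w0 * ez) := by
    rw [e, map_mul, map_mul, map_mul, map_mul, sm_sm, sm_sm, iX_comp_C, iY_comp_C, heu1', hez1',
      ht0', hw0', hez']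
    calc sm (iX B) eu * w * z * h' = sm (iX B) eu * (w * z * h' * (w * z)⁻¹) * (w * z) := by group
      _ = _ := by rw [e3]; group
  set ep := eu * eu1 * sm Polynomial.C t0 with hep
  set em := ez1 * sm Polynomial.C w0 * ez with hem
  have hepE : ep ∈ El n (Polynomial B) := mul_mem (mul_mem heu heu1) (sm_mem_El _ ht0)
  have hemE : em ∈ El n (Polynomial B) := mul_mem (mul_mem hez1 (sm_mem_El _ hw0)) hez
  have e5 : sm (iX B) (ep⁻¹ * α) = sm (iY B) (em * β) := by
    rw [map_mul, map_mul, map_inv, inv_mul_eq_iff_eq_mul, ← mul_assoc, ← mul_inv_eq_iff_eq_mul]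
    exact e4
  obtain ⟨γ, h1, h2⟩ := const_of_eq _ _ e5
  have hγ : sm Polynomial.C γ ∈ El n (Polynomial B) := by
    apply sm_mem_El
    rw [El_eq_top_of_isLocalRing]; trivial
  constructor
  · rw [← h1] at hγ
    have := mul_mem hepE hγ
    rwa [mul_inv_cancel_left] at this
  · rw [← h2] at hγ
    have := mul_mem (inv_mem hemE) hγ
    rwa [inv_mul_cancel_left] at this

end local_lemma

end Part8

section Part9
set_option linter.unusedSimpArgs false
set_option linter.unusedSectionVars false

section MI
open LaurentPolynomial

variable {n : ℕ} {B : Type*} [CommRing B]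

/-- polynomials with constant term one -/
def SS (B : Type*) [CommRing B] : Submonoid (Polynomial B) where
  carrier := {s | s.coeff 0 = 1}
  one_mem' := by simp
  mul_mem' := by
    intro a b ha hb
    change a.coeff 0 = 1 at ha
    change b.coeff 0 = 1 at hb
    change (a * b).coeff 0 = 1
    rw [Polynomial.mul_coeff_zero, ha, hb, one_mul]

theorem SS_coprime {s : Polynomial B} (hs : s ∈ SS B) (m : ℕ) :
    IsCoprime s ((Polynomial.X : Polynomial B) ^ m) := by
  apply IsCoprime.pow_right
  have hs : s.coeff 0 = 1 := hs
  refine ⟨1, -s.divX, ?_⟩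
  have := Polynomial.divX_mul_X_add s
  rw [hs, Polynomial.C_1] at this
  linear_combination -this

/-- the denominators -/
noncomputable def WW (B : Type*) [CommRing B] : Submonoid (Polynomial B) :=
  SS B ⊔ Submonoid.powers (Polynomial.X : Polynomial B)

/-- The big localisation. -/
abbrev QQ (B : Type*) [CommRing B] : Type _ := Localization (WW B)

theorem SS_le : SS B ≤ WW B := le_sup_left

theorem WW_nzd [IsDomain B] : WW B ≤ nonZeroDivisors (Polynomial B) := by
  apply sup_le
  · intro s hs
    apply mem_nonZeroDivisors_of_ne_zero
    rintro rfl
    have hs : (0 : Polynomial B).coeff 0 = 1 := hs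
    simp at hs
  · rw [Submonoid.powers_le]
    exact mem_nonZeroDivisors_of_ne_zero Polynomial.X_ne_zero

theorem QQ_inj [IsDomain B] : Function.Injective (algebraMap (Polynomial B) (QQ B)) :=
  IsLocalization.injective _ WW_nzd

theorem X_unit : IsUnit (algebraMap (Polynomial B) (QQ B) Polynomial.X) :=
  IsLocalization.map_units (QQ B) (⟨Polynomial.X, 
    (le_sup_right : _ ≤ WW B) (Submonoid.mem_powers _)⟩ : WW B)

/-- Laurent polynomials into the big localisation; `T ↦ Y⁻¹`. -/
noncomputable def qL (B : Type*) [CommRing B] : B[T;T⁻¹] →+* QQ B :=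
  LaurentPolynomial.eval₂ ((algebraMap (Polynomial B) (QQ B)).comp Polynomial.C) (X_unit (B := B)).unit⁻¹

theorem qL_iY : (qL B).comp (iY B) = algebraMap (Polynomial B) (QQ B) := by
  apply Polynomial.ringHom_ext
  · intro a; simp [iY_C, qL]
  · simp [iY_X, qL]

theorem qL_iY' (p : Polynomial B) : qL B (iY B p) = algebraMap (Polynomial B) (QQ B) p := by
  rw [← qL_iY]; rfl

theorem exists_iY (l : B[T;T⁻¹]) : ∃ (N : ℕ) (p : Polynomial B), iY B p = l * T (-N) := by
  obtain ⟨N, p, h⟩ := (invert l).exists_T_pow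
  refine ⟨N, p, ?_⟩
  change invert (Polynomial.toLaurent p) = _
  rw [h, map_mul, invert_T]
  congr 1
  ext; simp

theorem qL_inj [IsDomain B] : Function.Injective (qL B) := by
  rw [injective_iff_map_eq_zero]
  intro l hl
  obtain ⟨N, p, h⟩ := exists_iY l
  have h1 : qL B (iY B p) = 0 := by rw [h, map_mul, hl, zero_mul]
  rw [qL_iY'] at h1
  have : p = 0 := QQ_inj (by rw [h1, map_zero])
  rw [this, map_zero] at h
  have := congrArg (· * T (N : ℤ)) h
  simp only [zero_mul, mul_assoc, ← T_add, neg_add_cancel, T_zero, mul_one] at this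
  exact this.symm

/-- the embedding of `B[X]` in the big localisation -/
noncomputable def qX (B : Type*) [CommRing B] : Polynomial B →+* QQ B := (qL B).comp (iX B)

theorem monic_unit (f : Polynomial B) (hf : f.Monic) : IsUnit (qX B f) := by
  have h1 : iY B f.reverse = iX B f * T (-f.natDegree) := by
    change invert (Polynomial.toLaurent f.reverse) = Polynomial.toLaurent f * _
    rw [toLaurent_reverse, map_mul, invert_T]
    congr 1
    ext; simp
  have h2 : f.reverse ∈ SS B := by
    change f.reverse.coeff 0 = 1
    rw [Polynomial.coeff_zero_reverse]; exact hf
  have h3 : IsUnit (qL B (iY B f.reverse)) := by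
    rw [qL_iY']
    exact IsLocalization.map_units (QQ B) (⟨_, SS_le h2⟩ : WW B)
  rw [h1, map_mul] at h3
  exact isUnit_of_mul_isUnit_left h3

/-- from the localisation at polynomials with constant term one -/
noncomputable def qM (B : Type*) [CommRing B] : Localization (SS B) →+* QQ B :=
  IsLocalization.lift (M := SS B) (g := algebraMap (Polynomial B) (QQ B))
    (fun s => IsLocalization.map_units (QQ B) (⟨s.1, SS_le s.2⟩ : WW B))

theorem qM_a (p : Polynomial B) : qM B (algebraMap _ _ p) = algebraMap (Polynomial B) (QQ B) p :=
  IsLocalization.lift_eq _ _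

theorem SSl_inj [IsDomain B] : Function.Injective (algebraMap (Polynomial B) (Localization (SS B))) :=
  IsLocalization.injective _ (SS_le.trans WW_nzd)

theorem qM_inj [IsDomain B] : Function.Injective (qM B) := by
  rw [injective_iff_map_eq_zero]
  intro m hm
  obtain ⟨⟨r, s⟩, h⟩ := IsLocalization.surj (SS B) m
  have h1 := congrArg (qM B) h
  rw [map_mul, hm, zero_mul, qM_a] at h1
  have : r = 0 := QQ_inj (by rw [← h1, map_zero])
  simp only [this, map_zero] at h
  exact (IsLocalization.map_units (Localization (SS B)) s).mul_left_eq_zero.1 h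

theorem denomL : Denom (qL B) ((SS B).map (iY B)) := by
  intro q
  obtain ⟨⟨r, w⟩, h⟩ := IsLocalization.surj (WW B) q
  obtain ⟨s, hs, y, ⟨m, hy⟩, hw⟩ := Submonoid.mem_sup.1 w.2
  refine ⟨iY B s, ⟨s, hs, rfl⟩, iY B r * T m, ?_⟩
  simp only [← hw, ← hy, map_mul] at h
  have h3 : qL B (iY B (Polynomial.X ^ m)) * qL B (T m) = 1 := by
    rw [← map_mul, map_pow, iY_X, T_pow, ← T_add]
    simp
  rw [map_mul, qL_iY', qL_iY', ← h]
  rw [qL_iY'] at h3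
  linear_combination (-(algebraMap (Polynomial B) (QQ B) s * q)) * h3

theorem denomM : Denom (qM B) ((Submonoid.powers (Polynomial.X : Polynomial B)).map
    (algebraMap (Polynomial B) (Localization (SS B)))) := by
  intro q
  obtain ⟨⟨r, w⟩, h⟩ := IsLocalization.surj (WW B) q
  obtain ⟨s, hs, y, hy, hw⟩ := Submonoid.mem_sup.1 w.2
  simp only [← hw, map_mul] at h
  refine ⟨algebraMap _ _ y, ⟨y, hy, rfl⟩, IsLocalization.mk' _ r (⟨s, hs⟩ : SS B), ?_⟩
  have h1 := congrArg (qM B) (IsLocalization.mk'_spec (Localization (SS B)) r (⟨s, hs⟩ : SS B))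
  rw [map_mul, qM_a, qM_a, ← h] at h1
  rw [qM_a]
  apply (IsLocalization.map_units (QQ B) (⟨s, SS_le hs⟩ : WW B)).mul_right_cancel
  change _ * algebraMap (Polynomial B) (QQ B) s = _ * algebraMap (Polynomial B) (QQ B) s
  rw [h1]; ring

theorem inter_LM [IsDomain B] (l : B[T;T⁻¹]) (m : Localization (SS B)) (h : qL B l = qM B m) :
    ∃ p, iY B p = l := by
  obtain ⟨N, p, hp⟩ := exists_iY l
  obtain ⟨⟨r, s⟩, hm⟩ := IsLocalization.surj (SS B) m
  have hN : iY B p * T N = l := by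
    rw [hp, mul_assoc, ← T_add]; simp
  have h1 : s.1 * p = r * Polynomial.X ^ N := by
    apply QQ_inj
    have h1 := congrArg (qM B) hm
    simp only [map_mul, qM_a] at h1
    have h2 := congrArg (qL B) hp
    rw [qL_iY', map_mul, h] at h2
    have h3 : qL B (T (-N : ℤ)) = algebraMap (Polynomial B) (QQ B) (Polynomial.X ^ N) := by
      rw [← qL_iY', map_pow, iY_X, T_pow]; simp
    rw [map_mul, map_mul, h2, ← h1, h3]
    ring
  have h2 : Polynomial.X ^ N ∣ p := by
    apply (SS_coprime s.2 N).symm.dvd_of_dvd_mul_left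
    exact ⟨r, by rw [h1, mul_comm]⟩
  obtain ⟨p', rfl⟩ := h2
  refine ⟨p', ?_⟩
  rw [← hN, map_mul, map_pow, iY_X, T_pow]
  rw [mul_right_comm, ← T_add]
  simp

/-- evaluation at zero -/
noncomputable def evM (B : Type*) [CommRing B] : Localization (SS B) →+* B :=
  IsLocalization.lift (M := SS B) (g := Polynomial.evalRingHom (0 : B)) (by
    intro s
    have hs : s.1.coeff 0 = 1 := s.2
    rw [Polynomial.coe_evalRingHom, ← Polynomial.coeff_zero_eq_eval_zero, hs]
    exact isUnit_one)

theorem monic_inversion [IsDomain B] [NeZero n] (hn : 3 ≤ n)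
    (α : Matrix.SpecialLinearGroup (Fin n) (Polynomial B)) (h : sm (qX B) α ∈ El n (QQ B)) :
    α ∈ El n (Polynomial B) := by
  obtain ⟨ε₁, h1, ε₂, h2, e⟩ := splitting hn (iY B) (algebraMap (Polynomial B) (Localization (SS B)))
    (qL B) (qM B) (by rw [qL_iY]; refine RingHom.ext fun p => ?_; exact (qM_a p).symm) qL_inj qM_inj (SS B)
    (Submonoid.powers Polynomial.X) denomL denomM
    (by rintro s hs _ ⟨m, rfl⟩; exact SS_coprime hs m) _ h
  have e' : sm (qL B) (ε₁⁻¹ * sm (iX B) α) = sm (qM B) ε₂ := by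
    rw [map_mul, map_inv, sm_sm]
    change _ * sm (qX B) α = _
    rw [e]; group
  obtain ⟨β, hβ⟩ := sm_lift (iY B) iY_inj (ε₁⁻¹ * sm (iX B) α) (by
    intro i j
    apply inter_LM _ (ε₂.1 i j)
    exact congrFun (congrFun (congrArg Subtype.val e') i) j)
  have hβ2 : sm (algebraMap (Polynomial B) (Localization (SS B))) β = ε₂ := by
    apply sm_injective _ qM_inj
    rw [← e', ← hβ, sm_sm, sm_sm]
    congr 1
    congr 1
    rw [qL_iY]; refine RingHom.ext fun p => ?_; exact (qM_a p)
  have key : sm (iX B) α * (sm (iY B) β)⁻¹ = ε₁ := by rw [hβ]; group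
  have loc : ∀ (m : Ideal B) [hm : m.IsMaximal],
      sm (Polynomial.mapRingHom (algebraMap B (Localization.AtPrime m))) α ∈ El n _ ∧
      sm (Polynomial.mapRingHom (algebraMap B (Localization.AtPrime m))) β ∈ El n _ := by
    intro m hm
    apply local_lemma hn
    have := sm_mem_El (lam (algebraMap B (Localization.AtPrime m))) (key ▸ h1)
    rw [map_mul, map_inv, sm_sm, sm_sm, lam_iX, lam_iY] at this
    rw [sm_sm, sm_sm]; exact this
  have ha := local_global hn α (fun m _ => (loc m).1)
  have hb := local_global hn β (fun m _ => (loc m).2)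
  have hb0 : sm (Polynomial.evalRingHom 0) β ∈ El n B := by
    have := sm_mem_El (evM B) (hβ2 ▸ h2)
    rw [sm_sm] at this
    convert this using 3
    refine RingHom.ext fun p => ?_
    exact (IsLocalization.lift_eq _ _).symm
  have hβE : β ∈ El n (Polynomial B) := by
    have h3 : sm cst β ∈ El n (Polynomial B) := by
      have := sm_mem_El (Polynomial.C) hb0
      rwa [sm_sm] at this
    simpa using mul_mem hb h3
  have hαL : sm (iX B) α ∈ El n B[T;T⁻¹] := by
    have := mul_mem h1 (sm_mem_El (iY B) hβE)
    rw [← key] at this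
    simpa using this
  have hα1 : sm (Polynomial.evalRingHom 1) α ∈ El n B := by
    have := sm_mem_El (LaurentPolynomial.eval₂ (RingHom.id B) 1) hαL
    rw [sm_sm] at this
    convert this using 3
    apply Polynomial.ringHom_ext
    · intro a; simp [iX_C]
    · simp [iX_X]
  have hα0 : sm (Polynomial.evalRingHom 0) α ∈ El n B := by
    have := sm_mem_El (Polynomial.evalRingHom 1) ha
    rw [map_mul, map_inv, sm_sm] at this
    have q : (Polynomial.evalRingHom (1 : B)).comp cst = Polynomial.evalRingHom 0 := by
      apply Polynomial.ringHom_ext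
      · intro a; simp
      · simp
    rw [q] at this
    have := mul_mem (inv_mem this) hα1
    simpa using this
  have h3 : sm cst α ∈ El n (Polynomial B) := by
    have := sm_mem_El (Polynomial.C) hα0
    rwa [sm_sm] at this
  simpa using mul_mem ha h3

end MI

end Part9

section Part10
set_option linter.unusedSimpArgs false
set_option linter.unusedSectionVars false

section Euclid
open Polynomial

variable {A : Type*} [CommRing A] [IsDomain A]

theorem EuclProp.pid (H : EuclProp A) : IsPrincipalIdealRing A := by
  classical
  obtain ⟨N, hN⟩ := H
  refine ⟨fun I => ?_⟩
  by_cases hI : I = ⊥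
  · subst hI; infer_instance
  obtain ⟨x, hx, hx0⟩ := Submodule.exists_mem_ne_zero_of_ne_bot hI
  have hex : ∃ k, ∃ y ∈ I, y ≠ 0 ∧ N y = k := ⟨_, x, hx, hx0, rfl⟩
  obtain ⟨y, hy, hy0, hyN⟩ := Nat.find_spec hex
  refine ⟨y, le_antisymm ?_ ?_⟩
  · intro z hz
    obtain ⟨q, hq⟩ := hN z y hy0
    have hmem : z - q * y ∈ I := I.sub_mem hz (I.mul_mem_left q hy)
    have h0 : z - q * y = 0 := by
      by_contra hne
      rcases hq with hq | hq
      · exact hne hq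
      · rw [hyN] at hq
        exact Nat.find_min hex hq ⟨_, hmem, hne, rfl⟩
    rw [Submodule.mem_span_singleton]
    exact ⟨q, by rw [smul_eq_mul]; exact (sub_eq_zero.1 h0).symm⟩
  · rw [Submodule.span_singleton_le_iff_mem]; exact hy

/-- divisibility in `A((1/X))` -/
def DD (f g : A[X]) : Prop := ∃ M : ℕ, ∀ N : ℕ, ∃ q : A[X], (X ^ N * f - q * g).natDegree ≤ M

theorem DD.add {f f' g : A[X]} (h : DD f g) (h' : DD f' g) : DD (f + f') g := by
  obtain ⟨M, h⟩ := h
  obtain ⟨M', h'⟩ := h'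
  refine ⟨max M M', fun N => ?_⟩
  obtain ⟨q, hq⟩ := h N
  obtain ⟨q', hq'⟩ := h' N
  refine ⟨q + q', ?_⟩
  have : X ^ N * (f + f') - (q + q') * g = (X ^ N * f - q * g) + (X ^ N * f' - q' * g) := by ring
  rw [this]
  exact (natDegree_add_le _ _).trans (max_le_max hq hq')

theorem DD.mul {f g : A[X]} (u : A[X]) (h : DD f g) : DD (u * f) g := by
  obtain ⟨M, h⟩ := h
  refine ⟨u.natDegree + M, fun N => ?_⟩
  obtain ⟨q, hq⟩ := h N
  refine ⟨u * q, ?_⟩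
  have : X ^ N * (u * f) - (u * q) * g = u * (X ^ N * f - q * g) := by ring
  rw [this]
  exact natDegree_mul_le.trans (by omega)

theorem DD.self (g : A[X]) : DD g g := ⟨0, fun N => ⟨X ^ N, by simp⟩⟩

theorem DD.cancel {f g h : A[X]} (hh : h ≠ 0) (H : DD (h * f) (h * g)) : DD f g := by
  obtain ⟨M, H⟩ := H
  refine ⟨M, fun N => ?_⟩
  obtain ⟨q, hq⟩ := H N
  refine ⟨q, ?_⟩
  have : X ^ N * (h * f) - q * (h * g) = h * (X ^ N * f - q * g) := by ring
  rw [this] at hq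
  by_cases h0 : X ^ N * f - q * g = 0
  · rw [h0]; simp
  · rw [natDegree_mul hh h0] at hq; omega

theorem DD.dvd {f g : A[X]} {p : A} (hp : C p ∣ g) (H : DD f g) : C p ∣ f := by
  obtain ⟨M, H⟩ := H
  obtain ⟨q, hq⟩ := H (M + 1)
  obtain ⟨g', rfl⟩ := hp
  rw [C_dvd_iff_dvd_coeff]
  intro i
  have h1 : (X ^ (M + 1) * f - q * (C p * g')).coeff (i + (M + 1)) = 0 :=
    coeff_eq_zero_of_natDegree_lt (by omega)
  have h2 : q * (C p * g') = C p * (q * g') := by ring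
  rw [coeff_sub, coeff_X_pow_mul, h2, coeff_C_mul, sub_eq_zero] at h1
  exact ⟨_, h1⟩

theorem DD.descend {g : A[X]} {p c : A} (hp : Prime p) (hg : ¬ C p ∣ g) (H : DD (C (p * c)) g) :
    DD (C c) g := by
  obtain ⟨M, H⟩ := H
  refine ⟨M + g.natDegree, fun N => ?_⟩
  obtain ⟨q, hq⟩ := H N
  have hpI : (Ideal.span {p}).IsPrime := (Ideal.span_singleton_prime hp.ne_zero).2 hp
  have zero_iff : ∀ a : A, Ideal.Quotient.mk (Ideal.span {p}) a = 0 ↔ p ∣ a := by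
    intro a; rw [Ideal.Quotient.eq_zero_iff_mem, Ideal.mem_span_singleton]
  let π := Ideal.Quotient.mk (Ideal.span {p})
  have hgπ : g.map π ≠ 0 := by
    intro h
    apply hg
    rw [C_dvd_iff_dvd_coeff]
    intro i
    rw [← zero_iff]
    have := congrArg (fun x => coeff x i) h
    simpa [coeff_map] using this
  have hdeg : (q.map π).natDegree ≤ M := by
    by_cases h0 : q.map π = 0
    · rw [h0]; simp
    have h1 : (X ^ N * C (p * c) - q * g).map π = - (q.map π * g.map π) := by
      have : π p = 0 := (zero_iff p).2 dvd_rfl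
      simp [this]
    have h2 : (q.map π * g.map π).natDegree ≤ M := by
      rw [← natDegree_neg, ← h1]
      exact natDegree_map_le.trans hq
    rw [natDegree_mul h0 hgπ] at h2
    omega
  -- truncate
  let t : A[X] := ∑ i ∈ Finset.range (M + 1), monomial i (q.coeff i)
  have htc : ∀ i, t.coeff i = if i < M + 1 then q.coeff i else 0 := by
    intro i
    simp only [t, finsetSum_coeff, coeff_monomial]
    simp
  have htd : t.natDegree ≤ M := by
    rw [natDegree_le_iff_coeff_eq_zero]
    intro i hi
    rw [htc, if_neg (by omega)]
  have hdvd : C p ∣ q - t := by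
    rw [C_dvd_iff_dvd_coeff]
    intro i
    rw [coeff_sub, htc]
    split_ifs with h
    · simp
    · rw [sub_zero, ← zero_iff]
      have : (q.map π).coeff i = 0 := coeff_eq_zero_of_natDegree_lt (by omega)
      rwa [coeff_map] at this
  obtain ⟨q', hq'⟩ := hdvd
  refine ⟨q', ?_⟩
  have e : C p * (X ^ N * C c - q' * g) = (X ^ N * C (p * c) - q * g) + t * g := by
    rw [C_mul]
    linear_combination g * hq'
  have h3 : (C p * (X ^ N * C c - q' * g)).natDegree ≤ M + g.natDegree := by
    rw [e]
    refine (natDegree_add_le _ _).trans (max_le (by omega) ?_)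
    exact natDegree_mul_le.trans (by omega)
  rwa [natDegree_C_mul hp.ne_zero] at h3

theorem DD.one {g : A[X]} (H : DD 1 g) : ∃ m : A[X], m.Monic ∧ g ∣ m := by
  obtain ⟨M, H⟩ := H
  obtain ⟨q, hq⟩ := H (M + 1)
  refine ⟨X ^ (M + 1) - (X ^ (M + 1) * 1 - q * g), ?_, q, by ring⟩
  apply monic_X_pow_sub
  refine lt_of_le_of_lt degree_le_natDegree ?_
  exact_mod_cast Nat.lt_succ_of_le hq

theorem DD.main1 [UniqueFactorizationMonoid A] (c : A) (hc : c ≠ 0) : ∀ f g : A[X], g ≠ 0 →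
    DD (C c) g → DD f g → ∃ m : A[X], m.Monic ∧ g ∣ m * f := by
  induction c using UniqueFactorizationMonoid.induction_on_prime with
  | h₁ => exact absurd rfl hc
  | h₂ u hu =>
    intro f g hg h _
    obtain ⟨v, hv⟩ := hu.exists_left_inv
    have h1 : DD 1 g := by
      have := h.mul (C v)
      rwa [← C_mul, hv, C_1] at this
    obtain ⟨m, hm, hd⟩ := h1.one
    exact ⟨m, hm, hd.mul_right _⟩
  | h₃ c p hc0 hp ih =>
    intro f g hg h hf
    by_cases hpg : C p ∣ g
    · obtain ⟨f', rfl⟩ := hf.dvd hpg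
      obtain ⟨g', rfl⟩ := hpg
      have hp0 : (C p : A[X]) ≠ 0 := C_ne_zero.2 hp.ne_zero
      rw [C_mul] at h
      obtain ⟨m, hm, hd⟩ := ih hc0 f' g' (right_ne_zero_of_mul hg) (h.cancel hp0) (hf.cancel hp0)
      refine ⟨m, hm, ?_⟩
      rw [mul_left_comm]
      exact mul_dvd_mul_left _ hd
    · exact ih hc0 f g hg (h.descend hp hpg) hf

theorem red_lt {f h : A[X]} (hf : f ≠ 0) (hh : h ≠ 0) (hle : h.natDegree ≤ f.natDegree) :
    (C h.leadingCoeff * f - C f.leadingCoeff * X ^ (f.natDegree - h.natDegree) * h).degree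
      < f.degree := by
  have h1 : (C h.leadingCoeff * f).degree = f.degree := degree_C_mul (leadingCoeff_ne_zero.2 hh)
  rw [← h1]
  apply degree_sub_lt_left
  · rw [h1, mul_assoc, degree_C_mul (leadingCoeff_ne_zero.2 hf), degree_mul, degree_X_pow,
      degree_eq_natDegree hf, degree_eq_natDegree hh]
    norm_cast; omega
  · exact mul_ne_zero (C_ne_zero.2 (leadingCoeff_ne_zero.2 hh)) hf
  · simp [leadingCoeff_mul]; ring

theorem pseudo {h : A[X]} (J : Ideal A[X]) (hJ : h ∈ J) (hh : h ≠ 0)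
    (hmin : ∀ x ∈ J, x ≠ 0 → h.natDegree ≤ x.natDegree) :
    ∀ (k : ℕ) (f : A[X]), f ∈ J → f.degree < k → ∃ a : A, a ≠ 0 ∧ h ∣ C a * f := by
  intro k
  induction k with
  | zero =>
    intro f hf hk
    have : f = 0 := by
      rw [← degree_eq_bot]; exact (Nat.WithBot.lt_zero_iff).1 (by exact_mod_cast hk)
    exact ⟨1, one_ne_zero, by simp [this]⟩
  | succ k ih =>
    intro f hf hk
    by_cases h0 : f = 0
    · exact ⟨1, one_ne_zero, by simp [h0]⟩
    have hlt := red_lt h0 hh (hmin f hf h0)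
    obtain ⟨a, ha, hd⟩ := ih _ (J.sub_mem (J.mul_mem_left _ hf) (J.mul_mem_left _ hJ))
      (lt_of_lt_of_le hlt (by
        rw [degree_eq_natDegree h0] at hk ⊢
        norm_cast at hk ⊢; omega))
    refine ⟨a * h.leadingCoeff, mul_ne_zero ha (leadingCoeff_ne_zero.2 hh), ?_⟩
    have : C (a * h.leadingCoeff) * f = C a * (C h.leadingCoeff * f -
        C f.leadingCoeff * X ^ (f.natDegree - h.natDegree) * h) +
        (C a * C f.leadingCoeff * X ^ (f.natDegree - h.natDegree)) * h := by
      rw [C_mul]; ring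
    rw [this]
    exact dvd_add hd (dvd_mul_left _ _)

theorem prim_dvd [UniqueFactorizationMonoid A] {d f : A[X]} (hd : d.IsPrimitive) {a : A}
    (ha : a ≠ 0) (h : d ∣ C a * f) : d ∣ f := by
  have hr : IsRelPrime d (C a) := by
    intro e he1 he2
    have hdeg : e.natDegree = 0 := by
      have := natDegree_le_of_dvd he2 (C_ne_zero.2 ha)
      simpa using this
    rw [natDegree_eq_zero] at hdeg
    obtain ⟨x, rfl⟩ := hdeg
    exact (hd x he1).map C
  exact hr.dvd_of_dvd_mul_left h

theorem DD.main [UniqueFactorizationMonoid A] (f g : A[X]) (hg : g ≠ 0) (H : DD f g) :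
    ∃ m : A[X], m.Monic ∧ g ∣ m * f := by
  classical
  let J : Ideal A[X] := Ideal.span {f, g}
  have hfJ : f ∈ J := Ideal.subset_span (by simp)
  have hgJ : g ∈ J := Ideal.subset_span (by simp)
  have hex : ∃ k, ∃ y ∈ J, y ≠ 0 ∧ y.natDegree = k := ⟨_, g, hgJ, hg, rfl⟩
  obtain ⟨h, hJ, hh, hN⟩ := Nat.find_spec hex
  have hmin : ∀ x ∈ J, x ≠ 0 → h.natDegree ≤ x.natDegree := by
    intro x hx hx0
    rw [hN]
    exact Nat.find_min' hex ⟨x, hx, hx0, rfl⟩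
  let _ : NormalizedGCDMonoid A := Classical.choice inferInstance
  have hc := h.eq_C_content_mul_primPart
  set c := h.content
  set d := h.primPart
  have hdp : d.IsPrimitive := h.isPrimitive_primPart
  have hall : ∀ x ∈ J, d ∣ x := by
    intro x hx
    obtain ⟨a, ha, hd⟩ := pseudo J hJ hh hmin (x.natDegree + 1) x hx
      (lt_of_le_of_lt degree_le_natDegree (by exact_mod_cast Nat.lt_succ_self _))
    exact prim_dvd hdp ha ((Dvd.intro_left _ hc.symm).trans hd)
  obtain ⟨f', hf'⟩ := hall f hfJ
  obtain ⟨g', hg'⟩ := hall g hgJ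
  have hd0 : d ≠ 0 := by rintro h0; rw [h0] at hc; simp at hc; exact hh hc
  have hc0 : c ≠ 0 := by rintro h0; rw [h0] at hc; simp at hc; exact hh hc
  obtain ⟨u, v, huv⟩ := Ideal.mem_span_pair.1 hJ
  have hcu : C c = u * f' + v * g' := by
    apply mul_left_cancel₀ hd0
    rw [mul_comm, ← hc, ← huv]
    nth_rewrite 1 [hf']
    nth_rewrite 1 [hg']
    ring
  rw [hf', hg'] at H
  have H' := H.cancel hd0
  have hg0 : g' ≠ 0 := by rintro rfl; rw [mul_zero] at hg'; exact hg hg'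
  have hDc : DD (C c) g' := by rw [hcu]; exact (H'.mul u).add ((DD.self g').mul v)
  obtain ⟨m, hm, hd⟩ := DD.main1 c hc0 f' g' hg0 hDc H'
  refine ⟨m, hm, ?_⟩
  rw [hf', hg', mul_left_comm]
  exact mul_dvd_mul_left _ hd

theorem reduce_or_DD (N : A → ℕ) (hN : ∀ a b : A, b ≠ 0 → ∃ q, a - q * b = 0 ∨ N (a - q * b) < N b)
    (f g : A[X]) (hg : g ≠ 0) :
    (∃ (k : ℕ) (q : A[X]), N (X ^ k * f - q * g).leadingCoeff < N g.leadingCoeff) ∨ DD f g := by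
  classical
  by_contra hcon
  push Not at hcon
  obtain ⟨h1, h2⟩ := hcon
  apply h2
  refine ⟨g.natDegree, fun k => ?_⟩
  have hex : ∃ t, ∃ q : A[X], (X ^ k * f - q * g).natDegree = t := ⟨_, 0, rfl⟩
  obtain ⟨q, hq⟩ := Nat.find_spec hex
  refine ⟨q, ?_⟩
  by_contra hlt
  push Not at hlt
  set r := X ^ k * f - q * g with hr
  have hr0 : r ≠ 0 := by rintro h0; rw [h0] at hlt; simp at hlt
  obtain ⟨c, hc⟩ := hN r.leadingCoeff g.leadingCoeff (leadingCoeff_ne_zero.2 hg)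
  set e := r.natDegree - g.natDegree with he
  have hs : X ^ k * f - (q + C c * X ^ e) * g = r - C c * X ^ e * g := by rw [hr]; ring
  have hdl : (C c * X ^ e * g).natDegree ≤ r.natDegree := by
    refine natDegree_mul_le.trans ?_
    have := natDegree_C_mul_X_pow_le c e
    omega
  have hle : (r - C c * X ^ e * g).natDegree ≤ r.natDegree :=
    (natDegree_sub_le _ _).trans (max_le le_rfl hdl)
  have hco : (r - C c * X ^ e * g).coeff r.natDegree = r.leadingCoeff - c * g.leadingCoeff := by
    have : r.natDegree = g.natDegree + e := by omega
    rw [coeff_sub, mul_assoc, coeff_C_mul, coeff_natDegree, mul_comm (X ^ e) g]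
    rw [this, coeff_mul_X_pow, coeff_natDegree]
  by_cases hz : r.leadingCoeff - c * g.leadingCoeff = 0
  · have hlt' : (r - C c * X ^ e * g).natDegree < r.natDegree := by
      refine lt_of_le_of_ne hle ?_
      intro heq
      rw [hz, ← heq, coeff_natDegree, leadingCoeff_eq_zero] at hco
      rw [hco] at heq
      simp at heq; omega
    rw [hq] at hlt'
    exact Nat.find_min hex hlt' ⟨q + C c * X ^ e, by rw [hs]⟩
  · have hd : (r - C c * X ^ e * g).natDegree = r.natDegree := by
      refine le_antisymm hle (le_natDegree_of_ne_zero ?_)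
      rw [hco]; exact hz
    have hlc : (r - C c * X ^ e * g).leadingCoeff = r.leadingCoeff - c * g.leadingCoeff := by
      rw [leadingCoeff, hd, hco]
    have := h1 k (q + C c * X ^ e)
    rw [hs, hlc] at this
    rcases hc with hc | hc
    · exact hz hc
    · omega

/-- monic polynomials -/
def Mon (A : Type*) [CommRing A] : Submonoid A[X] where
  carrier := {f | f.Monic}
  one_mem' := monic_one
  mul_mem' := fun ha hb => Monic.mul ha hb

/-- `A⟨X⟩` -/
abbrev AX (A : Type*) [CommRing A] : Type _ := Localization (Mon A)

theorem Mon_nzd : Mon A ≤ nonZeroDivisors A[X] := fun f hf =>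
  mem_nonZeroDivisors_of_ne_zero (Monic.ne_zero (show f.Monic from hf))

theorem AX_domain : IsDomain (AX A) := IsLocalization.isDomain_localization Mon_nzd

theorem AX_inj : Function.Injective (algebraMap A[X] (AX A)) := IsLocalization.injective _ Mon_nzd

theorem lc_sec (x : AX A) (f m : A[X]) (hm : m.Monic)
    (h : x * algebraMap A[X] (AX A) m = algebraMap A[X] (AX A) f) :
    (IsLocalization.sec (Mon A) x).1.leadingCoeff = f.leadingCoeff := by
  have h1 := IsLocalization.sec_spec (Mon A) x
  set y := IsLocalization.sec (Mon A) x
  have hy : y.2.1.Monic := y.2.2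
  have h2 : y.1 * m = f * y.2.1 := by
    apply AX_inj
    rw [map_mul, map_mul, ← h1, ← h]; ring
  have h3 := congrArg leadingCoeff h2
  rwa [leadingCoeff_mul_monic hm, leadingCoeff_mul_monic hy] at h3

theorem AX_eucl (H : EuclProp A) : EuclProp (AX A) := by
  have := H.pid
  obtain ⟨N, hN⟩ := H
  have := AX_domain (A := A)
  refine ⟨fun x => N (IsLocalization.sec (Mon A) x).1.leadingCoeff, fun a b hb => ?_⟩
  obtain ⟨⟨f, m⟩, ha⟩ := IsLocalization.surj (Mon A) a
  obtain ⟨⟨g, m'⟩, hb'⟩ := IsLocalization.surj (Mon A) b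
  simp only at ha hb'
  have um : IsUnit (algebraMap A[X] (AX A) m.1) := IsLocalization.map_units (AX A) m
  have um' : IsUnit (algebraMap A[X] (AX A) m'.1) := IsLocalization.map_units (AX A) m'
  have hg : g ≠ 0 := by
    rintro rfl
    rw [map_zero] at hb'
    exact hb ((um'.mul_left_eq_zero).1 hb')
  rcases reduce_or_DD N hN f g hg with ⟨k, q, hlt⟩ | hD
  · have hmk : (X ^ k * m.1 : A[X]).Monic := (monic_X_pow k).mul m.2
    obtain ⟨w, hw⟩ := (IsLocalization.map_units (AX A) (⟨_, hmk⟩ : Mon A)).exists_left_inv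
    simp only at hw
    refine ⟨w * algebraMap _ _ (q * m'.1), Or.inr ?_⟩
    have h1 := lc_sec (a - w * algebraMap _ _ (q * m'.1) * b) (X ^ k * f - q * g) _ hmk (by
      simp only [map_sub, map_mul, ← ha, ← hb'] at hw ⊢
      linear_combination (-(algebraMap A[X] (AX A) q * algebraMap A[X] (AX A) m'.1 * b)) * hw)
    have h2 := lc_sec b g _ m'.2 hb'
    simp only [h1, h2]; exact hlt
  · obtain ⟨μ, hμ, t, ht⟩ := DD.main f g hg hD
    obtain ⟨w, hw⟩ := (IsLocalization.map_units (AX A) (⟨_, hμ.mul m.2⟩ : Mon A)).exists_left_inv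
    refine ⟨w * algebraMap _ _ (m'.1 * t), Or.inl ?_⟩
    simp only at hw
    have ht' := congrArg (algebraMap A[X] (AX A)) ht
    rw [map_mul, map_mul, ← ha, ← hb'] at ht'
    rw [map_mul] at hw ⊢
    linear_combination (-a) * hw + w * ht'

end Euclid

end Part10

section Part11
set_option linter.unusedSimpArgs false
set_option linter.unusedSectionVars false

universe u

open scoped commutatorElement

theorem El_top_of_surj {n : ℕ} {R S : Type*} [CommRing R] [CommRing S] (e : R ≃+* S)
    (h : El n R = ⊤) : El n S = ⊤ := by
  rw [eq_top_iff]
  intro g _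
  have h1 : sm (e.symm : S →+* R) g ∈ El n R := by rw [h]; trivial
  have := sm_mem_El (e : R →+* S) h1
  rw [sm_sm] at this
  convert this
  apply SLext
  ext i j
  exact (e.apply_symm_apply _).symm

theorem El_mvPolynomial {n : ℕ} [NeZero n] (hn : 3 ≤ n) (k : ℕ) :
    ∀ (A : Type u) [CommRing A] [IsDomain A], EuclProp A → El n (MvPolynomial (Fin k) A) = ⊤ := by
  induction k with
  | zero =>
    intro A _ _ H
    exact El_top_of_surj (MvPolynomial.isEmptyRingEquiv A (Fin 0)).symm (El_eq_top_of_eucl H)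
  | succ k ih =>
    intro A _ _ H
    have := AX_domain (A := A)
    have hIH := ih (AX A) (AX_eucl H)
    apply El_top_of_surj (MvPolynomial.finSuccEquiv A k).symm.toRingEquiv
    rw [eq_top_iff]
    intro α _
    apply monic_inversion hn
    let g0 : Polynomial A →+* QQ (MvPolynomial (Fin k) A) := (qX (MvPolynomial (Fin k) A)).comp (Polynomial.mapRingHom MvPolynomial.C)
    have hg0 : ∀ m : Mon A, IsUnit (g0 m) := fun m =>
      monic_unit _ (Polynomial.Monic.map _ m.2)
    let g1 : AX A →+* QQ (MvPolynomial (Fin k) A) := IsLocalization.lift hg0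
    let g2 : MvPolynomial (Fin k) (AX A) →+* QQ (MvPolynomial (Fin k) A) :=
      MvPolynomial.eval₂Hom g1 (fun i => qX (MvPolynomial (Fin k) A) (Polynomial.C (MvPolynomial.X i)))
    let g3 : Polynomial (MvPolynomial (Fin k) A) →+* MvPolynomial (Fin k) (AX A) :=
      Polynomial.eval₂RingHom
        (MvPolynomial.map ((algebraMap (Polynomial A) (AX A)).comp Polynomial.C))
        (MvPolynomial.C (algebraMap (Polynomial A) (AX A) Polynomial.X))
    have hcomp : qX (MvPolynomial (Fin k) A) = g2.comp g3 := by
      apply Polynomial.ringHom_ext'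
      · apply MvPolynomial.ringHom_ext
        · intro a
          simp [g2, g3, g1, g0]
        · intro i
          simp [g2, g3]
      · simp [g2, g3, g1, g0]
    have h1 : (sm g3 α : Matrix.SpecialLinearGroup (Fin n) (MvPolynomial (Fin k) (AX A))) ∈
        El n (MvPolynomial (Fin k) (AX A)) := by rw [hIH]; trivial
    have h2 := sm_mem_El g2 h1
    rw [sm_sm] at h2
    rw [hcomp]; exact h2

theorem eucl_int : EuclProp ℤ := by
  refine ⟨Int.natAbs, fun a b hb => ⟨a / b, Or.inr ?_⟩⟩
  have h1 : a - a / b * b = a % b := by rw [Int.emod_def]; ring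
  rw [h1]
  have h2 := Int.emod_nonneg a hb
  have h3 := Int.emod_lt_abs a hb
  rw [Int.abs_eq_natAbs] at h3
  omega

theorem El_int (d k : ℕ) (hd : 3 ≤ d) : El d (MvPolynomial (Fin k) ℤ) = ⊤ := by
  have : NeZero d := ⟨by omega⟩
  exact El_mvPolynomial hd k ℤ eucl_int

theorem perfect_of_El {d : ℕ} {R : Type*} [CommRing R] (hd : 3 ≤ d) (h : El d R = ⊤) :
    commutator (Matrix.SpecialLinearGroup (Fin d) R) = ⊤ := by
  rw [eq_top_iff, ← h]
  have key : ∀ (i j : Fin d) (hij : i ≠ j) (r : R), elem i j hij r ∈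
      commutator (Matrix.SpecialLinearGroup (Fin d) R) := by
    intro i j hij r
    obtain ⟨l, hl1, hl2⟩ : ∃ l : Fin d, l ≠ i ∧ l ≠ j := by
      have : ∃ l ∈ (Finset.univ : Finset (Fin d)), l ∉ ({i, j} : Finset (Fin d)) := by
        apply Finset.exists_mem_notMem_of_card_lt_card
        refine lt_of_le_of_lt Finset.card_le_two ?_
        simp; omega
      obtain ⟨l, _, hl⟩ := this
      simp at hl
      exact ⟨l, hl.1, hl.2⟩
    have e := elem_commutator i l j (Ne.symm hl1) hl2 hij r 1
    rw [mul_one] at e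
    have e' : elem i j hij r = ⁅elem i l (Ne.symm hl1) r, elem l j hl2 (1 : R)⁆ := by
      rw [commutatorElement_def, e]; group
    rw [e']
    exact Subgroup.commutator_mem_commutator (Subgroup.mem_top _) (Subgroup.mem_top _)
  unfold El
  rw [Subgroup.closure_le]
  rintro _ ⟨i, j, hij, r, rfl⟩
  exact key i j hij r

theorem central_comm {G : Type*} [Group G] {a b z w : G} (hz : z ∈ Subgroup.center G)
    (hw : w ∈ Subgroup.center G) : ⁅a * z, b * w⁆ = ⁅a, b⁆ := by
  have cz := Subgroup.mem_center_iff.1 hz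
  have cw := Subgroup.mem_center_iff.1 hw
  rw [commutatorElement_def, commutatorElement_def]
  calc a * z * (b * w) * (a * z)⁻¹ * (b * w)⁻¹
      = a * (z * (b * w)) * z⁻¹ * a⁻¹ * (b * w)⁻¹ := by group
    _ = a * b * (w * a⁻¹) * w⁻¹ * b⁻¹ := by rw [← cz]; group
    _ = a * b * a⁻¹ * b⁻¹ := by rw [← cw]; group

theorem finite_of_perfect {G : Type*} [Group G] (hp : commutator G = ⊤) (Z : Subgroup G)
    (hZ : Z ≤ Subgroup.center G) (hf : Z.FiniteIndex) : Finite G := by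
  have hfin : Finite (commutatorSet G) := by
    have : Finite (G ⧸ Z) := Subgroup.finite_quotient_of_finiteIndex
    let F : (G ⧸ Z) × (G ⧸ Z) → G := fun p => ⁅p.1.out, p.2.out⁆
    refine Set.Finite.subset (Set.finite_range F) ?_
    rintro _ ⟨a, b, rfl⟩
    refine ⟨((a : G ⧸ Z), (b : G ⧸ Z)), ?_⟩
    obtain ⟨z, hz⟩ := QuotientGroup.mk_out_eq_mul Z a
    obtain ⟨w, hw⟩ := QuotientGroup.mk_out_eq_mul Z b
    change ⁅(a : G ⧸ Z).out, (b : G ⧸ Z).out⁆ = _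
    rw [hz, hw, central_comm (hZ z.2) (hZ w.2)]
  have : Finite (commutator G) := inferInstance
  rw [hp] at this
  exact Finite.of_equiv _ Subgroup.topEquiv.toEquiv

end Part11

/-- For `d ≥ 3`, `R = ℤ[x₁,…,x_k]` and an ideal `U` of finite index,
`G(U)/EL(d;U)` is finite and central in `SL_d(R)/EL(d;U)`: every commutator of an element
of `SL_d(R)` with an element of `G(U)` lies in `EL(d;U)`. -/
theorem SK1_finite_and_central (d k : ℕ) (hd : 3 ≤ d)
    (U : Ideal (MvPolynomial (Fin k) ℤ)) (hU : Finite (MvPolynomial (Fin k) ℤ ⧸ U)) :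
    Finite ((congSubgroup d U : Subgroup _) ⧸ ((EL d U).subgroupOf (congSubgroup d U))) ∧
      ∀ g : Matrix.SpecialLinearGroup (Fin d) (MvPolynomial (Fin k) ℤ),
        ∀ h ∈ congSubgroup d U, g * h * g⁻¹ * h⁻¹ ∈ EL d U := by
  have hE := El_int d k hd
  have hcent : ∀ g : Matrix.SpecialLinearGroup (Fin d) (MvPolynomial (Fin k) ℤ),
        ∀ h ∈ congSubgroup d U, g * h * g⁻¹ * h⁻¹ ∈ EL d U := fun g h hh =>
    relative_comm hd U g h (by rw [hE]; trivial) hh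
  refine ⟨?_, hcent⟩
  have hnorm : (EL d U).Normal := Subgroup.normalClosure_normal
  have hsurj := QuotientGroup.mk'_surjective (EL d U)
  have hfin : Finite (Matrix.SpecialLinearGroup (Fin d) (MvPolynomial (Fin k) ℤ) ⧸ EL d U) := by
    refine finite_of_perfect ?_ ((congSubgroup d U).map (QuotientGroup.mk' (EL d U))) ?_ ?_
    · have h1 := congrArg (Subgroup.map (QuotientGroup.mk' (EL d U))) (perfect_of_El hd hE)
      rw [commutator_def, Subgroup.map_commutator, ← MonoidHom.range_eq_map,
        MonoidHom.range_eq_top.2 hsurj] at h1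
      exact h1
    · rintro _ ⟨h, hh, rfl⟩
      rw [Subgroup.mem_center_iff]
      intro x
      obtain ⟨g, rfl⟩ := hsurj x
      have := (QuotientGroup.eq_one_iff _).2 (hcent g h hh)
      change QuotientGroup.mk' (EL d U) (g * h * g⁻¹ * h⁻¹) = 1 at this
      rw [map_mul, map_mul, map_mul, map_inv, map_inv] at this
      rw [mul_inv_eq_one, mul_inv_eq_iff_eq_mul] at this
      exact this
    · have hfs : Finite (Matrix.SpecialLinearGroup (Fin d) (MvPolynomial (Fin k) ℤ ⧸ U)) :=
        Subtype.finite
      have h1 : (congSubgroup d U).FiniteIndex := Subgroup.finiteIndex_ker _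
      refine ⟨fun h0 => h1.index_ne_zero ?_⟩
      have h2 := Subgroup.index_map_dvd (congSubgroup d U) hsurj
      rw [h0] at h2
      exact zero_dvd_iff.1 h2
  have : (EL d U).FiniteIndex := Subgroup.finiteIndex_of_finite_quotient
  exact Subgroup.finite_quotient_of_finiteIndex
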